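/- arXiv:1911.08887 — 2 statements merged into one kernel-verified Lean document; each statement's English description precedes it below -/
import Mathlib

section
/- For every integer k ≥ 2 and every constant γ > 0 there exist c > 0 and n₀ ∈ ℕ such that for all n ≥ n₀ the following holds. Let G be an (n,k,γ)-graph and let S be an ordered (k−1)-tuple of distinct vertices of G. Then there exists a set 𝒫 of √n-paths in G such that: (i) |𝒫| ≥ (cn)^{√n}; (ii) S is an end of each P ∈ 𝒫; and (iii) if P ∈ 𝒫 and T is the end of P other than S, then G′ := G − (V(P) \ T) satisfies δ(G′) ≥ (1/2 + γ − n^{−2/3})(n − √n). -/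
open scoped Classical

set_option linter.unusedSectionVars false

/-- Extend a finite sequence to `ℕ` by a default value. -/
def extSeq {V : Type} [Inhabited V] {M : ℕ} (u : Fin M → V) (i : ℕ) : V :=
  if h : i < M then u ⟨i, h⟩ else default

/-- The first `j` terms of `X` followed by `Y`. -/
def appSeq {V : Type} (j : ℕ) (X Y : ℕ → V) (i : ℕ) : V :=
  if i < j then X i else Y (i - j)

/-- The set of the `j` consecutive terms of `s` starting at position `a`. -/
def window {V : Type} [DecidableEq V] (s : ℕ → V) (a j : ℕ) : Finset V :=
  (Finset.range j).image fun i => s (a + i)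

/-- The first `N` terms of `s` form a tight walk in the link of `Z`. -/
def IsTightWalk {V : Type} [DecidableEq V] (E : Finset (Finset V)) (Z : Finset V) (j N : ℕ)
    (s : ℕ → V) : Prop :=
  ∀ i, i + (j + 1) ≤ N → window s i (j + 1) ∪ Z ∈ E

/-- The interiors, of length `M`, of the tight walks from `X` to `Y` in the link of `Z`. -/
noncomputable def connectors {V : Type} [Fintype V] [DecidableEq V] [Inhabited V]
    (E : Finset (Finset V)) (Z : Finset V) (j M : ℕ) (X Y : ℕ → V) : Finset (Fin M → V) :=
  Finset.univ.filter fun u => IsTightWalk E Z j (j + M + j) (appSeq j X (appSeq M (extSeq u) Y))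

/-- The vertices completing `S` to an edge. -/
def nbrs {V : Type} [Fintype V] [DecidableEq V] (E : Finset (Finset V)) (S : Finset V) :
    Finset V :=
  Finset.univ.filter fun v => insert v S ∈ E

lemma appSeq_cons_succ {V : Type} [Inhabited V] (j M : ℕ) (X Y : ℕ → V) (v : V) (u : Fin M → V) (i : ℕ) :
    appSeq j X (appSeq (M + 1) (extSeq (Fin.cons v u : Fin (M + 1) → V)) Y) (i + 1) =
      appSeq j (fun i => appSeq j X (fun _ => v) (i + 1)) (appSeq M (extSeq u) Y) i := by
  unfold appSeq extSeq
  by_cases h1 : i + 1 < j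
  · simp [h1, show i < j by omega]
  by_cases h2 : i < j
  · simp [h2, show i + 1 = j by omega]
  obtain ⟨t, rfl⟩ : ∃ t, i = j + t := ⟨i - j, by omega⟩
  have e1 : j + t + 1 - j = t + 1 := by omega
  have e2 : j + t - j = t := by omega
  simp only [h1, h2, e1, e2, if_false]
  by_cases h3 : t < M
  · simp [h3]
    rfl
  · simp [h3]

section Connecting

variable {V : Type} [DecidableEq V]

lemma window_congr {s t : ℕ → V} {a b j : ℕ} (h : ∀ i < j, s (a + i) = t (b + i)) :
    window s a j = window t b j := by
  unfold window
  exact Finset.image_congr fun i hi => h i (by simpa using hi)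

lemma card_window_le (s : ℕ → V) (a j : ℕ) : (window s a j).card ≤ j := by
  exact Finset.card_image_le.trans (Finset.card_range j).le

lemma window_succ_last (s : ℕ → V) (a j : ℕ) :
    window s a (j + 1) = insert (s (a + j)) (window s a j) := by
  simp [window, Finset.range_add_one]

lemma window_succ_first (s : ℕ → V) (a j : ℕ) :
    window s a (j + 1) = insert (s a) (window s (a + 1) j) := by
  ext x
  simp only [window, Finset.mem_image, Finset.mem_range, Finset.mem_insert]
  constructor
  · rintro ⟨i, hi, rfl⟩
    rcases i with _ | i
    · simp
    · exact Or.inr ⟨i, by omega, by congr 1; omega⟩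
  · rintro (rfl | ⟨i, hi, rfl⟩)
    · exact ⟨0, by omega, by simp⟩
    · exact ⟨i + 1, by omega, by congr 1; omega⟩

variable [Inhabited V] [Fintype V]

lemma connectors_extend {E : Finset (Finset V)} {d : ℕ} (hE : ∀ e ∈ E, e.card = d + 1)
    {γ : ℝ} (hγ : 0 < γ)
    (hδ : ∀ S : Finset V, S.card = d → (1 / 2 + γ) * (Fintype.card V : ℝ) ≤ (nbrs E S).card)
    {Z : Finset V} {j M : ℕ} (hZ : Z.card + j = d) {c : ℝ} (hc : 0 < c) {Y : ℕ → V}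
    (h : ∀ X : ℕ → V, (window X 0 j ∪ Z).card = d →
      c * (Fintype.card V : ℝ) ^ M ≤ (connectors E Z j M X Y).card)
    (X : ℕ → V) (hX : (window X 0 j ∪ Z).card = d) :
    c / 2 * (Fintype.card V : ℝ) ^ (M + 1) ≤ (connectors E Z j (M + 1) X Y).card := by
  set N := (Fintype.card V : ℝ)
  have hN : 0 ≤ N := Nat.cast_nonneg _
  set Nb := nbrs E (window X 0 j ∪ Z)
  let Xv : V → ℕ → V := fun v i => appSeq j X (fun _ => v) (i + 1)
  have hw : ∀ v, window (appSeq j X (fun _ => v)) 0 (j + 1) = insert v (window X 0 j) := by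
    intro v
    rw [window_succ_last]
    have : window (appSeq j X fun _ => v) 0 j = window X 0 j :=
      window_congr fun i hi => by simp [appSeq, hi]
    rw [this]; simp [appSeq]
  have hval : ∀ v ∈ Nb, (window (Xv v) 0 j ∪ Z).card = d := by
    intro v hv
    have hv' : insert v (window X 0 j ∪ Z) ∈ E := by simpa [Nb, nbrs] using hv
    have h1 : window (Xv v) 0 j = window (appSeq j X fun _ => v) 1 j :=
      window_congr fun i hi => by simp [Xv, add_comm]
    have h2 := hE _ hv'
    rw [← Finset.insert_union, ← hw, window_succ_first, zero_add, ← h1, Finset.insert_union] at h2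
    have h3 := Finset.card_insert_le (appSeq j X (fun _ => v) 0) (window (Xv v) 0 j ∪ Z)
    have h4 := Finset.card_union_le (window (Xv v) 0 j) Z
    have h5 := card_window_le (Xv v) 0 j
    omega
  have hle : (Nb.sigma fun v => connectors E Z j M (Xv v) Y).card ≤
      (connectors E Z j (M + 1) X Y).card := by
    apply Finset.card_le_card_of_injOn (fun a => (Fin.cons a.1 a.2 : Fin (M + 1) → V))
    · rintro ⟨v, u⟩ hvu
      simp only [Finset.coe_sigma, Set.mem_sigma_iff, Finset.mem_coe] at hvu
      obtain ⟨hv, hu⟩ := hvu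
      simp only [connectors, Finset.mem_filter, Finset.mem_univ, true_and, Finset.mem_coe] at hu ⊢
      intro i hi
      rcases i with _ | i
      · have hv' : insert v (window X 0 j ∪ Z) ∈ E := by simpa [Nb, nbrs] using hv
        rw [← Finset.insert_union, ← hw] at hv'
        convert hv' using 2
        apply window_congr
        intro i hi
        by_cases hij : i < j
        · simp [appSeq, hij]
        · have : i = j := by omega
          subst this
          simp [appSeq, extSeq]
      · have := hu i (by omega)
        convert this using 2
        apply window_congr
        intro t ht
        rw [show i + 1 + t = i + t + 1 by ring, appSeq_cons_succ]
    · rintro ⟨v, u⟩ - ⟨v', u'⟩ - heq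
      simp only at heq
      have := Fin.cons_injective2 heq
      simp [this.1, this.2]
  have hcast : (∑ v ∈ Nb, ((connectors E Z j M (Xv v) Y).card : ℝ)) ≤
      (connectors E Z j (M + 1) X Y).card := by
    rw [Finset.card_sigma] at hle
    exact_mod_cast hle
  refine le_trans ?_ hcast
  calc c / 2 * N ^ (M + 1) = (1 / 2 * N) * (c * N ^ M) := by ring
    _ ≤ Nb.card * (c * N ^ M) := by
      apply mul_le_mul_of_nonneg_right _ (by positivity)
      have := hδ _ hX
      nlinarith
    _ ≤ _ := by
      rw [← nsmul_eq_mul]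
      exact Finset.card_nsmul_le_sum _ _ _ fun v hv => h _ (hval v hv)

end Connecting

section Insertion

variable {V : Type} [DecidableEq V]

/-- Insert the terms of `z` into `s`, one after each block of `j` terms. -/
def interleave (j : ℕ) (s z : ℕ → V) (q : ℕ) : V :=
  if q % (j + 1) = j then z (q / (j + 1)) else s (q - q / (j + 1))

lemma interleave_block (j : ℕ) (s z : ℕ → V) (a b : ℕ) (hb : b < j) :
    interleave j s z (a * (j + 1) + b) = s (a * j + b) := by
  have h1 : (a * (j + 1) + b) % (j + 1) = b := by
    rw [Nat.mul_add_mod', Nat.mod_eq_of_lt (by omega)]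
  have h2 : (a * (j + 1) + b) / (j + 1) = a := by
    rw [Nat.mul_comm, Nat.mul_add_div (by omega), Nat.div_eq_of_lt (by omega)]; rfl
  rw [interleave, h1, h2, if_neg (by omega)]
  congr 1
  have : a * (j + 1) = a * j + a := by ring
  omega

lemma interleave_sep (j : ℕ) (s z : ℕ → V) (a : ℕ) :
    interleave j s z (a * (j + 1) + j) = z a := by
  have h1 : (a * (j + 1) + j) % (j + 1) = j := by
    rw [Nat.mul_add_mod', Nat.mod_eq_of_lt (by omega)]
  have h2 : (a * (j + 1) + j) / (j + 1) = a := by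
    rw [Nat.mul_comm, Nat.mul_add_div (by omega), Nat.div_eq_of_lt (by omega)]; rfl
  rw [interleave, h1, h2, if_pos rfl]

lemma window_interleave (j : ℕ) (s z : ℕ → V) (a b : ℕ) (hb : b ≤ j) :
    window (interleave j s z) (a * (j + 1) + b) (j + 1) =
      insert (z a) (window s (a * j + b) j) := by
  ext x
  simp only [window, Finset.mem_image, Finset.mem_range, Finset.mem_insert]
  constructor
  · rintro ⟨i, hi, rfl⟩
    rcases lt_trichotomy (b + i) j with h | h | h
    · right
      refine ⟨i, by omega, ?_⟩
      rw [show a * (j + 1) + b + i = a * (j + 1) + (b + i) by ring, interleave_block _ _ _ _ _ h]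
      congr 1; ring
    · left
      rw [show a * (j + 1) + b + i = a * (j + 1) + (b + i) by ring, h, interleave_sep]
    · right
      obtain ⟨t, ht⟩ : ∃ t, b + i = j + 1 + t := ⟨b + i - (j + 1), by omega⟩
      refine ⟨i - 1, by omega, ?_⟩
      rw [show a * (j + 1) + b + i = (a + 1) * (j + 1) + t by
        rw [add_assoc, ht]; ring, interleave_block _ _ _ _ _ (by omega)]
      congr 1
      have : (a + 1) * j = a * j + j := by ring
      omega
  · rintro (rfl | ⟨i, hi, rfl⟩)
    · refine ⟨j - b, by omega, ?_⟩
      rw [show a * (j + 1) + b + (j - b) = a * (j + 1) + j by omega, interleave_sep]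
    · by_cases h : b + i < j
      · refine ⟨i, by omega, ?_⟩
        rw [show a * (j + 1) + b + i = a * (j + 1) + (b + i) by ring, interleave_block _ _ _ _ _ h]
        congr 1; ring
      · obtain ⟨t, ht⟩ : ∃ t, b + i = j + t := ⟨b + i - j, by omega⟩
        refine ⟨i + 1, by omega, ?_⟩
        rw [show a * (j + 1) + b + (i + 1) = (a + 1) * (j + 1) + t by
          have : (a + 1) * (j + 1) = a * (j + 1) + j + 1 := by ring
          omega, interleave_block _ _ _ _ _ (by omega)]
        congr 1
        have : (a + 1) * j = a * j + j := by ring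
        omega

/-- Windows of the interleaving are edges as soon as the separators complete all windows. -/
lemma isTightWalk_interleave {E : Finset (Finset V)} {Z : Finset V} {j r : ℕ}
    {s z : ℕ → V}
    (h : ∀ a < r + 1, ∀ i, i + (j + 1) ≤ (r + 2) * (j + 1) →
      insert (z a) (window s i (j + 1) ∪ Z) ∈ E) :
    IsTightWalk E Z (j + 1) ((r + 2) * (j + 1) + (r + 1)) (interleave (j + 1) s z) := by
  intro q hq
  have hq' := Nat.div_add_mod q (j + 1 + 1)
  set a := q / (j + 1 + 1)
  set b := q % (j + 1 + 1)
  have hb : b < j + 1 + 1 := Nat.mod_lt _ (by omega)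
  have e : q = a * (j + 1 + 1) + b := by rw [← hq']; ring
  rw [e, window_interleave _ _ _ _ _ (by omega), Finset.insert_union]
  have ha : a < r + 1 := by
    by_contra hcon
    have : (r + 1) * (j + 1 + 1) ≤ a * (j + 1 + 1) := Nat.mul_le_mul_right _ (by omega)
    have e2 : (r + 2) * (j + 1) + (r + 1) = (r + 1) * (j + 1 + 1) + (j + 1) := by ring
    omega
  apply h _ ha
  have e2 : (r + 2) * (j + 1) + (r + 1) = (r + 1) * (j + 1 + 1) + (j + 1) := by ring
  have e3 : (r + 2) * (j + 1) = r * (j + 1) + (j + 1) + (j + 1) := by ring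
  have e4 : r * (j + 1 + 1) = r * (j + 1) + r := by ring
  have e5 : a * (j + 1 + 1) = a * (j + 1) + a := by ring
  have e6 : (r + 1) * (j + 1 + 1) = r * (j + 1) + r + (j + 1 + 1) := by ring
  rcases Nat.lt_or_ge a r with h1 | h1
  · have : (a + 1) * (j + 1) ≤ r * (j + 1) := Nat.mul_le_mul_right _ (by omega)
    have e7 : (a + 1) * (j + 1) = a * (j + 1) + (j + 1) := by ring
    omega
  · have : a = r := by omega
    rw [this] at e e5 ⊢
    omega

end Insertion

section Recursion

variable {V : Type} [Fintype V] [DecidableEq V] [Inhabited V]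

lemma appSeq_last {j : ℕ} (X Y : ℕ → V) (t : ℕ) : appSeq j X Y (j + t) = Y t := by
  simp [appSeq]

lemma appSeq_mid {j M : ℕ} (X Y : ℕ → V) (u : Fin M → V) (t : Fin M) :
    appSeq j X (appSeq M (extSeq u) Y) (j + t) = u t := by
  simp [appSeq, extSeq]

lemma appSeq_end {j M : ℕ} (X Y : ℕ → V) (u : Fin M → V) (t : ℕ) :
    appSeq j X (appSeq M (extSeq u) Y) (j + M + t) = Y t := by
  rw [add_assoc, appSeq_last, appSeq_last]

/-- The interior of the interleaving of `X u Y` with `z`. -/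
def interleaveMid (j r : ℕ) (X Y : ℕ → V) (u : Fin (r * (j + 1)) → V) (z : Fin (r + 1) → V) :
    Fin (r * (j + 1) + (r + 1)) → V := fun i =>
  interleave (j + 1) (appSeq (j + 1) X (appSeq (r * (j + 1)) (extSeq u) Y)) (extSeq z) (j + 1 + i)

lemma appSeq_interleaveMid (j r : ℕ) (X Y : ℕ → V) (u : Fin (r * (j + 1)) → V)
    (z : Fin (r + 1) → V) (q : ℕ) (hq : q < (r + 2) * (j + 1) + (r + 1)) :
    appSeq (j + 1) X (appSeq (r * (j + 1) + (r + 1)) (extSeq (interleaveMid j r X Y u z)) Y) q =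
      interleave (j + 1) (appSeq (j + 1) X (appSeq (r * (j + 1)) (extSeq u) Y)) (extSeq z) q := by
  rcases Nat.lt_or_ge q (j + 1) with h | h
  · have := interleave_block (j + 1) (appSeq (j + 1) X (appSeq (r * (j + 1)) (extSeq u) Y))
      (extSeq z) 0 q h
    simp only [zero_mul, zero_add] at this
    rw [this]
    simp [appSeq, h]
  · obtain ⟨t, rfl⟩ := Nat.exists_eq_add_of_le h
    rcases Nat.lt_or_ge t (r * (j + 1) + (r + 1)) with h1 | h1
    · exact appSeq_mid X Y (interleaveMid j r X Y u z) ⟨t, h1⟩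
    · obtain ⟨t, rfl⟩ := Nat.exists_eq_add_of_le h1
      have e1 : (r + 2) * (j + 1) = r * (j + 1) + (j + 1) + (j + 1) := by ring
      rw [← add_assoc (j + 1) (r * (j + 1) + (r + 1)) t, appSeq_end,
        show j + 1 + (r * (j + 1) + (r + 1)) + t = (r + 1) * (j + 1 + 1) + t by ring,
        interleave_block _ _ _ _ _ (by omega),
        show (r + 1) * (j + 1) + t = (j + 1) + r * (j + 1) + t by ring, appSeq_end]

lemma interleaveMid_injective (j r : ℕ) (X Y : ℕ → V) {u u' : Fin (r * (j + 1)) → V}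
    {z z' : Fin (r + 1) → V} (h : interleaveMid j r X Y u z = interleaveMid j r X Y u' z') :
    u = u' ∧ z = z' := by
  have key : ∀ q < (r + 2) * (j + 1) + (r + 1),
      interleave (j + 1) (appSeq (j + 1) X (appSeq (r * (j + 1)) (extSeq u) Y)) (extSeq z) q =
      interleave (j + 1) (appSeq (j + 1) X (appSeq (r * (j + 1)) (extSeq u') Y)) (extSeq z') q := by
    intro q hq
    rw [← appSeq_interleaveMid _ _ _ _ _ _ _ hq, ← appSeq_interleaveMid _ _ _ _ _ _ _ hq, h]
  constructor
  · funext t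
    rw [← appSeq_mid (j := j + 1) X Y u t, ← appSeq_mid (j := j + 1) X Y u' t]
    have hdm := Nat.div_add_mod (j + 1 + (t : ℕ)) (j + 1)
    set a := (j + 1 + (t : ℕ)) / (j + 1)
    set b := (j + 1 + (t : ℕ)) % (j + 1)
    have hb : b < j + 1 := Nat.mod_lt _ (by omega)
    have ht := t.isLt
    have ha : a < r + 1 := by
      by_contra hcon
      have h1 : (r + 1) * (j + 1) ≤ a * (j + 1) := Nat.mul_le_mul_right _ (by omega)
      have h2 : (r + 1) * (j + 1) = r * (j + 1) + (j + 1) := by ring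
      have h3 : (j + 1) * a = a * (j + 1) := by ring
      omega
    have h1 : a * (j + 1 + 1) ≤ r * (j + 1 + 1) := Nat.mul_le_mul_right _ (by omega)
    have := key (a * (j + 1 + 1) + b) (by
      have e1 : (r + 2) * (j + 1) + (r + 1) = r * (j + 1 + 1) + (j + 1) + (j + 1) + 1 := by ring
      omega)
    rw [interleave_block _ _ _ _ _ hb, interleave_block _ _ _ _ _ hb] at this
    rwa [mul_comm a, hdm] at this
  · funext a
    have ha := a.isLt
    have h1 : a * (j + 1 + 1) ≤ r * (j + 1 + 1) := Nat.mul_le_mul_right _ (by omega)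
    have := key (a * (j + 1 + 1) + (j + 1)) (by
      have e1 : (r + 2) * (j + 1) + (r + 1) = r * (j + 1 + 1) + (j + 1) + (j + 1) + 1 := by ring
      omega)
    rw [interleave_sep, interleave_sep] at this
    simpa [extSeq, ha] using this

lemma le_card_connectors_succ {E : Finset (Finset V)} {d : ℕ} (hE : ∀ e ∈ E, e.card = d + 1)
    {γ : ℝ} (hγ : 0 < γ)
    (hδ : ∀ S : Finset V, S.card = d → (1 / 2 + γ) * (Fintype.card V : ℝ) ≤ (nbrs E S).card)
    {j r : ℕ} {c : ℝ} (hc : 0 < c)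
    (h : ∀ Z : Finset V, Z.card + j = d → ∀ X Y : ℕ → V, (window X 0 j ∪ Z).card = d →
      (window Y 0 j ∪ Z).card = d → c * (Fintype.card V : ℝ) ^ (r * (j + 1)) ≤
        (connectors E Z j (r * (j + 1)) X Y).card)
    {Z : Finset V} (hZ : Z.card + (j + 1) = d) (X Y : ℕ → V)
    (hX : (window X 0 (j + 1) ∪ Z).card = d) (hY : (window Y 0 (j + 1) ∪ Z).card = d) :
    (2 * γ * c) ^ (r + 1) * (Fintype.card V : ℝ) ^ (r * (j + 1) + (r + 1)) ≤
      (connectors E Z (j + 1) (r * (j + 1) + (r + 1)) X Y).card := by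
  set N := (Fintype.card V : ℝ)
  have hN : 0 < N := by simp only [N]; exact_mod_cast Fintype.card_pos
  set M := r * (j + 1) with hM
  let old : (Fin M → V) → ℕ → V := fun u => appSeq (j + 1) X (appSeq M (extSeq u) Y)
  let R : (Fin M → V) → V → Prop := fun u z =>
    ∀ i, i + (j + 1) ≤ (r + 2) * (j + 1) → insert z (window (old u) i (j + 1) ∪ Z) ∈ E
  let Zs : (Fin M → V) → Finset V := fun u => Finset.univ.filter (R u)
  let Cm : Finset V := nbrs E (window X 0 (j + 1) ∪ Z) ∩ nbrs E (window Y 0 (j + 1) ∪ Z)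
  have hCm : 2 * γ * N ≤ Cm.card := by
    have h1 := hδ _ hX
    have h2 := hδ _ hY
    have h3 := Finset.card_union_add_card_inter (nbrs E (window X 0 (j + 1) ∪ Z))
      (nbrs E (window Y 0 (j + 1) ∪ Z))
    have h4 := Finset.card_le_univ (nbrs E (window X 0 (j + 1) ∪ Z) ∪
      nbrs E (window Y 0 (j + 1) ∪ Z))
    have h5 : (nbrs E (window X 0 (j + 1) ∪ Z)).card + (nbrs E (window Y 0 (j + 1) ∪ Z)).card
      ≤ Fintype.card V + Cm.card := by simp only [Cm]; omega
    have h6 : ((nbrs E (window X 0 (j + 1) ∪ Z)).card : ℝ) +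
      (nbrs E (window Y 0 (j + 1) ∪ Z)).card ≤ (Fintype.card V : ℝ) + Cm.card := by
      exact_mod_cast h5
    linarith
  have hfib : ∀ z ∈ Cm, c * N ^ M ≤ ((Finset.univ.filter fun u => R u z).card : ℝ) := by
    intro z hz
    simp only [Cm, nbrs, Finset.mem_inter, Finset.mem_filter, Finset.mem_univ, true_and] at hz
    obtain ⟨hzX, hzY⟩ := hz
    have hnot : ∀ S : ℕ → V, (window S 0 (j + 1) ∪ Z).card = d →
        insert z (window S 0 (j + 1) ∪ Z) ∈ E → z ∉ window S 0 (j + 1) ∪ Z := by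
      intro S hS hz hmem
      have := hE _ hz
      rw [Finset.insert_eq_of_mem hmem] at this
      omega
    have hzZ : z ∉ Z := fun hmem => hnot X hX hzX (Finset.mem_union_right _ hmem)
    have hZ' : (insert z Z).card = Z.card + 1 := Finset.card_insert_of_notMem hzZ
    have aux : ∀ (S : Finset V) (x : V), (insert x S ∪ Z).card = d → z ∉ insert x S ∪ Z →
        S.card ≤ j → (S ∪ insert z Z).card = d := by
      intro S x hS hz hSc
      have h1 : insert x (S ∪ insert z Z) = insert z (insert x S ∪ Z) := by
        ext; simp; tauto
      have h2 := Finset.card_insert_le x (S ∪ insert z Z)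
      rw [h1, Finset.card_insert_of_notMem hz] at h2
      have h3 := Finset.card_union_le S (insert z Z)
      omega
    have hXs : window X 0 (j + 1) = insert (X 0) (window (fun i => X (i + 1)) 0 j) := by
      rw [window_succ_first]
      congr 1
      exact window_congr fun i _ => by simp [add_comm]
    have hYs : window Y 0 (j + 1) = insert (Y j) (window Y 0 j) := by
      rw [window_succ_last, zero_add]
    have h1 := h (insert z Z) (by omega) (fun i => X (i + 1)) Y
      (aux _ (X 0) (by rw [← hXs]; exact hX) (by rw [← hXs]; exact hnot X hX hzX)
        (card_window_le _ _ _))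
      (aux _ (Y j) (by rw [← hYs]; exact hY) (by rw [← hYs]; exact hnot Y hY hzY)
        (card_window_le _ _ _))
    refine h1.trans ?_
    rw [Nat.cast_le]
    apply Finset.card_le_card
    intro u hu
    simp only [connectors, Finset.mem_filter, Finset.mem_univ, true_and] at hu ⊢
    intro i hi
    have e1 : (r + 2) * (j + 1) = M + (j + 1) + (j + 1) := by rw [hM]; ring
    rcases i with _ | i
    · convert hzX using 3
      exact window_congr fun i hi => by simp [old, appSeq, hi]
    · rcases Nat.lt_or_ge i (M + j) with h2 | h2
      · have := hu i (by omega)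
        rw [Finset.union_insert] at this
        convert this using 3
        apply window_congr
        intro t ht
        simp only [old, appSeq]
        rw [show i + 1 + t = i + t + 1 by ring]
        by_cases h3 : i + t < j
        · simp [h3]
        · simp [h3, show i + t + 1 - (j + 1) = i + t - j by omega]
      · have h3 : i + 1 = (j + 1) + M := by omega
        convert hzY using 3
        apply window_congr
        intro t ht
        rw [h3, zero_add]
        exact appSeq_end X Y u t
  have hsum : 2 * γ * c * N ^ (M + 1) ≤ ∑ u, ((Zs u).card : ℝ) := by
    have hdc : ∑ u, (Zs u).card = ∑ z, (Finset.univ.filter fun u => R u z).card :=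
      Finset.sum_card_bipartiteAbove_eq_sum_card_bipartiteBelow R
    have : (∑ u, ((Zs u).card : ℝ)) = ∑ z, ((Finset.univ.filter fun u => R u z).card : ℝ) := by
      exact_mod_cast hdc
    rw [this]
    calc 2 * γ * c * N ^ (M + 1) = (2 * γ * N) * (c * N ^ M) := by ring
      _ ≤ Cm.card * (c * N ^ M) := mul_le_mul_of_nonneg_right hCm (by positivity)
      _ ≤ ∑ z ∈ Cm, ((Finset.univ.filter fun u => R u z).card : ℝ) := by
        rw [← nsmul_eq_mul]; exact Finset.card_nsmul_le_sum _ _ _ hfib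
      _ ≤ _ := Finset.sum_le_sum_of_subset_of_nonneg (Finset.subset_univ _)
        fun _ _ _ => Nat.cast_nonneg _
  have hpow : (2 * γ * c) ^ (r + 1) * N ^ (M + (r + 1)) ≤ ∑ u, ((Zs u).card : ℝ) ^ (r + 1) := by
    have h1 := pow_sum_div_card_le_sum_pow (s := Finset.univ) (f := fun u => ((Zs u).card : ℝ))
      (fun _ _ => Nat.cast_nonneg _) r
    refine le_trans ?_ h1
    rw [le_div_iff₀ (by positivity)]
    have h2 := pow_le_pow_left₀ (by positivity) hsum (r + 1)
    refine le_trans (le_of_eq ?_) h2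
    rw [Finset.card_univ, Fintype.card_fun, Fintype.card_fin, Nat.cast_pow]
    change _ * (N ^ M) ^ r = _
    ring
  refine hpow.trans ?_
  have hle : (Finset.univ.sigma fun u => Fintype.piFinset fun _ : Fin (r + 1) => Zs u).card ≤
      (connectors E Z (j + 1) (M + (r + 1)) X Y).card := by
    apply Finset.card_le_card_of_injOn (fun a => interleaveMid j r X Y a.1 a.2)
    · rintro ⟨u, z⟩ huz
      simp only [Finset.coe_sigma, Set.mem_sigma_iff, Finset.mem_coe, Fintype.mem_piFinset] at huz
      have hz : ∀ a, R u (z a) := by simpa [Zs] using huz.2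
      simp only [connectors, Finset.mem_filter, Finset.mem_univ, true_and, Finset.mem_coe]
      have hw : IsTightWalk E Z (j + 1) ((r + 2) * (j + 1) + (r + 1))
          (interleave (j + 1) (old u) (extSeq z)) := by
        apply isTightWalk_interleave
        intro a ha i hi
        have := hz ⟨a, ha⟩ i hi
        simpa [extSeq, ha] using this
      intro i hi
      have e1 : j + 1 + (M + (r + 1)) + (j + 1) = (r + 2) * (j + 1) + (r + 1) := by rw [hM]; ring
      have := hw i (by omega)
      convert this using 2
      apply window_congr
      intro t ht
      exact appSeq_interleaveMid j r X Y u z (i + t) (by omega)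
    · rintro ⟨u, z⟩ - ⟨u', z'⟩ - heq
      obtain ⟨rfl, rfl⟩ := interleaveMid_injective j r X Y heq
      rfl
  rw [Finset.card_sigma] at hle
  simp only [Fintype.card_piFinset_const] at hle
  exact_mod_cast hle

end Recursion

theorem exists_connectors (d : ℕ) (γ : ℝ) (hγ : 0 < γ) (j : ℕ) :
    ∃ (r : ℕ) (c : ℝ), 0 < c ∧ ∀ (V : Type) [Fintype V] [DecidableEq V] [Inhabited V]
      (E : Finset (Finset V)), (∀ e ∈ E, e.card = d + 1) →
      (∀ S : Finset V, S.card = d → (1 / 2 + γ) * (Fintype.card V : ℝ) ≤ (nbrs E S).card) →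
      ∀ Z : Finset V, Z.card + j = d → ∀ X Y : ℕ → V, (window X 0 j ∪ Z).card = d →
      (window Y 0 j ∪ Z).card = d → c * (Fintype.card V : ℝ) ^ (r * (j + 1)) ≤
        (connectors E Z j (r * (j + 1)) X Y).card := by
  induction j with
  | zero =>
    refine ⟨0, 1, one_pos, ?_⟩
    intro V _ _ _ E _ _ Z _ X Y _ _
    have : (connectors E Z 0 (0 * (0 + 1)) X Y) = Finset.univ := by
      apply Finset.filter_true_of_mem
      intro u _ i hi
      omega
    rw [this]
    simp
  | succ j ih =>
    obtain ⟨r, c, hc, h⟩ := ih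
    have key : ∀ e : ℕ, ∃ c' : ℝ, 0 < c' ∧
      ∀ (V : Type) [Fintype V] [DecidableEq V] [Inhabited V]
      (E : Finset (Finset V)), (∀ e ∈ E, e.card = d + 1) →
      (∀ S : Finset V, S.card = d → (1 / 2 + γ) * (Fintype.card V : ℝ) ≤ (nbrs E S).card) →
      ∀ Z : Finset V, Z.card + (j + 1) = d → ∀ X Y : ℕ → V, (window X 0 (j + 1) ∪ Z).card = d →
      (window Y 0 (j + 1) ∪ Z).card = d →
        c' * (Fintype.card V : ℝ) ^ (r * (j + 1) + (r + 1) + e) ≤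
        (connectors E Z (j + 1) (r * (j + 1) + (r + 1) + e) X Y).card := by
      intro e
      induction e with
      | zero =>
        refine ⟨(2 * γ * c) ^ (r + 1), by positivity, ?_⟩
        intro V _ _ _ E hE hδ Z hZ X Y hX hY
        exact le_card_connectors_succ hE hγ hδ hc (h V E hE hδ) hZ X Y hX hY
      | succ e ihe =>
        obtain ⟨c', hc', h'⟩ := ihe
        refine ⟨c' / 2, by positivity, ?_⟩
        intro V _ _ _ E hE hδ Z hZ X Y hX hY
        exact connectors_extend hE hγ hδ hZ hc' (fun X hX => h' V E hE hδ Z hZ X Y hX hY) X hX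
    obtain ⟨c', hc', h'⟩ := key (j + 1)
    refine ⟨r + 1, c', hc', ?_⟩
    have e : r * (j + 1) + (r + 1) + (j + 1) = (r + 1) * (j + 1 + 1) := by ring
    rw [e] at h'
    exact h'

lemma sum_cons_eq {V : Type} [Fintype V] {d : ℕ} (F : (Fin (d + 1) → V) → ℝ) :
    ∑ z, F z = ∑ v, ∑ x : Fin d → V, F (Fin.cons v x) := by
  rw [← Fintype.sum_prod_type' (f := fun v x => F (Fin.cons v x))]
  exact (Equiv.sum_comp (Fin.consEquiv fun _ => V) F).symm

section Weights

variable {V : Type} [Fintype V] [DecidableEq V]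

lemma exists_top_set (y : V → ℝ) (a : ℕ) (ha : a ≤ Fintype.card V) :
    ∃ A : Finset V, A.card = a ∧ ∀ u ∈ A, ∀ v ∉ A, y v ≤ y u := by
  induction a with
  | zero => exact ⟨∅, rfl, by simp⟩
  | succ a ih =>
    obtain ⟨A, hA, h⟩ := ih (by omega)
    have hne : (Finset.univ \ A).Nonempty := by
      rw [← Finset.card_pos, Finset.card_sdiff_of_subset (Finset.subset_univ _), Finset.card_univ]
      omega
    obtain ⟨m, hm, hmax⟩ := Finset.exists_max_image _ y hne
    have hmA : m ∉ A := by simpa using hm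
    refine ⟨insert m A, by rw [Finset.card_insert_of_notMem hmA, hA], ?_⟩
    intro u hu v hv
    rw [Finset.mem_insert, not_or] at hv
    rcases Finset.mem_insert.1 hu with rfl | hu
    · exact hmax v (by simp [hv.2])
    · exact h u hu v hv.2

lemma sum_embedding_apply {A : Type} [Fintype A] [DecidableEq A] {d : ℕ} (y : A → ℝ) (i : Fin d) :
    (Fintype.card A : ℝ) * ∑ f : Fin d ↪ A, y (f i) =
      (Fintype.card (Fin d ↪ A) : ℝ) * ∑ a, y a := by
  have hswap : ∀ u v : A, (∑ f : Fin d ↪ A, if f i = u then (1 : ℝ) else 0) =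
      ∑ f : Fin d ↪ A, if f i = v then (1 : ℝ) else 0 := by
    intro u v
    rw [← Equiv.sum_comp (Equiv.embeddingCongr (Equiv.refl (Fin d)) (Equiv.swap u v))]
    refine Finset.sum_congr rfl fun f _ => ?_
    have : (Equiv.embeddingCongr (Equiv.refl (Fin d)) (Equiv.swap u v) f) i =
      Equiv.swap u v (f i) := rfl
    rw [this]
    congr 1
    rw [Equiv.swap_apply_eq_iff, Equiv.swap_apply_left]
  have h1 : ∀ g : A → ℝ, ∑ f : Fin d ↪ A, g (f i) =
      ∑ a, g a * ∑ f : Fin d ↪ A, if f i = a then (1 : ℝ) else 0 := by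
    intro g
    simp_rw [Finset.mul_sum]
    rw [Finset.sum_comm]
    refine Finset.sum_congr rfl fun f _ => ?_
    simp
  rcases isEmpty_or_nonempty A with hA | ⟨⟨b⟩⟩
  · simp
  have h2 : ∀ g : A → ℝ, ∑ f : Fin d ↪ A, g (f i) =
      (∑ a, g a) * ∑ f : Fin d ↪ A, if f i = b then (1 : ℝ) else 0 := by
    intro g
    rw [h1, Finset.sum_mul]
    exact Finset.sum_congr rfl fun a _ => by rw [hswap a b]
  have h3 := h2 fun _ => 1
  simp only [Finset.sum_const, Finset.card_univ, nsmul_eq_mul, mul_one] at h3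
  rw [h2 y, h3]
  ring

lemma top_set_bounds {y : V → ℝ} (hy : ∑ v, y v = 0) {A : Finset V} (hA0 : A.Nonempty)
    (hA2 : 2 * A.card ≤ Fintype.card V) {θ : ℝ} (h1 : ∀ u ∈ A, θ ≤ y u) (h2 : ∀ v ∉ A, y v ≤ θ) :
    ∑ v, |y v| ≤ 2 * Fintype.card V * ((∑ u ∈ A, y u) / A.card) ∧
    (1 - 2 * A.card / Fintype.card V) * ((∑ u ∈ A, y u) / A.card) ≤
      θ + (∑ u ∈ A, y u) / A.card := by
  set N := (Fintype.card V : ℝ) with hN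
  set a := (A.card : ℝ) with ha
  set μ := (∑ u ∈ A, y u) / a with hμ
  have ha0 : 0 < a := by rw [ha]; exact_mod_cast hA0.card_pos
  have haN : 2 * a ≤ N := by rw [ha, hN]; exact_mod_cast hA2
  have hsA : ∑ u ∈ A, y u = a * μ := by rw [hμ]; field_simp
  have hsplit : ∑ u ∈ A, y u + ∑ u ∈ Aᶜ, y u = 0 := by rw [Finset.sum_add_sum_compl, hy]
  have hcc : ((Aᶜ).card : ℝ) = N - a := by
    rw [Finset.card_compl, Nat.cast_sub (Finset.card_le_univ A)]
  have hθμ : θ * a ≤ a * μ := by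
    rw [← hsA]
    have := Finset.card_nsmul_le_sum A y θ h1
    rw [nsmul_eq_mul] at this
    linarith
  have hθc : -(a * μ) ≤ (N - a) * θ := by
    have := Finset.sum_le_card_nsmul Aᶜ y θ fun v hv => h2 v (by simpa using hv)
    rw [nsmul_eq_mul, hcc] at this
    linarith
  have hθμ' : θ ≤ μ := by nlinarith
  have hμ0 : 0 ≤ μ := by nlinarith
  constructor
  · have hp : ∑ v, |y v| = ∑ u ∈ A, |y u| + ∑ u ∈ Aᶜ, |y u| := by rw [Finset.sum_add_sum_compl]
    rw [hp]
    rcases le_total 0 θ with h | h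
    · have e1 : ∑ u ∈ A, |y u| = a * μ := by
        rw [← hsA]
        exact Finset.sum_congr rfl fun u hu => abs_of_nonneg (h.trans (h1 u hu))
      have e2 : ∑ u ∈ Aᶜ, |y u| ≤ ∑ u ∈ Aᶜ, (2 * θ - y u) := by
        refine Finset.sum_le_sum fun u hu => ?_
        have := h2 u (by simpa using hu)
        rw [abs_le]; constructor <;> linarith
      rw [Finset.sum_sub_distrib, Finset.sum_const, nsmul_eq_mul, hcc] at e2
      have : (N - a) * θ ≤ (N - a) * μ := mul_le_mul_of_nonneg_left hθμ' (by linarith)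
      nlinarith
    · have e1 : ∑ u ∈ Aᶜ, |y u| = a * μ := by
        have : ∑ u ∈ Aᶜ, |y u| = ∑ u ∈ Aᶜ, - y u := 
          Finset.sum_congr rfl fun u hu => 
            abs_of_nonpos ((h2 u (by simpa using hu)).trans h)
        rw [this, Finset.sum_neg_distrib]
        linarith
      have e2 : ∑ u ∈ A, |y u| ≤ ∑ u ∈ A, (y u - 2 * θ) := by
        refine Finset.sum_le_sum fun u hu => ?_
        have := h1 u hu
        rw [abs_le]; constructor <;> linarith
      rw [Finset.sum_sub_distrib, Finset.sum_const, nsmul_eq_mul] at e2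
      have : -(a * μ) ≤ a * θ := by nlinarith
      have : -θ ≤ μ := by nlinarith
      change _ ≤ _ - a * (2 * θ) at e2
      nlinarith
  · have hN0 : 0 < N := by linarith
    have hNa : 0 < N - a := by linarith
    have : -(a / (N - a)) * μ ≤ θ := by
      rw [← neg_div, div_mul_eq_mul_div, div_le_iff₀ hNa]; nlinarith
    have h3 : a / (N - a) ≤ 2 * a / N := by
      rw [div_le_div_iff₀ hNa hN0]; nlinarith
    nlinarith

lemma sum_pos_part_edges_ge {E : Finset (Finset V)} {d : ℕ} (hd : 1 ≤ d) {γ : ℝ} (hγ : 0 < γ)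
    (hγ1 : γ ≤ 1 / 2)
    (hδ : ∀ S : Finset V, S.card = d → (1 / 2 + γ) * (Fintype.card V : ℝ) ≤ (nbrs E S).card)
    (hN1 : 4 / γ ≤ Fintype.card V) (hN2 : 8 * d ≤ Fintype.card V)
    {y : V → ℝ} (hy : ∑ v, y v = 0) :
    γ ^ 2 / 8 * (1 / 8) ^ d * (Fintype.card V : ℝ) ^ d * ∑ v, |y v| ≤
      ∑ x : Fin d → V, ∑ v ∈ nbrs E (Finset.univ.image x), max (y v + ∑ i, y (x i)) 0 := by
  set N := (Fintype.card V : ℝ) with hN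
  have hγN : 4 ≤ γ * N := by rw [div_le_iff₀ hγ] at hN1; linarith
  have hNpos : 0 < N := by nlinarith
  set a := ⌈(1 / 2 - γ / 2) * N⌉₊ with ha
  have ha1 : (1 / 2 - γ / 2) * N ≤ a := Nat.le_ceil _
  have ha2 : (a : ℝ) < (1 / 2 - γ / 2) * N + 1 := Nat.ceil_lt_add_one (by nlinarith)
  have haN : 2 * a ≤ Fintype.card V := by
    have : ((2 * a : ℕ) : ℝ) ≤ (Fintype.card V : ℝ) := by push_cast; nlinarith
    exact_mod_cast this
  obtain ⟨A, hAc, hA⟩ := exists_top_set y a (by omega)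
  have ha4 : N / 4 ≤ a := by nlinarith
  have hA0 : A.Nonempty := by
    rw [← Finset.card_pos, hAc]
    have : (0 : ℝ) < a := by linarith
    exact_mod_cast this
  obtain ⟨m, hmA, hmin⟩ := Finset.exists_min_image A y hA0
  set θ := y m
  obtain ⟨hb1, hb2⟩ := top_set_bounds hy hA0 (by omega) hmin (fun v hv => hA m hmA v hv)
  rw [hAc] at hb1 hb2
  set μ := (∑ u ∈ A, y u) / (a : ℝ) with hμ
  have hμ0 : 0 ≤ μ := by
    have : 0 ≤ ∑ v, |y v| := Finset.sum_nonneg fun _ _ => abs_nonneg _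
    by_contra hcon
    push Not at hcon
    nlinarith
  have hb3 : γ / 2 * μ ≤ θ + μ := by
    refine le_trans (mul_le_mul_of_nonneg_right ?_ hμ0) hb2
    have : 2 * (a : ℝ) / N ≤ 1 - γ / 2 := by rw [div_le_iff₀ hNpos]; nlinarith
    linarith
  -- restrict to tuples inside `A`
  let emb : (Fin d ↪ A) ↪ (Fin d → V) :=
    ⟨fun f i => (f i : V), fun f g h => by
      ext i; exact congrFun h i⟩
  have hnb : ∀ f : Fin d ↪ A, γ / 2 * N ≤ ((nbrs E (Finset.univ.image (emb f)) ∩ A).card : ℝ) := by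
    intro f
    have hc : (Finset.univ.image (emb f)).card = d := by
      rw [Finset.card_image_of_injective]
      · simp
      · intro i j hij
        exact f.injective (Subtype.ext hij)
    have h1 := hδ _ hc
    have h3 := Finset.card_union_add_card_inter (nbrs E (Finset.univ.image (emb f))) A
    have h4 := Finset.card_le_univ (nbrs E (Finset.univ.image (emb f)) ∪ A)
    have h5 : (((nbrs E (Finset.univ.image (emb f))).card + A.card : ℕ) : ℝ) ≤
      ((Fintype.card V + (nbrs E (Finset.univ.image (emb f)) ∩ A).card : ℕ) : ℝ) := by
      exact_mod_cast by omega
    push_cast at h5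
    rw [hAc] at h5
    change _ ≤ N + _ at h5
    nlinarith
  have hterm : ∀ f : Fin d ↪ A, γ / 2 * N * (θ + ∑ i, y (f i)) ≤
      ∑ v ∈ nbrs E (Finset.univ.image (emb f)), max (y v + ∑ i, y (emb f i)) 0 := by
    intro f
    calc γ / 2 * N * (θ + ∑ i, y (f i)) ≤ γ / 2 * N * max (θ + ∑ i, y (f i)) 0 :=
          mul_le_mul_of_nonneg_left (le_max_left _ _) (by positivity)
      _ ≤ ((nbrs E (Finset.univ.image (emb f)) ∩ A).card : ℝ) * max (θ + ∑ i, y (f i)) 0 :=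
          mul_le_mul_of_nonneg_right (hnb f) (le_max_right _ _)
      _ ≤ ∑ v ∈ nbrs E (Finset.univ.image (emb f)) ∩ A, max (y v + ∑ i, y (emb f i)) 0 := by
          rw [← nsmul_eq_mul]
          refine Finset.card_nsmul_le_sum _ _ _ fun v hv => ?_
          exact max_le_max (add_le_add (hmin v (Finset.mem_inter.1 hv).2) le_rfl) le_rfl
      _ ≤ _ := Finset.sum_le_sum_of_subset_of_nonneg Finset.inter_subset_left
          fun _ _ _ => le_max_right _ _
  have hall : ∑ f : Fin d ↪ A, γ / 2 * N * (θ + ∑ i, y (f i)) ≤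
      ∑ x : Fin d → V, ∑ v ∈ nbrs E (Finset.univ.image x), max (y v + ∑ i, y (x i)) 0 := by
    refine (Finset.sum_le_sum fun f _ => hterm f).trans ?_
    rw [← Finset.sum_map Finset.univ emb
      (fun x => ∑ v ∈ nbrs E (Finset.univ.image x), max (y v + ∑ i, y (x i)) 0)]
    exact Finset.sum_le_sum_of_subset_of_nonneg (Finset.subset_univ _)
      fun _ _ _ => Finset.sum_nonneg fun _ _ => le_max_right _ _
  refine le_trans ?_ hall
  have hapos : (0 : ℝ) < a := by linarith
  have hI : ∑ f : Fin d ↪ A, (θ + ∑ i, y (f i)) =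
      (Fintype.card (Fin d ↪ A) : ℝ) * (θ + d * μ) := by
    rw [Finset.sum_add_distrib, Finset.sum_comm]
    have : ∀ i : Fin d, ∑ f : Fin d ↪ A, y (f i) = (Fintype.card (Fin d ↪ A) : ℝ) * μ := by
      intro i
      have := sum_embedding_apply (A := A) (fun u => y u) i
      rw [Fintype.card_coe, hAc, Finset.sum_coe_sort A y] at this
      rw [hμ]
      field_simp
      linarith
    simp only [this, Finset.sum_const, Finset.card_univ, nsmul_eq_mul, Fintype.card_fin]
    ring
  have hcard : (1 / 8 * N) ^ d ≤ (Fintype.card (Fin d ↪ A) : ℝ) := by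
    rw [Fintype.card_embedding_eq, Fintype.card_coe, Fintype.card_fin, hAc]
    have h1 := Nat.pow_sub_le_descFactorial a d
    have h2 : (((a + 1 - d) ^ d : ℕ) : ℝ) ≤ (a.descFactorial d : ℝ) := by exact_mod_cast h1
    refine le_trans ?_ h2
    rw [Nat.cast_pow]
    apply pow_le_pow_left₀ (by positivity)
    have h3 : (a : ℝ) + 1 ≤ ((a + 1 - d : ℕ) : ℝ) + d := by
      exact_mod_cast (by omega : a + 1 ≤ (a + 1 - d) + d)
    have h4 : (8 * d : ℝ) ≤ N := by rw [hN]; exact_mod_cast hN2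
    linarith
  rw [← Finset.mul_sum, hI]
  have hd' : (1 : ℝ) ≤ d := by exact_mod_cast hd
  have h6 : γ / 2 * μ ≤ θ + d * μ := by nlinarith
  calc γ ^ 2 / 8 * (1 / 8) ^ d * N ^ d * ∑ v, |y v|
      ≤ γ ^ 2 / 8 * (1 / 8) ^ d * N ^ d * (2 * N * μ) :=
        mul_le_mul_of_nonneg_left hb1 (by positivity)
    _ = γ / 2 * N * ((1 / 8 * N) ^ d * (γ / 2 * μ)) := by rw [mul_pow]; ring
    _ ≤ _ := by
      apply mul_le_mul_of_nonneg_left _ (by positivity)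
      exact mul_le_mul hcard h6 (by positivity) (by positivity)

end Weights

section Minimize

variable {V : Type} [Fintype V] [DecidableEq V]

/-- The weight function `w`, set to zero outside `E`. -/
def edgeWeight (E : Finset (Finset V)) (w : Finset V → ℝ) (A : Finset V) : ℝ :=
  if A ∈ E then w A else 0

/-- The weighted degree of `v`, counted over ordered edges. -/
noncomputable def weightedDegree (E : Finset (Finset V)) (d : ℕ) (w : Finset V → ℝ) (v : V) : ℝ :=
  ∑ x : Fin d → V, edgeWeight E w (insert v (Finset.univ.image x))

lemma image_cons {d : ℕ} (v : V) (x : Fin d → V) :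
    Finset.univ.image (Fin.cons v x : Fin (d + 1) → V) = insert v (Finset.univ.image x) := by
  ext a
  simp [Fin.exists_fin_succ, eq_comm]

lemma sum_mul_weightedDegree (E : Finset (Finset V)) (d : ℕ) (w : Finset V → ℝ) (y : V → ℝ) :
    (d + 1 : ℝ) * ∑ v, y v * weightedDegree E d w v =
      ∑ x : Fin d → V, ∑ v, (y v + ∑ i, y (x i)) *
        edgeWeight E w (insert v (Finset.univ.image x)) := by
  have h0 : ∑ v, y v * weightedDegree E d w v =
      ∑ z : Fin (d + 1) → V, y (z 0) * edgeWeight E w (Finset.univ.image z) := by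
    rw [sum_cons_eq]
    simp_rw [weightedDegree, Finset.mul_sum, image_cons, Fin.cons_zero]
  have h1 : ∀ i : Fin (d + 1), ∑ z : Fin (d + 1) → V,
      y (z i) * edgeWeight E w (Finset.univ.image z) =
      ∑ z : Fin (d + 1) → V, y (z 0) * edgeWeight E w (Finset.univ.image z) := by
    intro i
    rw [← Equiv.sum_comp (Equiv.arrowCongr (Equiv.swap 0 i) (Equiv.refl V))]
    refine Finset.sum_congr rfl fun z _ => ?_
    have e : Equiv.arrowCongr (Equiv.swap 0 i) (Equiv.refl V) z = z ∘ Equiv.swap 0 i := by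
      ext j; simp [Equiv.arrowCongr]
    rw [e]
    congr 2
    · simp
    · ext a
      simp only [Finset.mem_image, Finset.mem_univ, true_and, Function.comp]
      exact ⟨fun ⟨j, hj⟩ => ⟨_, hj⟩, fun ⟨j, hj⟩ => ⟨Equiv.swap 0 i j, by simpa using hj⟩⟩
  have h2 : (d + 1 : ℝ) * ∑ v, y v * weightedDegree E d w v = ∑ i : Fin (d + 1),
      ∑ z : Fin (d + 1) → V, y (z i) * edgeWeight E w (Finset.univ.image z) := by
    simp_rw [h1, ← h0]
    simp
  rw [h2, Finset.sum_comm]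
  simp_rw [← Finset.sum_mul]
  rw [sum_cons_eq, Finset.sum_comm]
  simp_rw [image_cons, Fin.sum_univ_succ, Fin.cons_zero, Fin.cons_succ]

lemma weightedDegree_combine (E : Finset (Finset V)) (d : ℕ) (w w' : Finset V → ℝ) (t : ℝ) (v : V) :
    weightedDegree E d (fun e => w e + t * (w' e - w e)) v =
      weightedDegree E d w v + t * (weightedDegree E d w' v - weightedDegree E d w v) := by
  simp only [weightedDegree]
  rw [← Finset.sum_sub_distrib, Finset.mul_sum, ← Finset.sum_add_distrib]
  refine Finset.sum_congr rfl fun x _ => ?_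
  unfold edgeWeight
  split_ifs <;> ring

lemma sum_abs_tuple_le {d : ℕ} (y : V → ℝ) :
    ∑ x : Fin d → V, ∑ v, |y v + ∑ i, y (x i)| ≤
      (d + 1) * (Fintype.card V : ℝ) ^ d * ∑ v, |y v| := by
  have h1 : ∑ x : Fin d → V, ∑ v, |y v + ∑ i, y (x i)| =
      ∑ z : Fin (d + 1) → V, |∑ i, y (z i)| := by
    rw [sum_cons_eq, Finset.sum_comm]
    simp_rw [Fin.sum_univ_succ, Fin.cons_zero, Fin.cons_succ]
  rw [h1]
  calc ∑ z : Fin (d + 1) → V, |∑ i, y (z i)| ≤ ∑ z : Fin (d + 1) → V, ∑ i, |y (z i)| :=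
        Finset.sum_le_sum fun _ _ => Finset.abs_sum_le_sum_abs _ _
    _ = ∑ i : Fin (d + 1), ∑ z : Fin (d + 1) → V, |y (z i)| := Finset.sum_comm
    _ = ∑ i : Fin (d + 1), (Fintype.card V : ℝ) ^ d * ∑ v, |y v| := by
      refine Finset.sum_congr rfl fun i _ => ?_
      have := Fintype.sum_piFinset_apply (fun v => |y v|) Finset.univ i
      simpa using this
    _ = _ := by simp; ring

theorem exists_balanced_weights (d : ℕ) (hd : 1 ≤ d) (γ : ℝ) (hγ : 0 < γ) (hγ1 : γ ≤ 1 / 2) :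
    ∃ C : ℝ, 1 ≤ C ∧ ∀ (V : Type) [Fintype V] [DecidableEq V] (E : Finset (Finset V)),
      (∀ e ∈ E, e.card = d + 1) →
      (∀ S : Finset V, S.card = d → (1 / 2 + γ) * (Fintype.card V : ℝ) ≤ (nbrs E S).card) →
      4 / γ ≤ Fintype.card V → 8 * d ≤ Fintype.card V →
      ∃ w : Finset V → ℝ, (∀ e, 1 ≤ w e ∧ w e ≤ C) ∧
        ∃ D : ℝ, ∀ v, weightedDegree E d w v = D := by
  set c := γ ^ 2 / 8 * (1 / 8 : ℝ) ^ d with hc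
  have hc0 : 0 < c := by positivity
  set C := (d + 2) / c + 1 with hC
  have hC1 : 1 ≤ C := by rw [hC]; have : 0 ≤ (d + 2) / c := by positivity
                         linarith
  refine ⟨C, hC1, ?_⟩
  intro V _ _ E hE hδ hN1 hN2
  set N := (Fintype.card V : ℝ) with hN
  have hNpos : 0 < N := lt_of_lt_of_le (by positivity) hN1
  let dev : (Finset V → ℝ) → V → ℝ := fun w v =>
    weightedDegree E d w v - (∑ u, weightedDegree E d w u) / N
  have hdev0 : ∀ w, ∑ v, dev w v = 0 := by
    intro w
    simp only [dev, Finset.sum_sub_distrib, Finset.sum_const, Finset.card_univ, nsmul_eq_mul]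
    rw [← hN]; field_simp; ring
  have hcont : Continuous fun w => ∑ v, dev w v ^ 2 := by
    simp only [dev, weightedDegree, edgeWeight]
    refine continuous_finsetSum _ fun v _ => Continuous.pow (Continuous.sub ?_ ?_) 2
    · refine continuous_finsetSum _ fun x _ => ?_
      split_ifs <;> fun_prop
    · refine Continuous.div_const (continuous_finsetSum _ fun u _ =>
        continuous_finsetSum _ fun x _ => ?_) _
      split_ifs <;> fun_prop
  obtain ⟨w, hw, hmin⟩ := (isCompact_Icc (a := fun _ : Finset V => (1 : ℝ)) (b := fun _ => C)).exists_isMinOn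
    ⟨fun _ => 1, le_rfl, fun _ => hC1⟩ hcont.continuousOn
  refine ⟨w, fun e => ⟨hw.1 e, hw.2 e⟩, (∑ u, weightedDegree E d w u) / N, ?_⟩
  set y := dev w with hy
  let w' : Finset V → ℝ := fun e => if ∑ v ∈ e, y v < 0 then C else 1
  have hw' : ∀ e, 1 ≤ w' e ∧ w' e ≤ C := by
    intro e; simp only [w']; split_ifs <;> constructor <;> linarith
  -- first-order optimality
  have hopt : 0 ≤ ∑ v, y v * (dev w' v - y v) := by
    have hcomb : ∀ t v, dev (fun e => w e + t * (w' e - w e)) v = y v + t * (dev w' v - y v) := by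
      intro t v
      simp only [hy, dev, weightedDegree_combine, Finset.sum_add_distrib, ← Finset.mul_sum,
        Finset.sum_sub_distrib]
      ring
    by_contra hneg
    push Not at hneg
    set p := ∑ v, y v * (dev w' v - y v)
    set S := ∑ v, (dev w' v - y v) ^ 2
    have hS : 0 ≤ S := Finset.sum_nonneg fun _ _ => sq_nonneg _
    have hq : ∀ t : ℝ, 0 ≤ t → t ≤ 1 → 0 ≤ 2 * t * p + t ^ 2 * S := by
      intro t ht0 ht1
      have hmem : (fun e => w e + t * (w' e - w e)) ∈ Set.Icc (fun _ : Finset V => (1 : ℝ)) (fun _ => C) := by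
        constructor
        · intro e
          have h1 := hw.1 e
          have h2 := (hw' e).1
          simp only at h1 ⊢
          nlinarith
        · intro e
          have h1 := hw.2 e
          have h2 := (hw' e).2
          simp only at h1 ⊢
          nlinarith
      have := hmin hmem
      simp only [Set.mem_ofPred_eq, hcomb] at this
      have e : ∑ v, (y v + t * (dev w' v - y v)) ^ 2 = ∑ v, dev w v ^ 2 + (2 * t * p + t ^ 2 * S) := by
        simp only [p, S, Finset.mul_sum, ← Finset.sum_add_distrib]
        exact Finset.sum_congr rfl fun v _ => by rw [← hy]; ring
      linarith
    have ht : 0 < -p / (S - p) := by apply div_pos <;> linarith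
    have ht1 : -p / (S - p) ≤ 1 := by rw [div_le_one (by linarith)]; linarith
    have := hq _ ht.le ht1
    set t := -p / (S - p) with htd
    have e1 : t * (S - p) = -p := div_mul_cancel₀ _ (by linarith : (0 : ℝ) < S - p).ne'
    nlinarith
  have hyy : ∀ u : Finset V → ℝ, ∑ v, y v * dev u v = ∑ v, y v * weightedDegree E d u v := by
    intro u
    simp only [dev, mul_sub, Finset.sum_sub_distrib, ← Finset.sum_mul]
    rw [hy, hdev0]; ring
  have hgain := sum_pos_part_edges_ge hd hγ hγ1 hδ hN1 hN2 (y := fun v => - y v)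
    (by rw [Finset.sum_neg_distrib, hy, hdev0, neg_zero])
  simp only [abs_neg, Finset.sum_neg_distrib] at hgain
  have habs := sum_abs_tuple_le (d := d) y
  have hpt : ∀ (x : Fin d → V) (v : V), (y v + ∑ i, y (x i)) *
      edgeWeight E w' (insert v (Finset.univ.image x)) ≤ |y v + ∑ i, y (x i)| -
        C * (if insert v (Finset.univ.image x) ∈ E then max (-y v + -∑ i, y (x i)) 0 else 0)
        + |y v + ∑ i, y (x i)| * 0 := by
    intro x v
    unfold edgeWeight
    split_ifs with h
    · have hcard := hE _ h
      have hinj : Function.Injective (Fin.cons v x : Fin (d + 1) → V) := by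
        have := Finset.card_image_iff.1
          (by rw [image_cons, hcard]; simp :
            (Finset.univ.image (Fin.cons v x : Fin (d + 1) → V)).card =
              (Finset.univ : Finset (Fin (d + 1))).card)
        simpa using this
      have hs : ∑ u ∈ insert v (Finset.univ.image x), y u = y v + ∑ i, y (x i) := by
        rw [← image_cons, Finset.sum_image hinj.injOn, Fin.sum_univ_succ]
        simp
      simp only [w', hs]
      set q := y v + ∑ i, y (x i)
      rw [show -y v + -∑ i, y (x i) = -q by simp only [q]; ring]
      split_ifs with h2
      · rw [max_eq_left (by linarith), abs_of_neg h2]; nlinarith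
      · push Not at h2
        rw [max_eq_right (by linarith), abs_of_nonneg h2]; linarith
    · have := abs_nonneg (y v + ∑ i, y (x i))
      nlinarith
  have hsum : (d + 1 : ℝ) * ∑ v, y v * weightedDegree E d w' v ≤
      (d + 1) * N ^ d * ∑ v, |y v| - C * (c * N ^ d * ∑ v, |y v|) := by
    rw [sum_mul_weightedDegree]
    refine (Finset.sum_le_sum fun x _ => Finset.sum_le_sum fun v _ => hpt x v).trans ?_
    simp only [mul_zero, add_zero, Finset.sum_sub_distrib, ← Finset.mul_sum]
    have e : ∀ x : Fin d → V, ∑ v, (if insert v (Finset.univ.image x) ∈ E then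
        max (-y v + -∑ i, y (x i)) 0 else 0) =
        ∑ v ∈ nbrs E (Finset.univ.image x), max (-y v + -∑ i, y (x i)) 0 := by
      intro x
      rw [nbrs, Finset.sum_filter]
    simp only [e]
    rw [← hN, ← hc] at hgain
    rw [← hN] at habs
    have := mul_le_mul_of_nonneg_left hgain (by linarith : 0 ≤ C)
    linarith
  have hA : 0 ≤ ∑ v, |y v| := Finset.sum_nonneg fun _ _ => abs_nonneg _
  have hCc : C * c = d + 2 + c := by rw [hC]; field_simp
  have hneg : (d + 1 : ℝ) * ∑ v, y v * weightedDegree E d w' v ≤ 0 := by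
    refine hsum.trans ?_
    have h1 : C * (c * N ^ d * ∑ v, |y v|) = (d + 2 + c) * (N ^ d * ∑ v, |y v|) := by
      rw [← hCc]; ring
    have h2 : 0 ≤ N ^ d * ∑ v, |y v| := by positivity
    rw [h1]
    nlinarith
  have hsq : ∑ v, y v * y v ≤ 0 := by
    have h1 : ∑ v, y v * (dev w' v - y v) = ∑ v, y v * dev w' v - ∑ v, y v * y v := by
      rw [← Finset.sum_sub_distrib]; exact Finset.sum_congr rfl fun _ _ => by ring
    rw [h1, hyy] at hopt
    have : ∑ v, y v * weightedDegree E d w' v ≤ 0 := by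
      by_contra hcon
      push Not at hcon
      have : (0 : ℝ) < (d + 1 : ℝ) * ∑ v, y v * weightedDegree E d w' v := by positivity
      linarith
    linarith
  intro v
  have h0 := (Finset.sum_eq_zero_iff_of_nonneg fun v _ => mul_self_nonneg (y v)).1
    (le_antisymm hsq (Finset.sum_nonneg fun v _ => mul_self_nonneg (y v))) v (Finset.mem_univ v)
  have : y v = 0 := mul_self_eq_zero.1 h0
  simp only [hy, dev] at this
  linarith

end Minimize

section Chain

variable {X V : Type} [Fintype V]

/-- The averaging operator of the chain which moves from `x` to `sh x v` with probability `K x v`. -/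
def stepAvg (K : X → V → ℝ) (sh : X → V → X) (g : X → ℝ) (x : X) : ℝ :=
  ∑ v, K x v * g (sh x v)

/-- The probability that the chain started at `x` performs the steps `s`. -/
def walkProb (K : X → V → ℝ) (sh : X → V → X) : (ℓ : ℕ) → X → (Fin ℓ → V) → ℝ
  | 0, _, _ => 1
  | ℓ + 1, x, s => K x (s 0) * walkProb K sh ℓ (sh x (s 0)) (Fin.tail s)

/-- The state reached from `x` by the steps `s`. -/
def walkEnd (sh : X → V → X) : (ℓ : ℕ) → X → (Fin ℓ → V) → X
  | 0, x, _ => x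
  | ℓ + 1, x, s => walkEnd sh ℓ (sh x (s 0)) (Fin.tail s)

/-- `I` is a closed set of states on which `K` is a transition kernel. -/
structure IsKernelOn (K : X → V → ℝ) (sh : X → V → X) (I : X → Prop) : Prop where
  nonneg : ∀ x, I x → ∀ v, 0 ≤ K x v
  sum_eq_one : ∀ x, I x → ∑ v, K x v = 1
  closed : ∀ x, I x → ∀ v, K x v ≠ 0 → I (sh x v)

variable {K : X → V → ℝ} {sh : X → V → X} {I : X → Prop}

lemma stepAvg_add (g h : X → ℝ) : stepAvg K sh (g + h) = stepAvg K sh g + stepAvg K sh h := by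
  funext x
  simp [stepAvg, mul_add, Finset.sum_add_distrib]

lemma stepAvg_sub (g h : X → ℝ) : stepAvg K sh (g - h) = stepAvg K sh g - stepAvg K sh h := by
  funext x
  simp [stepAvg, mul_sub, Finset.sum_sub_distrib]

lemma iterate_stepAvg_add (ℓ : ℕ) (g h : X → ℝ) :
    (stepAvg K sh)^[ℓ] (g + h) = (stepAvg K sh)^[ℓ] g + (stepAvg K sh)^[ℓ] h := by
  induction ℓ generalizing g h with
  | zero => rfl
  | succ ℓ ih => rw [Function.iterate_succ_apply, stepAvg_add, ih]; rfl

lemma iterate_stepAvg_sub (ℓ : ℕ) (g h : X → ℝ) :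
    (stepAvg K sh)^[ℓ] (g - h) = (stepAvg K sh)^[ℓ] g - (stepAvg K sh)^[ℓ] h := by
  induction ℓ generalizing g h with
  | zero => rfl
  | succ ℓ ih => rw [Function.iterate_succ_apply, stepAvg_sub, ih]; rfl

lemma stepAvg_sum (T : ℕ) (g : ℕ → X → ℝ) :
    stepAvg K sh (∑ t ∈ Finset.range T, g t) = ∑ t ∈ Finset.range T, stepAvg K sh (g t) := by
  induction T with
  | zero => funext x; simp [stepAvg]
  | succ T ih => rw [Finset.sum_range_succ, stepAvg_add, ih, Finset.sum_range_succ]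

lemma IsKernelOn.stepAvg_le (hK : IsKernelOn K sh I) {g h : X → ℝ} (hgh : ∀ x, I x → g x ≤ h x)
    {x : X} (hx : I x) : stepAvg K sh g x ≤ stepAvg K sh h x := by
  refine Finset.sum_le_sum fun v _ => ?_
  by_cases h0 : K x v = 0
  · simp [h0]
  · exact mul_le_mul_of_nonneg_left (hgh _ (hK.closed x hx v h0)) (hK.nonneg x hx v)

lemma IsKernelOn.stepAvg_const (hK : IsKernelOn K sh I) (a : ℝ) {x : X} (hx : I x) :
    stepAvg K sh (fun _ => a) x = a := by
  rw [stepAvg, ← Finset.sum_mul, hK.sum_eq_one x hx, one_mul]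

lemma IsKernelOn.iterate_stepAvg_const (hK : IsKernelOn K sh I) (a : ℝ) (ℓ : ℕ) :
    ∀ x, I x → (stepAvg K sh)^[ℓ] (fun _ => a) x = a := by
  induction ℓ with
  | zero => intro x _; rfl
  | succ ℓ ih =>
    intro x hx
    rw [Function.iterate_succ_apply']
    have h1 := hK.stepAvg_le (g := (stepAvg K sh)^[ℓ] fun _ => a) (h := fun _ => a)
      (fun y hy => (ih y hy).le) hx
    have h2 := hK.stepAvg_le (h := (stepAvg K sh)^[ℓ] fun _ => a) (g := fun _ => a)
      (fun y hy => (ih y hy).ge) hx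
    rw [hK.stepAvg_const a hx] at h1 h2
    exact le_antisymm h1 h2

lemma IsKernelOn.abs_iterate_stepAvg_le (hK : IsKernelOn K sh I) {g : X → ℝ} {M : ℝ}
    (hg : ∀ x, I x → |g x| ≤ M) (ℓ : ℕ) : ∀ x, I x → |(stepAvg K sh)^[ℓ] g x| ≤ M := by
  induction ℓ with
  | zero => exact hg
  | succ ℓ ih =>
    intro x hx
    rw [Function.iterate_succ_apply', abs_le]
    have h1 := hK.stepAvg_le (g := (stepAvg K sh)^[ℓ] g) (h := fun _ => M)
      (fun y hy => (abs_le.1 (ih y hy)).2) hx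
    have h2 := hK.stepAvg_le (h := (stepAvg K sh)^[ℓ] g) (g := fun _ => -M)
      (fun y hy => (abs_le.1 (ih y hy)).1) hx
    rw [hK.stepAvg_const _ hx] at h1 h2
    exact ⟨h2, h1⟩

lemma iterate_stepAvg_eq (g : X → ℝ) (ℓ : ℕ) (x : X) :
    (stepAvg K sh)^[ℓ] g x = ∑ s, walkProb K sh ℓ x s * g (walkEnd sh ℓ x s) := by
  induction ℓ generalizing x with
  | zero => simp [walkProb, walkEnd]
  | succ ℓ ih =>
    rw [Function.iterate_succ_apply', stepAvg, sum_cons_eq]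
    refine Finset.sum_congr rfl fun v _ => ?_
    rw [ih, Finset.mul_sum]
    refine Finset.sum_congr rfl fun s _ => ?_
    simp [walkProb, walkEnd, mul_assoc]

lemma IsKernelOn.walkProb_nonneg (hK : IsKernelOn K sh I) {ℓ : ℕ} {x : X} (hx : I x)
    (s : Fin ℓ → V) : 0 ≤ walkProb K sh ℓ x s := by
  induction ℓ generalizing x with
  | zero => simp [walkProb]
  | succ ℓ ih =>
    rw [walkProb]
    by_cases h0 : K x (s 0) = 0
    · simp [h0]
    · exact mul_nonneg (hK.nonneg x hx _) (ih (hK.closed x hx _ h0) _)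

lemma IsKernelOn.walkEnd_mem (hK : IsKernelOn K sh I) {ℓ : ℕ} {x : X} (hx : I x)
    (s : Fin ℓ → V) (h : walkProb K sh ℓ x s ≠ 0) : I (walkEnd sh ℓ x s) := by
  induction ℓ generalizing x with
  | zero => exact hx
  | succ ℓ ih =>
    rw [walkProb] at h
    exact ih (hK.closed x hx _ (left_ne_zero_of_mul h)) _ (right_ne_zero_of_mul h)

lemma IsKernelOn.walkProb_le (hK : IsKernelOn K sh I) {κ : ℝ} (hκ : ∀ x, I x → ∀ v, K x v ≤ κ)
    {ℓ : ℕ} {x : X} (hx : I x) (s : Fin ℓ → V) : walkProb K sh ℓ x s ≤ κ ^ ℓ := by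
  induction ℓ generalizing x with
  | zero => simp [walkProb]
  | succ ℓ ih =>
    have hκ0 : 0 ≤ κ := (hK.nonneg x hx (s 0)).trans (hκ x hx _)
    rw [walkProb, pow_succ']
    by_cases h0 : K x (s 0) = 0
    · rw [h0, zero_mul]; positivity
    · exact mul_le_mul (hκ x hx _) (ih (hK.closed x hx _ h0) _)
        (hK.walkProb_nonneg (hK.closed x hx _ h0) _) hκ0

/-- Exponential moment bound for an additive functional of the chain, from an approximate solution
`q` of the Poisson equation. -/
lemma IsKernelOn.sum_walkProb_mul_exp_le (hK : IsKernelOn K sh I) {f : V → ℝ} {q : X → ℝ}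
    {B η lam : ℝ} (hf : ∀ v, |f v| ≤ 1) (hq : ∀ x, I x → |q x| ≤ B)
    (hdrift : ∀ x, I x → ∑ v, K x v * (f v + q (sh x v)) ≤ q x + η)
    (hlam : 0 ≤ lam) (hlam1 : lam * (1 + 2 * B) ≤ 1) (ℓ : ℕ) {x : X} (hx : I x) :
    ∑ s, walkProb K sh ℓ x s * Real.exp (lam * ∑ i, f (s i)) ≤
      Real.exp (lam * (B + q x) + ℓ * (lam * η + lam ^ 2 * (1 + 2 * B) ^ 2)) := by
  set c := lam * η + lam ^ 2 * (1 + 2 * B) ^ 2 with hc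
  induction ℓ generalizing x with
  | zero =>
    have := abs_le.1 (hq x hx)
    have : 0 ≤ lam * (B + q x) := mul_nonneg hlam (by linarith)
    simpa [walkProb] using this
  | succ ℓ ih =>
    rw [sum_cons_eq]
    have h1 : ∀ v, ∑ s : Fin ℓ → V, walkProb K sh (ℓ + 1) x (Fin.cons v s) *
        Real.exp (lam * ∑ i, f ((Fin.cons v s : Fin (ℓ + 1) → V) i)) ≤
        Real.exp (lam * (B + q x) + ℓ * c) *
          (K x v * (1 + lam * (f v + q (sh x v) - q x) + lam ^ 2 * (1 + 2 * B) ^ 2)) := by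
      intro v
      have e : ∀ s : Fin ℓ → V, walkProb K sh (ℓ + 1) x (Fin.cons v s) *
        Real.exp (lam * ∑ i, f ((Fin.cons v s : Fin (ℓ + 1) → V) i)) =
        K x v * Real.exp (lam * f v) *
          (walkProb K sh ℓ (sh x v) s * Real.exp (lam * ∑ i, f (s i))) := by
        intro s
        rw [walkProb, Fin.sum_univ_succ, mul_add, Real.exp_add]
        simp only [Fin.cons_zero, Fin.cons_succ, Fin.tail_cons]
        ring
      simp_rw [e]
      rw [← Finset.mul_sum]
      by_cases h0 : K x v = 0
      · simp [h0]
      have hI := hK.closed x hx v h0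
      have hk := hK.nonneg x hx v
      set t := lam * (f v + q (sh x v) - q x) with ht
      have habs : |t| ≤ lam * (1 + 2 * B) := by
        rw [ht, abs_mul, abs_of_nonneg hlam]
        refine mul_le_mul_of_nonneg_left ?_ hlam
        have h1 := abs_le.1 (hf v)
        have h2 := abs_le.1 (hq _ hI)
        have h3 := abs_le.1 (hq x hx)
        rw [abs_le]
        constructor <;> linarith
      have hexp : Real.exp t ≤ 1 + t + lam ^ 2 * (1 + 2 * B) ^ 2 := by
        have h1 := Real.abs_exp_sub_one_sub_id_le (habs.trans hlam1)
        have h2 := (abs_le.1 h1).2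
        have h3 : t ^ 2 ≤ lam ^ 2 * (1 + 2 * B) ^ 2 := by
          rw [← sq_abs, ← mul_pow]
          exact pow_le_pow_left₀ (abs_nonneg _) habs 2
        linarith
      calc _ ≤ K x v * Real.exp (lam * f v) *
            Real.exp (lam * (B + q (sh x v)) + ℓ * c) :=
            mul_le_mul_of_nonneg_left (ih hI) (by positivity)
        _ = Real.exp (lam * (B + q x) + ℓ * c) * (K x v * Real.exp t) := by
            rw [mul_assoc, ← Real.exp_add, mul_left_comm, ← Real.exp_add]
            congr 2
            rw [ht]; ring
        _ ≤ _ := by gcongr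
    refine (Finset.sum_le_sum fun v _ => h1 v).trans ?_
    rw [← Finset.mul_sum]
    have h2 : ∑ v, K x v * (1 + lam * (f v + q (sh x v) - q x) + lam ^ 2 * (1 + 2 * B) ^ 2) =
        (1 - lam * q x + lam ^ 2 * (1 + 2 * B) ^ 2) * ∑ v, K x v +
          lam * ∑ v, K x v * (f v + q (sh x v)) := by
      rw [Finset.mul_sum, Finset.mul_sum, ← Finset.sum_add_distrib]
      exact Finset.sum_congr rfl fun v _ => by ring
    rw [h2, hK.sum_eq_one x hx]
    have h3 := mul_le_mul_of_nonneg_left (hdrift x hx) hlam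
    have h4 : (1 - lam * q x + lam ^ 2 * (1 + 2 * B) ^ 2) * 1 +
          lam * ∑ v, K x v * (f v + q (sh x v)) ≤ Real.exp c := by
      refine le_trans ?_ (Real.add_one_le_exp c)
      rw [hc]; linarith
    calc _ ≤ Real.exp (lam * (B + q x) + ℓ * c) * Real.exp c := by gcongr
      _ = _ := by rw [← Real.exp_add]; congr 1; push_cast; ring

/-- A chain with small transition probabilities is likely to be self-avoiding and to avoid `U`. -/
lemma IsKernelOn.le_sum_walkProb_avoiding (hK : IsKernelOn K sh I) {κ : ℝ} (hκ0 : 0 ≤ κ)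
    (hκ : ∀ x, I x → ∀ v, K x v ≤ κ) {ℓ : ℕ} {x : X} (hx : I x) (U : Finset V)
    (hU : κ * (U.card + ℓ) ≤ 1) :
    (1 - κ * (U.card + ℓ)) ^ ℓ ≤
      ∑ s, if Function.Injective s ∧ ∀ i, s i ∉ U then walkProb K sh ℓ x s else 0 := by
  induction ℓ generalizing x U with
  | zero => simp [walkProb, Function.injective_of_subsingleton]
  | succ ℓ ih =>
    push_cast at hU ⊢
    rw [sum_cons_eq]
    set a := 1 - κ * (U.card + (ℓ + 1)) with ha
    have ha0 : 0 ≤ a := by linarith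
    have h1 : ∀ v, (if v ∈ U then 0 else K x v * a ^ ℓ) ≤ ∑ s : Fin ℓ → V,
        if Function.Injective (Fin.cons v s : Fin (ℓ + 1) → V) ∧
          ∀ i, (Fin.cons v s : Fin (ℓ + 1) → V) i ∉ U
        then walkProb K sh (ℓ + 1) x (Fin.cons v s) else 0 := by
      intro v
      by_cases h0 : K x v = 0
      · simp [walkProb, h0]
      have hI := hK.closed x hx v h0
      split_ifs with hv
      · refine Finset.sum_nonneg fun s _ => ?_
        split_ifs
        · exact hK.walkProb_nonneg hx _
        · exact le_rfl
      · have hc : ((insert v U).card : ℝ) + ℓ = U.card + (ℓ + 1) := by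
          rw [Finset.card_insert_of_notMem hv]; push_cast; ring
        have h := ih hI (insert v U) (by rw [hc]; exact hU)
        rw [hc] at h
        refine (mul_le_mul_of_nonneg_left h (hK.nonneg x hx v)).trans ?_
        rw [Finset.mul_sum]
        refine Finset.sum_le_sum fun s _ => ?_
        by_cases hs : Function.Injective s ∧ ∀ i, s i ∉ insert v U
        · rw [if_pos hs, if_pos]
          · simp [walkProb]
          · simp only [Finset.mem_insert, not_or] at hs
            refine ⟨Fin.cons_injective_iff.2 ⟨?_, hs.1⟩, fun i => ?_⟩
            · rintro ⟨i, hi⟩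
              exact (hs.2 i).1 hi
            · refine Fin.cases ?_ (fun i => ?_) i
              · simpa using hv
              · simpa using (hs.2 i).2
        · rw [if_neg hs, mul_zero]
          split_ifs
          · exact hK.walkProb_nonneg hx _
          · exact le_rfl
    refine le_trans ?_ (Finset.sum_le_sum fun v _ => h1 v)
    have h2 : ∑ v, (if v ∈ U then 0 else K x v * a ^ ℓ) =
        (∑ v, K x v - ∑ v ∈ U, K x v) * a ^ ℓ := by
      rw [← Finset.sum_filter_add_sum_filter_not Finset.univ (· ∈ U) (K x ·)]
      simp only [Finset.filter_univ_mem, add_sub_cancel_left]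
      rw [Finset.sum_mul, Finset.sum_filter]
      exact Finset.sum_congr rfl fun v _ => by by_cases h : v ∈ U <;> simp [h]
    rw [h2, pow_succ', hK.sum_eq_one x hx]
    have h3 : ∑ v ∈ U, K x v ≤ U.card * κ := by
      simpa using Finset.sum_le_card_nsmul U (K x ·) κ fun v _ => hκ x hx v
    refine mul_le_mul_of_nonneg_right ?_ (by positivity)
    rw [ha]
    nlinarith [mul_nonneg hκ0 (by positivity : (0 : ℝ) ≤ ℓ + 1)]

variable [Fintype X]

/-- If the `ℓ`-step chain dominates a multiple of its stationary measure `W`, then the Poisson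
equation is approximately solvable with uniform bounds. -/
lemma IsKernelOn.exists_corrector (hK : IsKernelOn K sh I) {W : X → ℝ} (hW : 0 < ∑ x, W x)
    (hinv : ∀ g : X → ℝ, ∑ x, W x * stepAvg K sh g x = ∑ x, W x * g x) {ℓ : ℕ} {ε : ℝ}
    (hε : 0 < ε)
    (hmin : ∀ g : X → ℝ, (∀ x, I x → 0 ≤ g x) → ∀ x, I x →
      ε * ∑ x, W x * g x ≤ (∑ x, W x) * (stepAvg K sh)^[ℓ] g x)
    {g : X → ℝ} (hg : ∑ x, W x * g x = 0) (hg1 : ∀ x, I x → |g x| ≤ 1) (j : ℕ) :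
    ∃ q : X → ℝ, (∀ x, I x → |q x| ≤ ℓ * ((1 - (1 - ε) ^ j) / ε)) ∧
      ∀ x, I x → |g x + stepAvg K sh q x - q x| ≤ (1 - ε) ^ j := by
  have hcontr : ∀ (g : X → ℝ) (M : ℝ), ∑ x, W x * g x = 0 → (∀ x, I x → |g x| ≤ M) →
      ∀ x, I x → |(stepAvg K sh)^[ℓ] g x| ≤ M * (1 - ε) := by
    intro g M hg hgM x hx
    have hsum : ∑ x, W x * M = (∑ x, W x) * M := by rw [Finset.sum_mul]
    have h1 := hmin ((fun _ => M) - g)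
      (fun y hy => by have := abs_le.1 (hgM y hy); simp only [Pi.sub_apply]; linarith) x hx
    have h2 := hmin ((fun _ => M) + g)
      (fun y hy => by have := abs_le.1 (hgM y hy); simp only [Pi.add_apply]; linarith) x hx
    rw [iterate_stepAvg_sub] at h1
    rw [iterate_stepAvg_add] at h2
    simp only [Pi.sub_apply, Pi.add_apply, mul_sub, mul_add, Finset.sum_sub_distrib,
      Finset.sum_add_distrib, hg, hsum, hK.iterate_stepAvg_const M ℓ x hx] at h1 h2
    rw [abs_le]
    constructor
    · by_contra h
      push Not at h
      nlinarith
    · by_contra h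
      push Not at h
      nlinarith
  induction j with
  | zero => exact ⟨0, by simp, by simpa [stepAvg] using hg1⟩
  | succ j ih =>
    obtain ⟨q, hq1, hq2⟩ := ih
    set r : X → ℝ := g + stepAvg K sh q - q with hr
    have hr0 : ∑ x, W x * r x = 0 := by
      simp only [hr, Pi.sub_apply, Pi.add_apply, mul_sub, mul_add, Finset.sum_sub_distrib,
        Finset.sum_add_distrib, hg, hinv]
      ring
    have hr1 : ∀ x, I x → |r x| ≤ (1 - ε) ^ j := fun x hx => by simpa [hr] using hq2 x hx
    refine ⟨q + ∑ t ∈ Finset.range ℓ, (stepAvg K sh)^[t] r, fun x hx => ?_, fun x hx => ?_⟩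
    · rw [Pi.add_apply, Finset.sum_apply]
      refine (abs_add_le _ _).trans ?_
      have h1 : |∑ t ∈ Finset.range ℓ, (stepAvg K sh)^[t] r x| ≤ ℓ * (1 - ε) ^ j := by
        refine (Finset.abs_sum_le_sum_abs _ _).trans ?_
        refine (Finset.sum_le_sum fun t _ => hK.abs_iterate_stepAvg_le hr1 t x hx).trans ?_
        simp
      refine (add_le_add (hq1 x hx) h1).trans (le_of_eq ?_)
      field_simp
      ring
    · rw [stepAvg_add, stepAvg_sum]
      have e : ∑ t ∈ Finset.range ℓ, stepAvg K sh ((stepAvg K sh)^[t] r) -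
          ∑ t ∈ Finset.range ℓ, (stepAvg K sh)^[t] r = (stepAvg K sh)^[ℓ] r - r := by
        rw [← Finset.sum_sub_distrib]
        simp_rw [← Function.iterate_succ_apply']
        exact Finset.sum_range_sub (fun t => (stepAvg K sh)^[t] r) ℓ
      have e2 := congrFun e x
      simp only [Pi.sub_apply] at e2
      have e3 : r x = g x + stepAvg K sh q x - q x := rfl
      have := hcontr r _ hr0 hr1 x hx
      rw [pow_succ]
      convert this using 2
      simp only [Pi.add_apply]
      linarith

end Chain

section EdgeChain

variable {V : Type} [Fintype V] [DecidableEq V] [Inhabited V]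

/-- Drop the first vertex of `x` and append `v`. -/
def shiftState {d : ℕ} (x : Fin d → V) (v : V) : Fin d → V :=
  fun i => appSeq d (extSeq x) (fun _ => v) (i + 1)

/-- The total weight of the edges through the vertices of `x`. -/
noncomputable def stateWeight (E : Finset (Finset V)) (w : Finset V → ℝ) {d : ℕ} (x : Fin d → V) : ℝ :=
  ∑ v, edgeWeight E w (insert v (Finset.univ.image x))

/-- The transition probabilities of the random tight walk governed by the edge weights `w`. -/
noncomputable def edgeKernel (E : Finset (Finset V)) (w : Finset V → ℝ) {d : ℕ} (x : Fin d → V)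
    (v : V) : ℝ :=
  edgeWeight E w (insert v (Finset.univ.image x)) / stateWeight E w x

lemma window_extSeq {d : ℕ} (x : Fin d → V) : window (extSeq x) 0 d = Finset.univ.image x := by
  ext a
  simp only [window, Finset.mem_image, Finset.mem_range, Finset.mem_univ, true_and, zero_add]
  constructor
  · rintro ⟨i, hi, rfl⟩
    exact ⟨⟨i, hi⟩, by simp [extSeq, hi]⟩
  · rintro ⟨i, rfl⟩
    exact ⟨i, i.2, by simp [extSeq]⟩

lemma extSeq_append {m n : ℕ} (u : Fin m → V) (y : Fin n → V) (i : ℕ) :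
    extSeq (Fin.append u y) i = appSeq m (extSeq u) (extSeq y) i := by
  unfold extSeq appSeq
  by_cases h1 : i < m
  · have : (⟨i, by omega⟩ : Fin (m + n)) = Fin.castAdd n ⟨i, h1⟩ := rfl
    simp only [h1, show i < m + n by omega, dif_pos, if_pos, this, Fin.append_left]
  by_cases h2 : i < m + n
  · have : (⟨i, h2⟩ : Fin (m + n)) = Fin.natAdd m ⟨i - m, by omega⟩ := by
      ext; simp; omega
    simp only [h1, h2, show i - m < n by omega, dif_pos, if_neg, this, Fin.append_right,
      not_false_eq_true]
  · simp [h1, h2, show ¬ i - m < n by omega]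

lemma appSeq_shiftState {d ℓ : ℕ} (x : Fin d → V) (s : Fin (ℓ + 1) → V) (i : ℕ) :
    appSeq d (extSeq (shiftState x (s 0))) (extSeq (Fin.tail s)) i =
      appSeq d (extSeq x) (extSeq s) (i + 1) := by
  unfold appSeq
  by_cases h1 : i + 1 < d
  · simp [h1, show i < d by omega, extSeq, shiftState, appSeq]
  by_cases h2 : i < d
  · have h3 : i + 1 - d = 0 := by omega
    simp [h1, h2, extSeq, shiftState, appSeq, h3]
  · have h3 : i + 1 - d = (i - d) + 1 := by omega
    simp only [h1, h2, if_neg, not_false_eq_true, h3, extSeq, Fin.tail]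
    by_cases h4 : i - d < ℓ
    · simp [h4]
    · simp [h4]

lemma walkEnd_shiftState {d : ℕ} (ℓ : ℕ) (x : Fin d → V) (s : Fin ℓ → V) (i : Fin d) :
    walkEnd shiftState ℓ x s i = appSeq d (extSeq x) (extSeq s) (ℓ + i) := by
  induction ℓ generalizing x with
  | zero => simp [walkEnd, appSeq, extSeq]
  | succ ℓ ih =>
    rw [walkEnd, ih, appSeq_shiftState]
    congr 1
    omega

lemma window_appSeq_zero {d ℓ : ℕ} (x : Fin d → V) (s : Fin (ℓ + 1) → V) :
    window (appSeq d (extSeq x) (extSeq s)) 0 (d + 1) =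
      insert (s 0) (Finset.univ.image x) := by
  rw [window_succ_last, ← window_extSeq x]
  congr 1
  · simp [appSeq, extSeq]
  · exact window_congr fun i hi => by simp [appSeq, hi]

lemma window_appSeq_succ {d ℓ : ℕ} (x : Fin d → V) (s : Fin (ℓ + 1) → V) (i j : ℕ) :
    window (appSeq d (extSeq x) (extSeq s)) (i + 1) j =
      window (appSeq d (extSeq (shiftState x (s 0))) (extSeq (Fin.tail s))) i j :=
  window_congr fun a _ => by rw [appSeq_shiftState]; congr 1; omega

lemma image_shiftState {d : ℕ} (x : Fin d → V) (v : V) :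
    insert (appSeq d (extSeq x) (fun _ => v) 0) (Finset.univ.image (shiftState x v)) =
      insert v (Finset.univ.image x) := by
  have h1 : Finset.univ.image (shiftState x v) =
      window (appSeq d (extSeq x) (fun _ => v)) 1 d := by
    rw [← window_extSeq]
    exact window_congr fun i hi => by simp [extSeq, shiftState, hi, add_comm]
  rw [h1, ← window_succ_first, window_succ_last, ← window_extSeq x]
  congr 1
  · simp [appSeq]
  · exact window_congr fun i hi => by simp [appSeq, hi]

lemma injective_of_card_image {d : ℕ} {x : Fin d → V} (h : (Finset.univ.image x).card = d) :
    Function.Injective x := by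
  have := Finset.card_image_iff.1 (h.trans (by simp : d = (Finset.univ : Finset (Fin d)).card))
  simpa using this

lemma card_image_of_card_insert {d : ℕ} {x : Fin d → V} {v : V}
    (h : (insert v (Finset.univ.image x)).card = d + 1) : (Finset.univ.image x).card = d := by
  have h1 := Finset.card_insert_le v (Finset.univ.image x)
  have h2 := (Finset.card_image_le (s := Finset.univ) (f := x))
  simp only [Finset.card_univ, Fintype.card_fin] at h2
  omega

variable {E : Finset (Finset V)} {w : Finset V → ℝ} {d : ℕ} {C : ℝ}

lemma edgeWeight_nonneg (hw : ∀ e, 1 ≤ w e ∧ w e ≤ C) (A : Finset V) : 0 ≤ edgeWeight E w A := by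
  unfold edgeWeight
  split_ifs
  · linarith [(hw A).1]
  · exact le_rfl

lemma edgeWeight_le (hw : ∀ e, 1 ≤ w e ∧ w e ≤ C) (A : Finset V) : edgeWeight E w A ≤ C := by
  unfold edgeWeight
  split_ifs
  · exact (hw A).2
  · linarith [(hw A).1, (hw A).2]

lemma stateWeight_nonneg (hw : ∀ e, 1 ≤ w e ∧ w e ≤ C) (x : Fin d → V) :
    0 ≤ stateWeight E w x :=
  Finset.sum_nonneg fun _ _ => edgeWeight_nonneg hw _

lemma stateWeight_le (hw : ∀ e, 1 ≤ w e ∧ w e ≤ C) (x : Fin d → V) :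
    stateWeight E w x ≤ C * Fintype.card V := by
  refine (Finset.sum_le_card_nsmul _ _ C fun v _ => edgeWeight_le hw _).trans (le_of_eq ?_)
  simp [mul_comm]

lemma stateWeight_eq_zero (hE : ∀ e ∈ E, e.card = d + 1) {x : Fin d → V}
    (hx : ¬ Function.Injective x) : stateWeight E w x = 0 := by
  refine Finset.sum_eq_zero fun v _ => ?_
  rw [edgeWeight, if_neg]
  exact fun h => hx (injective_of_card_image (card_image_of_card_insert (hE _ h)))

lemma le_stateWeight (hw : ∀ e, 1 ≤ w e ∧ w e ≤ C)
    (hδ : ∀ S : Finset V, S.card = d → (1 / 2 : ℝ) * (Fintype.card V : ℝ) ≤ (nbrs E S).card)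
    {x : Fin d → V} (hx : Function.Injective x) :
    (1 / 2 : ℝ) * Fintype.card V ≤ stateWeight E w x := by
  refine (hδ (Finset.univ.image x) (by rw [Finset.card_image_of_injective _ hx]; simp)).trans ?_
  rw [nbrs, Finset.card_filter, Nat.cast_sum]
  refine Finset.sum_le_sum fun v _ => ?_
  unfold edgeWeight
  split_ifs
  · simpa using (hw _).1
  · simp

lemma stateWeight_mul_edgeKernel (hw : ∀ e, 1 ≤ w e ∧ w e ≤ C) (x : Fin d → V) (v : V) :
    stateWeight E w x * edgeKernel E w x v =
      edgeWeight E w (insert v (Finset.univ.image x)) := by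
  by_cases h : stateWeight E w x = 0
  · rw [h, zero_mul]
    exact ((Finset.sum_eq_zero_iff_of_nonneg fun _ _ => edgeWeight_nonneg hw _).1 h v
      (Finset.mem_univ v)).symm
  · exact mul_div_cancel₀ _ h

lemma sum_stateWeight_mul_stepAvg (hw : ∀ e, 1 ≤ w e ∧ w e ≤ C) (g : (Fin d → V) → ℝ) :
    ∑ x, stateWeight E w x * stepAvg (edgeKernel E w) shiftState g x =
      ∑ x, stateWeight E w x * g x := by
  have h1 : ∀ x : Fin d → V, stateWeight E w x * stepAvg (edgeKernel E w) shiftState g x =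
      ∑ v, edgeWeight E w (insert v (Finset.univ.image x)) * g (shiftState x v) := by
    intro x
    rw [stepAvg, Finset.mul_sum]
    refine Finset.sum_congr rfl fun v _ => ?_
    rw [← mul_assoc, stateWeight_mul_edgeKernel hw]
  have h2 : ∑ z : Fin (d + 1) → V, edgeWeight E w (Finset.univ.image z) * g (Fin.tail z) =
      ∑ v, ∑ x : Fin d → V, edgeWeight E w (insert v (Finset.univ.image x)) *
        g (shiftState x v) := by
    rw [← Fintype.sum_prod_type'
      (f := fun v x => edgeWeight E w (insert v (Finset.univ.image x)) * g (shiftState x v))]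
    rw [← Equiv.sum_comp (Fin.snocEquiv fun _ => V)]
    refine Finset.sum_congr rfl fun p _ => ?_
    have e1 : Finset.univ.image (Fin.snoc (α := fun _ => V) p.2 p.1 : Fin (d + 1) → V) =
        insert p.1 (Finset.univ.image p.2) := by
      ext a
      simp [Fin.exists_fin_succ', eq_comm, or_comm]
    have e2 : Fin.tail (Fin.snoc (α := fun _ => V) p.2 p.1 : Fin (d + 1) → V) =
        shiftState p.2 p.1 := by
      funext i
      simp [Fin.tail, Fin.snoc, shiftState, appSeq, extSeq]
      split_ifs <;> rfl
    simp only [Fin.snocEquiv, Equiv.coe_fn_mk, e1, e2]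
  simp_rw [h1]
  rw [Finset.sum_comm, ← h2, sum_cons_eq, Finset.sum_comm]
  simp_rw [image_cons, Fin.tail_cons, stateWeight, Finset.sum_mul]

lemma isKernelOn_edgeKernel (hE : ∀ e ∈ E, e.card = d + 1) (hw : ∀ e, 1 ≤ w e ∧ w e ≤ C)
    (hδ : ∀ S : Finset V, S.card = d → (1 / 2 : ℝ) * (Fintype.card V : ℝ) ≤ (nbrs E S).card) :
    IsKernelOn (edgeKernel E w) shiftState (fun x : Fin d → V => Function.Injective x) where
  nonneg x _ v := div_nonneg (edgeWeight_nonneg hw _) (stateWeight_nonneg hw x)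
  sum_eq_one x hx := by
    unfold edgeKernel
    rw [← Finset.sum_div]
    have h1 := le_stateWeight hw hδ hx
    have h2 : (0 : ℝ) < Fintype.card V := by exact_mod_cast Fintype.card_pos
    exact div_self (by linarith : (0 : ℝ) < stateWeight E w x).ne'
  closed x _ v h := by
    have h1 : insert v (Finset.univ.image x) ∈ E := by
      by_contra hn
      exact h (by simp [edgeKernel, edgeWeight, hn])
    have h2 := hE _ h1
    rw [← image_shiftState] at h2
    exact injective_of_card_image (card_image_of_card_insert h2)

lemma edgeKernel_le (hw : ∀ e, 1 ≤ w e ∧ w e ≤ C)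
    (hδ : ∀ S : Finset V, S.card = d → (1 / 2 : ℝ) * (Fintype.card V : ℝ) ≤ (nbrs E S).card)
    {x : Fin d → V} (hx : Function.Injective x) (v : V) :
    edgeKernel E w x v ≤ 2 * C / Fintype.card V := by
  have h1 := le_stateWeight hw hδ hx
  have h2 : (0 : ℝ) < Fintype.card V := by exact_mod_cast Fintype.card_pos
  have hC : 0 ≤ C := by linarith [(hw ∅).1, (hw ∅).2]
  rw [edgeKernel, div_le_div_iff₀ (by linarith) h2]
  have := edgeWeight_le (E := E) hw (insert v (Finset.univ.image x))
  nlinarith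

lemma le_edgeKernel (hw : ∀ e, 1 ≤ w e ∧ w e ≤ C)
    (hδ : ∀ S : Finset V, S.card = d → (1 / 2 : ℝ) * (Fintype.card V : ℝ) ≤ (nbrs E S).card)
    {x : Fin d → V} (hx : Function.Injective x) {v : V} (hv : insert v (Finset.univ.image x) ∈ E) :
    1 / (C * Fintype.card V) ≤ edgeKernel E w x v := by
  have h1 := le_stateWeight hw hδ hx
  have h2 : (0 : ℝ) < Fintype.card V := by exact_mod_cast Fintype.card_pos
  have hC : 0 < C := by linarith [(hw ∅).1, (hw ∅).2]
  have h3 := stateWeight_le (E := E) hw x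
  rw [edgeKernel, edgeWeight, if_pos hv]
  exact div_le_div₀ (by linarith [(hw (insert v (Finset.univ.image x))).1]) (hw _).1
    (by linarith) h3

lemma window_mem_of_walkProb_ne_zero {ℓ : ℕ} (x : Fin d → V) (s : Fin ℓ → V)
    (h : walkProb (edgeKernel E w) shiftState ℓ x s ≠ 0) (i : ℕ) (hi : i < ℓ) :
    window (appSeq d (extSeq x) (extSeq s)) i (d + 1) ∈ E := by
  induction ℓ generalizing x i with
  | zero => omega
  | succ ℓ ih =>
    rw [walkProb] at h
    rcases i with _ | i
    · rw [window_appSeq_zero]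
      by_contra hn
      exact h (by simp [edgeKernel, edgeWeight, hn])
    · rw [window_appSeq_succ]
      exact ih _ _ (right_ne_zero_of_mul h) i (by omega)

lemma le_walkProb (hE : ∀ e ∈ E, e.card = d + 1) (hw : ∀ e, 1 ≤ w e ∧ w e ≤ C)
    (hδ : ∀ S : Finset V, S.card = d → (1 / 2 : ℝ) * (Fintype.card V : ℝ) ≤ (nbrs E S).card)
    {ℓ : ℕ} {x : Fin d → V} (hx : Function.Injective x) (s : Fin ℓ → V)
    (h : ∀ i < ℓ, window (appSeq d (extSeq x) (extSeq s)) i (d + 1) ∈ E) :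
    (1 / (C * Fintype.card V)) ^ ℓ ≤ walkProb (edgeKernel E w) shiftState ℓ x s := by
  have hC : 0 < C := by linarith [(hw ∅).1, (hw ∅).2]
  have h2 : (0 : ℝ) < Fintype.card V := by exact_mod_cast Fintype.card_pos
  induction ℓ generalizing x with
  | zero => simp [walkProb]
  | succ ℓ ih =>
    rw [walkProb, pow_succ']
    have h0 := h 0 (by omega)
    rw [window_appSeq_zero] at h0
    have h3 := le_edgeKernel hw hδ hx h0
    have h4 : 0 < 1 / (C * Fintype.card V) := by positivity
    have hI := (isKernelOn_edgeKernel hE hw hδ).closed x hx (s 0) (by linarith)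
    refine mul_le_mul h3 (ih hI _ fun i hi => ?_) (by positivity) (by linarith)
    rw [← window_appSeq_succ]
    exact h (i + 1) (by omega)

lemma walkEnd_append {M : ℕ} (x : Fin d → V) (u : Fin M → V) (y : Fin d → V) :
    walkEnd shiftState (M + d) x (Fin.append u y) = y := by
  funext i
  rw [walkEnd_shiftState, show M + d + (i : ℕ) = d + (M + i) by omega, appSeq_last, extSeq_append,
    appSeq_last]
  simp [extSeq]

lemma half_pow_le_card_injective (hN : 2 * d ≤ Fintype.card V) :
    ((Fintype.card V : ℝ) / 2) ^ d ≤
      (Finset.univ.filter fun x : Fin d → V => Function.Injective x).card := by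
  have h1 : (Finset.univ.filter fun x : Fin d → V => Function.Injective x).card =
      (Fintype.card V).descFactorial d := by
    rw [← Fintype.card_subtype, Fintype.card_congr (Equiv.subtypeInjectiveEquivEmbedding (Fin d) V),
      Fintype.card_embedding_eq, Fintype.card_fin]
  rw [h1]
  refine le_trans ?_ (Nat.cast_le.2 (Nat.pow_sub_le_descFactorial _ d))
  rw [Nat.cast_pow]
  refine pow_le_pow_left₀ (by positivity) ?_ d
  rw [Nat.cast_sub (by omega)]
  have : (2 * d : ℝ) ≤ Fintype.card V := by exact_mod_cast hN
  push_cast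
  linarith

/-- A lower bound for the number of connecting walks gives a minorisation of the chain by its
stationary measure. -/
lemma minorisation_of_connectors (hE : ∀ e ∈ E, e.card = d + 1) (hw : ∀ e, 1 ≤ w e ∧ w e ≤ C)
    (hδ : ∀ S : Finset V, S.card = d → (1 / 2 : ℝ) * (Fintype.card V : ℝ) ≤ (nbrs E S).card)
    (hN : 2 * d ≤ Fintype.card V) {M : ℕ} {c : ℝ} (hc : 0 < c)
    (hconn : ∀ x y : Fin d → V, Function.Injective x → Function.Injective y →
      c * (Fintype.card V : ℝ) ^ M ≤ (connectors E ∅ d M (extSeq x) (extSeq y)).card)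
    {g : (Fin d → V) → ℝ} (hg : ∀ x, Function.Injective x → 0 ≤ g x) {x : Fin d → V}
    (hx : Function.Injective x) :
    c / (2 ^ (d + 1) * C ^ (M + d + 1)) * ∑ y, stateWeight E w y * g y ≤
      (∑ y : Fin d → V, stateWeight E w y) *
        (stepAvg (edgeKernel E w) shiftState)^[M + d] g x := by
  set N := (Fintype.card V : ℝ) with hNdef
  have hN0 : 0 < N := by rw [hNdef]; exact_mod_cast Fintype.card_pos
  have hC : 0 < C := by linarith [(hw ∅).1, (hw ∅).2]
  have hK := isKernelOn_edgeKernel hE hw hδ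
  set J := Finset.univ.filter fun x : Fin d → V => Function.Injective x with hJ
  have hg0 : 0 ≤ ∑ y ∈ J, g y := Finset.sum_nonneg fun y hy => hg y (by simpa [hJ] using hy)
  have h1 : ∑ y, stateWeight E w y * g y ≤ C * N * ∑ y ∈ J, g y := by
    rw [Finset.mul_sum, hJ, Finset.sum_filter]
    refine Finset.sum_le_sum fun y _ => ?_
    split_ifs with hy
    · exact mul_le_mul_of_nonneg_right (stateWeight_le hw y) (hg y hy)
    · rw [stateWeight_eq_zero hE hy, zero_mul]
  have h2 : (N / 2) ^ (d + 1) ≤ ∑ y : Fin d → V, stateWeight E w y := by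
    calc (N / 2) ^ (d + 1) = (N / 2) ^ d * (1 / 2 * N) := by ring
      _ ≤ J.card * (1 / 2 * N) := by
        gcongr
        exact half_pow_le_card_injective hN
      _ = ∑ y ∈ J, (1 / 2 * N) := by simp
      _ ≤ ∑ y ∈ J, stateWeight E w y :=
        Finset.sum_le_sum fun y hy => le_stateWeight hw hδ (by simpa [hJ] using hy)
      _ ≤ _ := Finset.sum_le_sum_of_subset_of_nonneg (Finset.subset_univ _)
        fun y _ _ => stateWeight_nonneg hw y
  have h3 : c * N ^ M * (1 / (C * N)) ^ (M + d) * ∑ y ∈ J, g y ≤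
      (stepAvg (edgeKernel E w) shiftState)^[M + d] g x := by
    rw [iterate_stepAvg_eq, ← Equiv.sum_comp (Fin.appendEquiv M d), Fintype.sum_prod_type,
      Finset.sum_comm, Finset.mul_sum, hJ, Finset.sum_filter]
    refine Finset.sum_le_sum fun y _ => ?_
    have e : ∀ u : Fin M → V, Fin.appendEquiv M d (u, y) = Fin.append u y := fun _ => rfl
    simp_rw [e, walkEnd_append]
    rw [← Finset.sum_mul]
    split_ifs with hy
    · refine mul_le_mul_of_nonneg_right ?_ (hg y hy)
      calc c * N ^ M * (1 / (C * N)) ^ (M + d)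
          ≤ (connectors E ∅ d M (extSeq x) (extSeq y)).card * (1 / (C * N)) ^ (M + d) :=
            mul_le_mul_of_nonneg_right (hconn x y hx hy) (by positivity)
        _ = ∑ u ∈ connectors E ∅ d M (extSeq x) (extSeq y), (1 / (C * N)) ^ (M + d) := by simp
        _ ≤ ∑ u ∈ connectors E ∅ d M (extSeq x) (extSeq y),
            walkProb (edgeKernel E w) shiftState (M + d) x (Fin.append u y) := by
          refine Finset.sum_le_sum fun u hu => le_walkProb hE hw hδ hx _ fun i hi => ?_
          have := (Finset.mem_filter.1 hu).2 i (by omega)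
          rw [Finset.union_empty] at this
          convert this using 1
          refine window_congr fun a _ => ?_
          simp only [appSeq.eq_1 d, extSeq_append]
        _ ≤ _ := Finset.sum_le_sum_of_subset_of_nonneg (Finset.subset_univ _)
          fun u _ _ => hK.walkProb_nonneg hx _
    · refine le_of_eq (mul_eq_zero_of_left ?_ _).symm
      refine Finset.sum_eq_zero fun u _ => ?_
      by_contra h
      exact hy (by simpa [walkEnd_append] using hK.walkEnd_mem hx _ h)
  calc _ ≤ c / (2 ^ (d + 1) * C ^ (M + d + 1)) * (C * N * ∑ y ∈ J, g y) :=
        mul_le_mul_of_nonneg_left h1 (by positivity)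
    _ = (N / 2) ^ (d + 1) * (c * N ^ M * (1 / (C * N)) ^ (M + d) * ∑ y ∈ J, g y) := by
        rw [div_pow, div_pow, mul_pow, one_pow]
        simp only [pow_add, pow_one]
        field_simp
    _ ≤ _ := mul_le_mul h2 h3 (by positivity) (Finset.sum_nonneg fun y _ => stateWeight_nonneg hw y)

end EdgeChain

section Corrector

/-- The indicator of `A`, centred with respect to the uniform measure. -/
noncomputable def centredIndicator {V : Type} [Fintype V] (A : Finset V) (v : V) : ℝ :=
  (if v ∈ A then 1 else 0) - (A.card : ℝ) / Fintype.card V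

lemma abs_centredIndicator_le {V : Type} [Fintype V] (A : Finset V) (v : V) :
    |centredIndicator A v| ≤ 1 := by
  have h1 : (A.card : ℝ) / Fintype.card V ≤ 1 :=
    div_le_one_of_le₀ (by exact_mod_cast Finset.card_le_univ A) (by positivity)
  have h2 : 0 ≤ (A.card : ℝ) / Fintype.card V := by positivity
  unfold centredIndicator
  rw [abs_le]
  split_ifs <;> constructor <;> linarith

lemma sum_centredIndicator {V : Type} [Fintype V] [Nonempty V] (A : Finset V) :
    ∑ v, centredIndicator A v = 0 := by
  have : (Fintype.card V : ℝ) ≠ 0 := by exact_mod_cast Fintype.card_ne_zero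
  simp only [centredIndicator, Finset.sum_sub_distrib, Finset.sum_const, Finset.card_univ,
    nsmul_eq_mul, Finset.sum_ite_mem, Finset.univ_inter]
  field_simp
  simp

theorem exists_weights_with_corrector (d : ℕ) (hd : 1 ≤ d) (γ : ℝ) (hγ : 0 < γ) (hγ1 : γ ≤ 1 / 2) :
    ∃ C : ℝ, 1 ≤ C ∧ ∃ B : ℝ, 0 ≤ B ∧ ∀ (V : Type) [Fintype V] [DecidableEq V] [Inhabited V]
      (E : Finset (Finset V)), (∀ e ∈ E, e.card = d + 1) →
      (∀ S : Finset V, S.card = d → (1 / 2 + γ) * (Fintype.card V : ℝ) ≤ (nbrs E S).card) →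
      4 / γ ≤ Fintype.card V → 8 * d ≤ Fintype.card V →
      ∃ w : Finset V → ℝ, (∀ e, 1 ≤ w e ∧ w e ≤ C) ∧ ∀ (A : Finset V) (η : ℝ), 0 < η →
        ∃ q : (Fin d → V) → ℝ, (∀ x, Function.Injective x → |q x| ≤ B) ∧
          ∀ x : Fin d → V, Function.Injective x →
            ∑ v, edgeKernel E w x v * (centredIndicator A v + q (shiftState x v)) ≤ q x + η := by
  obtain ⟨r, c₀, hc₀, hconn⟩ := exists_connectors d γ hγ d
  obtain ⟨C, hC, hbal⟩ := exists_balanced_weights d hd γ hγ hγ1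
  set M := r * (d + 1) with hM
  set c := min c₀ 1 with hc
  have hc0 : 0 < c := lt_min hc₀ one_pos
  set ε := c / (2 ^ (d + 1) * C ^ (M + d + 1)) with hε
  have hden : 1 ≤ (2 : ℝ) ^ (d + 1) * C ^ (M + d + 1) :=
    one_le_mul_of_one_le_of_one_le (one_le_pow₀ (by norm_num)) (one_le_pow₀ hC)
  have hε0 : 0 < ε := by positivity
  have hε1 : ε ≤ 1 := div_le_one_of_le₀ ((min_le_right _ _).trans hden) (by positivity)
  refine ⟨C, hC, (M + d : ℕ) * (1 / ε), by positivity, ?_⟩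
  intro V _ _ _ E hE hδ hN1 hN2
  obtain ⟨w, hw, D, hD⟩ := hbal V E hE hδ hN1 (by exact_mod_cast hN2)
  refine ⟨w, hw, fun A η hη => ?_⟩
  have hN0 : (0 : ℝ) < Fintype.card V := by exact_mod_cast Fintype.card_pos
  have hδ' : ∀ S : Finset V, S.card = d →
      (1 / 2 : ℝ) * (Fintype.card V : ℝ) ≤ (nbrs E S).card := fun S hS =>
    le_trans (by nlinarith) (hδ S hS)
  have hK := isKernelOn_edgeKernel hE hw hδ'
  have hN2' : 2 * d ≤ Fintype.card V := by omega
  have hconn' : ∀ x y : Fin d → V, Function.Injective x → Function.Injective y →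
      c * (Fintype.card V : ℝ) ^ M ≤ (connectors E ∅ d M (extSeq x) (extSeq y)).card := by
    intro x y hx hy
    have himg : ∀ z : Fin d → V, Function.Injective z →
        (window (extSeq z) 0 d ∪ ∅).card = d := by
      intro z hz
      rw [window_extSeq, Finset.union_empty, Finset.card_image_of_injective _ hz]
      simp
    refine le_trans ?_ (hconn V E hE hδ ∅ (by simp) _ _ (himg x hx) (himg y hy))
    exact mul_le_mul_of_nonneg_right (min_le_left _ _) (by positivity)
  have hWpos : 0 < ∑ x : Fin d → V, stateWeight E w x := by
    obtain ⟨f⟩ : Nonempty (Fin d ↪ V) :=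
      Function.Embedding.nonempty_of_card_le (by rw [Fintype.card_fin]; omega)
    refine lt_of_lt_of_le (by linarith : 0 < (1 / 2 : ℝ) * Fintype.card V) ?_
    exact (le_stateWeight hw hδ' f.injective).trans
      (Finset.single_le_sum (f := fun x : Fin d → V => stateWeight E w x)
        (fun x _ => stateWeight_nonneg hw x) (Finset.mem_univ (f : Fin d → V)))
  set g : (Fin d → V) → ℝ := fun x => ∑ v, edgeKernel E w x v * centredIndicator A v with hg
  have hg0 : ∑ x, stateWeight E w x * g x = 0 := by
    simp only [hg, Finset.mul_sum]
    rw [Finset.sum_comm]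
    have e : ∀ v, ∑ x : Fin d → V, stateWeight E w x *
        (edgeKernel E w x v * centredIndicator A v) = D * centredIndicator A v := by
      intro v
      rw [← hD v, weightedDegree, Finset.sum_mul]
      exact Finset.sum_congr rfl fun x _ => by rw [← mul_assoc, stateWeight_mul_edgeKernel hw]
    simp_rw [e]
    rw [← Finset.mul_sum, sum_centredIndicator, mul_zero]
  have hg1 : ∀ x, Function.Injective x → |g x| ≤ 1 := by
    intro x hx
    refine (Finset.abs_sum_le_sum_abs _ _).trans ?_
    rw [← hK.sum_eq_one x hx]
    refine Finset.sum_le_sum fun v _ => ?_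
    rw [abs_mul, abs_of_nonneg (hK.nonneg x hx v)]
    exact mul_le_of_le_one_right (hK.nonneg x hx v) (abs_centredIndicator_le A v)
  obtain ⟨j, hj⟩ := exists_pow_lt_of_lt_one hη (by linarith : 1 - ε < 1)
  obtain ⟨q, hq1, hq2⟩ := hK.exists_corrector hWpos (sum_stateWeight_mul_stepAvg hw) hε0
    (fun g hg x hx => minorisation_of_connectors hE hw hδ' hN2' hc0 hconn' hg hx) hg0 hg1 j
  refine ⟨q, fun x hx => (hq1 x hx).trans ?_, fun x hx => ?_⟩
  · have : 0 ≤ (1 - ε) ^ j := pow_nonneg (by linarith) j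
    gcongr
    linarith
  · have h1 := (abs_le.1 (hq2 x hx)).2
    have h2 : ∑ v, edgeKernel E w x v * (centredIndicator A v + q (shiftState x v)) =
        g x + stepAvg (edgeKernel E w) shiftState q x := by
      simp only [hg, stepAvg, mul_add, Finset.sum_add_distrib]
    linarith

end Corrector

open Filter in
lemma eventually_walk_parameters (d : ℕ) (B C : ℝ) : ∀ᶠ n : ℕ in atTop,
    (n : ℝ) ^ (-(1 : ℝ) / 4) * (1 + 2 * B) ≤ 1 ∧
    2 * C / n * (d + n.sqrt) ≤ 1 / 2 ∧
    d ≤ n.sqrt ∧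
    (n : ℝ) ^ d * Real.exp (2 * |B| + (1 + (1 + 2 * B) ^ 2) - (n : ℝ) ^ ((1 : ℝ) / 12) / 4) <
      Real.exp (-(8 * C)) / 2 ∧
    d + (n : ℝ) ^ ((1 : ℝ) / 3) / 4 ≤ (n : ℝ) ^ (-(2 : ℝ) / 3) * (n - n.sqrt) := by
  have hcast := tendsto_natCast_atTop_atTop (R := ℝ)
  have hsq : Tendsto Nat.sqrt atTop atTop := by
    refine tendsto_atTop_atTop.2 fun b => ⟨b * b, fun a ha => Nat.le_sqrt.2 ha⟩
  have hsqle : ∀ n : ℕ, (n.sqrt : ℝ) * n.sqrt ≤ n := fun n => by exact_mod_cast Nat.sqrt_le n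
  have e1 : ∀ᶠ n : ℕ in atTop, (n : ℝ) ^ (-(1 : ℝ) / 4) * (1 + 2 * B) ≤ 1 := by
    have h1 : Tendsto (fun n : ℕ => (n : ℝ) ^ (-(1 : ℝ) / 4) * (1 + 2 * B)) atTop (nhds 0) := by
      have := (tendsto_rpow_neg_atTop (by norm_num : (0 : ℝ) < 1 / 4)).comp hcast
      have h2 := this.mul_const (1 + 2 * B)
      rw [zero_mul] at h2
      refine h2.congr fun n => ?_
      simp only [Function.comp, neg_div]
    exact (h1.eventually (gt_mem_nhds one_pos)).mono fun n hn => le_of_lt hn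
  have e3 : ∀ᶠ n : ℕ in atTop, d ≤ n.sqrt := hsq.eventually_ge_atTop d
  have e2 : ∀ᶠ n : ℕ in atTop, 2 * C / n * (d + n.sqrt) ≤ 1 / 2 := by
    filter_upwards [e3, hsq.eventually_ge_atTop 1,
      (hcast.comp hsq).eventually_ge_atTop (8 * |C|)] with n h1 h2 h3
    simp only [Function.comp] at h3
    have h1' : (d : ℝ) ≤ n.sqrt := by exact_mod_cast h1
    have h2' : (1 : ℝ) ≤ n.sqrt := by exact_mod_cast h2
    have hn := hsqle n
    have hn0 : (0 : ℝ) < n := by nlinarith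
    rw [div_mul_eq_mul_div, div_le_div_iff₀ hn0 (by norm_num)]
    have := le_abs_self C
    have h4 : C * (d + n.sqrt) ≤ |C| * (2 * n.sqrt) := by
      refine (mul_le_mul_of_nonneg_right this (by positivity)).trans ?_
      exact mul_le_mul_of_nonneg_left (by linarith) (abs_nonneg _)
    nlinarith
  have e4 : ∀ᶠ n : ℕ in atTop, (n : ℝ) ^ d *
      Real.exp (2 * |B| + (1 + (1 + 2 * B) ^ 2) - (n : ℝ) ^ ((1 : ℝ) / 12) / 4) <
      Real.exp (-(8 * C)) / 2 := by
    set k := 2 * |B| + (1 + (1 + 2 * B) ^ 2)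
    have hlog : ∀ᶠ x : ℝ in atTop, ‖Real.log x‖ ≤ 1 / (8 * (d + 1)) * ‖x ^ ((1 : ℝ) / 12)‖ :=
      (isLittleO_log_rpow_atTop (by norm_num : (0 : ℝ) < 1 / 12)).bound (by positivity)
    have hlarge := (tendsto_rpow_atTop (by norm_num : (0 : ℝ) < 1 / 12)).eventually_gt_atTop
      (8 * (k + 8 * C + Real.log 2))
    filter_upwards [hcast.eventually hlog, hcast.eventually hlarge,
      hcast.eventually_ge_atTop 1] with n h1 h2 h3
    have hn0 : (0 : ℝ) < n := by linarith
    have hp : 0 < (n : ℝ) ^ ((1 : ℝ) / 12) := by positivity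
    rw [Real.norm_eq_abs, Real.norm_eq_abs, abs_of_pos hp, abs_of_nonneg (Real.log_nonneg h3)] at h1
    have h4 : d * Real.log n ≤ (n : ℝ) ^ ((1 : ℝ) / 12) / 8 := by
      have h5 : d * Real.log n ≤ (d + 1) * (1 / (8 * (d + 1)) * (n : ℝ) ^ ((1 : ℝ) / 12)) := by
        have := Real.log_nonneg h3
        have h6 : (d + 1 : ℝ) * Real.log n ≤ _ := mul_le_mul_of_nonneg_left h1 (by positivity)
        linarith
      refine h5.trans (le_of_eq ?_)
      field_simp
    have e : (n : ℝ) ^ d = Real.exp (d * Real.log n) := by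
      rw [mul_comm, Real.exp_mul, Real.exp_log hn0, Real.rpow_natCast]
    have e' : Real.exp (-(8 * C)) / 2 = Real.exp (-(8 * C) - Real.log 2) := by
      rw [Real.exp_sub, Real.exp_log (by norm_num)]
    rw [e, e', ← Real.exp_add, Real.exp_lt_exp]
    linarith
  have e5 : ∀ᶠ n : ℕ in atTop,
      d + (n : ℝ) ^ ((1 : ℝ) / 3) / 4 ≤ (n : ℝ) ^ (-(2 : ℝ) / 3) * (n - n.sqrt) := by
    have hlarge := (tendsto_rpow_atTop (by norm_num : (0 : ℝ) < 1 / 3)).eventually_ge_atTop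
      (4 * (d : ℝ))
    filter_upwards [hcast.eventually hlarge, hsq.eventually_ge_atTop 2] with n h1 h2
    have h2' : (2 : ℝ) ≤ n.sqrt := by exact_mod_cast h2
    have hn := hsqle n
    have hn0 : (0 : ℝ) < n := by nlinarith
    have h3 : (n : ℝ) ^ (-(2 : ℝ) / 3) * n = (n : ℝ) ^ ((1 : ℝ) / 3) := by
      rw [← Real.rpow_add_one hn0.ne']; norm_num
    have h4 : (n : ℝ) / 2 ≤ n - n.sqrt := by nlinarith
    have h5 : 0 < (n : ℝ) ^ (-(2 : ℝ) / 3) := by positivity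
    nlinarith
  filter_upwards [e1, e2, e3, e4, e5] with n h1 h2 h3 h4 h5
  exact ⟨h1, h2, h3, h4, h5⟩

lemma exp_neg_le_one_sub_pow {a b : ℝ} {m : ℕ} (ha : 0 ≤ a) (ha1 : a ≤ 1 / 2) (hb : m * a ≤ b) :
    Real.exp (-(2 * b)) ≤ (1 - a) ^ m := by
  have h1 : Real.exp (-(2 * a)) ≤ 1 - a := by
    rw [Real.exp_neg]
    refine inv_le_of_inv_le₀ (by linarith) ?_
    refine le_trans ?_ (Real.add_one_le_exp (2 * a))
    rw [inv_le_iff_one_le_mul₀ (by linarith)]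
    nlinarith
  calc Real.exp (-(2 * b)) ≤ Real.exp (m * (-(2 * a))) := Real.exp_le_exp.2 (by linarith)
    _ = Real.exp (-(2 * a)) ^ m := Real.exp_nat_mul _ m
    _ ≤ _ := pow_le_pow_left₀ (Real.exp_pos _).le h1 m

/-- Exponential Markov inequality for an additive functional of the chain. -/
lemma IsKernelOn.sum_walkProb_tail_le {X V : Type} [Fintype V] {K : X → V → ℝ} {sh : X → V → X}
    {I : X → Prop} (hK : IsKernelOn K sh I) {f : V → ℝ} {lam θ R : ℝ} (hlam : 0 ≤ lam) {ℓ : ℕ}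
    {x : X} (hx : I x)
    (h : ∑ s, walkProb K sh ℓ x s * Real.exp (lam * ∑ i, f (s i)) ≤ Real.exp R) :
    ∑ s, (if θ < ∑ i, f (s i) then walkProb K sh ℓ x s else 0) ≤ Real.exp (R - lam * θ) := by
  rw [Real.exp_sub, le_div_iff₀ (Real.exp_pos _), Finset.sum_mul]
  refine le_trans (Finset.sum_le_sum fun s _ => ?_) h
  have := hK.walkProb_nonneg hx s
  split_ifs with hs
  · gcongr
  · rw [zero_mul]; positivity

set_option maxHeartbeats 1000000 in
theorem exists_many_walks (d : ℕ) (hd : 1 ≤ d) (γ : ℝ) (hγ : 0 < γ) (hγ1 : γ ≤ 1 / 2) :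
    ∃ c : ℝ, 0 < c ∧ ∃ n₀ : ℕ, ∀ (V : Type) [Fintype V] [DecidableEq V] [Inhabited V]
      (E : Finset (Finset V)) (n : ℕ), Fintype.card V = n → n₀ ≤ n → (∀ e ∈ E, e.card = d + 1) →
      (∀ S : Finset V, S.card = d → (1 / 2 + γ) * (n : ℝ) ≤ (nbrs E S).card) →
      ∀ x : Fin d → V, Function.Injective x →
        ∃ 𝒮 : Finset (Fin n.sqrt → V), (c * (n : ℝ)) ^ n.sqrt ≤ (𝒮.card : ℝ) ∧
          ∀ s ∈ 𝒮, Function.Injective s ∧ (∀ i, s i ∉ Finset.univ.image x) ∧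
            (∀ i < n.sqrt, window (appSeq d (extSeq x) (extSeq s)) i (d + 1) ∈ E) ∧
            ∀ S : Finset V, S.card = d → ∑ i, centredIndicator (nbrs E S) (s i) ≤
              (n : ℝ) ^ ((1 : ℝ) / 3) / 4 := by
  obtain ⟨C, hC, B, hB, hmain⟩ := exists_weights_with_corrector d hd γ hγ hγ1
  obtain ⟨n₁, hn₁⟩ := Filter.eventually_atTop.1 (eventually_walk_parameters d B C)
  obtain ⟨n₂, hn₂⟩ := exists_nat_ge (4 / γ)
  set δ := Real.exp (-(8 * C)) / 2 with hδdef
  have hδ0 : 0 < δ := by positivity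
  have hδ1 : δ ≤ 1 := by
    have : Real.exp (-(8 * C)) ≤ 1 := Real.exp_le_one_iff.2 (by linarith)
    linarith
  refine ⟨δ / (2 * C), by positivity, n₁ + n₂ + 8 * d, ?_⟩
  rintro V _ _ _ E _ rfl hn hE hδ x hx
  obtain ⟨h1, h2, h3, h4, -⟩ := hn₁ (Fintype.card V) (by omega)
  obtain ⟨w, hw, hq⟩ := hmain V E hE hδ
    (hn₂.trans (by exact_mod_cast (by omega : n₂ ≤ Fintype.card V))) (by omega)
  set N := (Fintype.card V : ℝ) with hN
  set m := (Fintype.card V).sqrt with hm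
  have hN0 : 0 < N := by rw [hN]; exact_mod_cast Fintype.card_pos
  have hmm : (m : ℝ) * m ≤ N := by rw [hN, hm]; exact_mod_cast Nat.sqrt_le _
  have hm1 : 1 ≤ m := hd.trans h3
  have hδ' : ∀ S : Finset V, S.card = d → (1 / 2 : ℝ) * (Fintype.card V : ℝ) ≤ (nbrs E S).card :=
    fun S hS => le_trans (by rw [← hN]; nlinarith) (hδ S hS)
  have hK := isKernelOn_edgeKernel hE hw hδ'
  set p := fun s : Fin m → V => walkProb (edgeKernel E w) shiftState m x s with hp
  have hp0 : ∀ s, 0 ≤ p s := fun s => hK.walkProb_nonneg hx s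
  set κ := 2 * C / N with hκ
  have hκ0 : 0 < κ := by positivity
  have hκle : ∀ x : Fin d → V, Function.Injective x → ∀ v, edgeKernel E w x v ≤ κ :=
    fun x hx v => edgeKernel_le hw hδ' hx v
  set U := Finset.univ.image x with hU
  have hUc : U.card = d := by rw [hU, Finset.card_image_of_injective _ hx]; simp
  set θ := N ^ ((1 : ℝ) / 3) / 4 with hθ
  -- self-avoidance
  have havoid : 2 * δ ≤ ∑ s, if Function.Injective s ∧ ∀ i, s i ∉ U then p s else 0 := by
    have ha := hK.le_sum_walkProb_avoiding hκ0.le hκle (ℓ := m) hx U (by rw [hUc]; linarith)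
    refine le_trans ?_ (ha.trans (le_of_eq (Finset.sum_congr rfl fun s _ => by congr)))
    rw [hUc]
    have hd' : (d : ℝ) ≤ m := by exact_mod_cast h3
    have hma : m * (κ * (d + m)) ≤ 4 * C := by
      have : m * (κ * (d + m)) = 2 * C * (m * (d + m)) / N := by rw [hκ]; ring
      rw [this, div_le_iff₀ hN0]
      have : (m : ℝ) * (d + m) ≤ 2 * N := by nlinarith
      nlinarith
    have := exp_neg_le_one_sub_pow (m := m) (a := κ * (d + m)) (by positivity) h2 hma
    rw [hδdef, mul_div_cancel₀ _ two_ne_zero, show 8 * C = 2 * (4 * C) by ring]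
    exact this
  -- concentration
  set lam := N ^ (-(1 : ℝ) / 4) with hlam
  have hlam0 : 0 < lam := by positivity
  have hlam1 : lam ≤ 1 := by nlinarith
  have hmlam : m * lam ^ 2 ≤ 1 := by
    have e : lam ^ 2 * lam ^ 2 * N = 1 := by
      rw [hlam, ← Real.rpow_natCast, ← Real.rpow_mul hN0.le, ← Real.rpow_add hN0,
        ← Real.rpow_add_one hN0.ne']
      norm_num
    have e2 : (m * lam ^ 2) ^ 2 ≤ 1 := by
      calc (m * lam ^ 2) ^ 2 = lam ^ 2 * lam ^ 2 * (m * m) := by ring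
        _ ≤ lam ^ 2 * lam ^ 2 * N := by gcongr
        _ = 1 := e
    exact (abs_le_one_iff_mul_self_le_one.2 (by linarith [sq (m * lam ^ 2)]) |> abs_le.1).2
  have htail : ∀ S : Finset V, ∑ s, (if θ < ∑ i, centredIndicator (nbrs E S) (s i) then p s else 0)
      ≤ Real.exp (2 * |B| + (1 + (1 + 2 * B) ^ 2) - N ^ ((1 : ℝ) / 12) / 4) := by
    intro S
    obtain ⟨q, hq1, hq2⟩ := hq (nbrs E S) lam hlam0
    have hmgf := hK.sum_walkProb_mul_exp_le (abs_centredIndicator_le (nbrs E S)) hq1 hq2 hlam0.le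
      h1 m hx
    refine (hK.sum_walkProb_tail_le (θ := θ) hlam0.le hx hmgf).trans (Real.exp_le_exp.2 ?_)
    have e1 : lam * θ = N ^ ((1 : ℝ) / 12) / 4 := by
      rw [hlam, hθ, mul_div_assoc', ← Real.rpow_add hN0]
      norm_num
    have e2 : lam * (B + q x) ≤ 2 * B := by
      have := abs_le.1 (hq1 x hx)
      nlinarith
    have e3 : m * (lam * lam + lam ^ 2 * (1 + 2 * B) ^ 2) ≤ 1 + (1 + 2 * B) ^ 2 := by
      calc m * (lam * lam + lam ^ 2 * (1 + 2 * B) ^ 2)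
          = m * lam ^ 2 * (1 + (1 + 2 * B) ^ 2) := by ring
        _ ≤ 1 * (1 + (1 + 2 * B) ^ 2) := by gcongr
        _ = _ := one_mul _
    rw [e1, abs_of_nonneg hB]
    linarith
  -- the good walks
  set 𝒟 := Finset.univ.powersetCard d (α := V) with h𝒟
  have h𝒟c : (𝒟.card : ℝ) ≤ N ^ d := by
    rw [h𝒟, Finset.card_powersetCard, hN]
    exact_mod_cast Nat.choose_le_pow _ d
  set 𝒮 := Finset.univ.filter fun s : Fin m → V => p s ≠ 0 ∧
    (Function.Injective s ∧ ∀ i, s i ∉ U) ∧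
    ∀ S : Finset V, S.card = d → ∑ i, centredIndicator (nbrs E S) (s i) ≤ θ with h𝒮
  have hcover : ∀ s, (if Function.Injective s ∧ ∀ i, s i ∉ U then p s else 0) ≤
      (if s ∈ 𝒮 then p s else 0) +
        ∑ S ∈ 𝒟, if θ < ∑ i, centredIndicator (nbrs E S) (s i) then p s else 0 := by
    intro s
    have hnn : ∀ S ∈ 𝒟, 0 ≤ if θ < ∑ i, centredIndicator (nbrs E S) (s i) then p s else 0 := by
      intro S _
      split_ifs
      exacts [hp0 s, le_rfl]
    have hnn' := Finset.sum_nonneg hnn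
    by_cases hs : s ∈ 𝒮
    · rw [if_pos hs]
      have := hp0 s
      split_ifs <;> linarith
    rw [if_neg hs, zero_add]
    split_ifs with hinj
    swap
    · exact hnn'
    by_cases hps : p s = 0
    · rw [hps] at hnn' ⊢; exact hnn'
    have : ∃ S : Finset V, S.card = d ∧ θ < ∑ i, centredIndicator (nbrs E S) (s i) := by
      by_contra hcon
      push Not at hcon
      exact hs (Finset.mem_filter.2 ⟨Finset.mem_univ _, hps, hinj, hcon⟩)
    obtain ⟨S, hS, hlt⟩ := this
    have := Finset.single_le_sum hnn (Finset.mem_powersetCard_univ.2 hS)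
    rwa [if_pos hlt] at this
  have hsum := Finset.sum_le_sum fun s (_ : s ∈ Finset.univ) => hcover s
  rw [Finset.sum_add_distrib, Finset.sum_comm, Finset.sum_ite_mem, Finset.univ_inter] at hsum
  have hbad : ∑ S ∈ 𝒟, ∑ s, (if θ < ∑ i, centredIndicator (nbrs E S) (s i) then p s else 0) ≤
      δ := by
    refine (Finset.sum_le_card_nsmul _ _ _ fun S _ => htail S).trans ?_
    rw [nsmul_eq_mul]
    refine le_trans ?_ h4.le
    exact mul_le_mul_of_nonneg_right h𝒟c (Real.exp_pos _).le
  have hgood : δ ≤ 𝒮.card * κ ^ m := by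
    have : ∑ s ∈ 𝒮, p s ≤ 𝒮.card * κ ^ m := by
      rw [← nsmul_eq_mul]
      exact Finset.sum_le_card_nsmul _ _ _ fun s _ => hK.walkProb_le hκle hx s
    linarith
  refine ⟨𝒮, ?_, fun s hs => ?_⟩
  · have e : (δ / (2 * C) * N) ^ m = δ ^ m / κ ^ m := by
      rw [← div_pow, hκ]
      congr 1
      field_simp
    rw [e, div_le_iff₀ (by positivity)]
    exact (pow_le_of_le_one hδ0.le hδ1 (by omega)).trans hgood
  · obtain ⟨-, hs1, hs2, hs3⟩ := Finset.mem_filter.1 hs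
    exact ⟨hs2.1, hs2.2, fun i hi => window_mem_of_walkProb_ne_zero x s hs1 i hi, hs3⟩

lemma card_filter_superset_le_card_nbrs {V : Type} [Fintype V] [DecidableEq V]
    {E : Finset (Finset V)} {d : ℕ} (hE : ∀ e ∈ E, e.card = d + 1) {S : Finset V}
    (hS : S.card = d) : (E.filter fun e => S ⊆ e).card ≤ (nbrs E S).card := by
  refine (Finset.card_le_card fun e he => ?_).trans
    (Finset.card_image_le (s := nbrs E S) (f := fun v => insert v S))
  obtain ⟨heE, hSe⟩ := Finset.mem_filter.1 he
  have h1 : (e \ S).card = 1 := by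
    rw [Finset.card_sdiff_of_subset hSe, hE e heE, hS]; omega
  obtain ⟨v, hv⟩ := Finset.card_eq_one.1 h1
  have h2 : insert v S = e := by
    rw [Finset.insert_eq, ← hv, Finset.sdiff_union_of_subset hSe]
  exact Finset.mem_image.2 ⟨v, by simp [nbrs, h2, heE], h2⟩

/-- Deleting the complement of `W` destroys at most `#(nbrs E S \ W)` of the edges containing
`S ⊆ W`. -/
lemma card_nbrs_inter_le {V : Type} [Fintype V] [DecidableEq V] {E : Finset (Finset V)} {d : ℕ}
    (hE : ∀ e ∈ E, e.card = d + 1) {S W : Finset V} (hS : S.card = d) (hSW : S ⊆ W) :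
    (nbrs E S ∩ W).card ≤ (E.filter fun e => S ⊆ e ∧ e ⊆ W).card := by
  have hnot : ∀ v ∈ nbrs E S ∩ W, v ∉ S := by
    intro v hv hvS
    have h1 := hE _ (Finset.mem_filter.1 (Finset.mem_inter.1 hv).1).2
    rw [Finset.insert_eq_of_mem hvS] at h1
    omega
  refine Finset.card_le_card_of_injOn (fun v => insert v S) (fun v hv => ?_) fun u hu v hv huv => ?_
  · obtain ⟨h1, h2⟩ := Finset.mem_inter.1 hv
    simp only [Finset.coe_filter, Set.mem_ofPred_eq]
    exact ⟨(Finset.mem_filter.1 h1).2, Finset.subset_insert _ _, Finset.insert_subset h2 hSW⟩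
  · have huv' : insert u S = insert v S := huv
    have h1 : u ∈ insert v S := huv' ▸ Finset.mem_insert_self u S
    exact (Finset.mem_insert.1 h1).resolve_right (hnot u hu)

theorem exists_many_paths (d : ℕ) (hd : 1 ≤ d) (γ : ℝ) (hγ : 0 < γ) :
    ∃ c : ℝ, 0 < c ∧ ∃ n₀ : ℕ, ∀ n : ℕ, n₀ ≤ n →
    ∀ E : Finset (Finset (Fin n)),
      (∀ e ∈ E, e.card = d + 1) →
      (∀ S : Finset (Fin n), S.card = d →
        (1/2 + γ) * (n : ℝ) ≤ ((E.filter (fun e => S ⊆ e)).card : ℝ)) →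
    ∀ S : Fin d → Fin n, Function.Injective S →
      ∃ P : Finset (Fin (n.sqrt + d) → Fin n),
        (c * (n : ℝ)) ^ n.sqrt ≤ (P.card : ℝ) ∧
        ∀ p ∈ P,
          Function.Injective p ∧
          (∀ i : ℕ, ∀ _h : i + (d + 1) ≤ n.sqrt + d,
            Finset.image (fun j : Fin (d + 1) => p ⟨i + (j : ℕ), by have := j.isLt; omega⟩)
              Finset.univ ∈ E) ∧
          (∀ j : Fin d, p ⟨(j : ℕ), by have := j.isLt; omega⟩ = S j) ∧
          (let Tset : Finset (Fin n) :=
            (Finset.univ.filter (fun i : Fin (n.sqrt + d) => n.sqrt ≤ (i : ℕ))).image p;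
           let Vrem : Finset (Fin n) :=
            Finset.univ \ ((Finset.image p Finset.univ) \ Tset);
           ∀ S' : Finset (Fin n), S' ⊆ Vrem → S'.card = d →
             (1/2 + γ - (n : ℝ) ^ (-(2 : ℝ)/3)) * ((n : ℝ) - (n.sqrt : ℝ)) ≤
               ((E.filter (fun e => S' ⊆ e ∧ e ⊆ Vrem)).card : ℝ)) := by
  obtain ⟨c, hc, n₁, hwalks⟩ := exists_many_walks d hd (min γ (1 / 2)) (by positivity)
    (min_le_right _ _)
  obtain ⟨n₂, hn₂⟩ := Filter.eventually_atTop.1 (eventually_walk_parameters d 0 0)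
  refine ⟨c, hc, n₁ + n₂ + 1, ?_⟩
  intro n hn E hE hδ S hS
  have : Inhabited (Fin n) := ⟨⟨0, by omega⟩⟩
  obtain ⟨-, -, -, -, hfinal⟩ := hn₂ n (by omega)
  have hδ' : ∀ S : Finset (Fin n), S.card = d → (1 / 2 + γ) * (n : ℝ) ≤ (nbrs E S).card :=
    fun S hS => (hδ S hS).trans (by exact_mod_cast card_filter_superset_le_card_nbrs hE hS)
  obtain ⟨𝒮, hcard, h𝒮⟩ := hwalks (Fin n) E n (Fintype.card_fin n) (by omega) hE
    (fun S hS => le_trans (by gcongr; exact min_le_left _ _) (hδ' S hS)) S hS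
  set path : (Fin n.sqrt → Fin n) → Fin (n.sqrt + d) → Fin n :=
    fun s i => appSeq d (extSeq S) (extSeq s) i with hpath
  have hlow : ∀ s (i : Fin (n.sqrt + d)) (h : (i : ℕ) < d), path s i = S ⟨i, h⟩ := by
    intro s i h
    simp [hpath, appSeq, extSeq, h]
  have hhigh : ∀ s (i : Fin (n.sqrt + d)) (h : ¬ (i : ℕ) < d),
      path s i = s ⟨i - d, by omega⟩ := by
    intro s i h
    simp [hpath, appSeq, extSeq, h, show (i : ℕ) - d < n.sqrt by omega]
  refine ⟨𝒮.image path, ?_, ?_⟩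
  · rw [Finset.card_image_of_injective]
    · exact hcard
    · intro s t hst
      funext i
      have h1 := congrFun hst ⟨i + d, by omega⟩
      rw [hhigh _ _ (by simp), hhigh _ _ (by simp)] at h1
      simpa using h1
  intro p hp
  obtain ⟨s, hs, rfl⟩ := Finset.mem_image.1 hp
  obtain ⟨hinj, havoid, hedge, hconc⟩ := h𝒮 s hs
  have havoid' : ∀ i j, s i ≠ S j := fun i j h => havoid i (h ▸ Finset.mem_image_of_mem S (by simp))
  refine ⟨?_, ?_, ?_, ?_⟩
  · intro i j hij
    by_cases hi : (i : ℕ) < d <;> by_cases hj : (j : ℕ) < d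
    · rw [hlow _ _ hi, hlow _ _ hj] at hij
      have := hS hij
      ext
      simpa using this
    · rw [hlow _ _ hi, hhigh _ _ hj] at hij
      exact absurd hij.symm (havoid' _ _)
    · rw [hhigh _ _ hi, hlow _ _ hj] at hij
      exact absurd hij (havoid' _ _)
    · rw [hhigh _ _ hi, hhigh _ _ hj] at hij
      have := hinj hij
      simp only [Fin.mk.injEq] at this
      ext
      omega
  · intro i hi
    convert hedge i (by omega) using 1
    ext a
    simp only [window, hpath, Finset.mem_image, Finset.mem_univ, true_and, Finset.mem_range]
    exact ⟨fun ⟨j, hj⟩ => ⟨j, j.2, hj⟩, fun ⟨j, hj, h⟩ => ⟨⟨j, hj⟩, h⟩⟩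
  · intro j
    exact hlow s ⟨j, by omega⟩ j.2
  · intro Tset Vrem S' hS' hcardS'
    set A := nbrs E S' with hA
    have hsub : A \ Vrem ⊆ Finset.univ.image S ∪
        (Finset.univ.filter fun i => s i ∈ A).image s := by
      intro v hv
      obtain ⟨hvA, hvV⟩ := Finset.mem_sdiff.1 hv
      have : v ∈ Finset.image (path s) Finset.univ := by
        by_contra hcon
        exact hvV (by simp only [Vrem, Finset.mem_sdiff, Finset.mem_univ, true_and, hcon,
          false_and, not_false_eq_true])
      obtain ⟨i, -, rfl⟩ := Finset.mem_image.1 this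
      rw [Finset.mem_union]
      by_cases hi : (i : ℕ) < d
      · rw [hlow s i hi]
        exact Or.inl (Finset.mem_image_of_mem S (Finset.mem_univ _))
      · rw [hhigh s i hi] at hvA ⊢
        exact Or.inr (Finset.mem_image_of_mem s (by simpa using hvA))
    have h1 : (A \ Vrem).card ≤ d + (Finset.univ.filter fun i => s i ∈ A).card := by
      refine (Finset.card_le_card hsub).trans ((Finset.card_union_le _ _).trans ?_)
      refine add_le_add (Finset.card_image_le.trans (by simp)) Finset.card_image_le
    have h2 : ((Finset.univ.filter fun i => s i ∈ A).card : ℝ) =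
        ∑ i, centredIndicator A (s i) + n.sqrt * (A.card / n) := by
      have hsum : ((Finset.univ.filter fun i => s i ∈ A).card : ℝ) =
          ∑ i, (centredIndicator A (s i) + (A.card : ℝ) / n) := by
        rw [Finset.card_filter, Nat.cast_sum]
        refine Finset.sum_congr rfl fun i _ => ?_
        unfold centredIndicator
        by_cases h : s i ∈ A <;> simp [h]
      rw [hsum, Finset.sum_add_distrib, Finset.sum_const, Finset.card_univ, Fintype.card_fin,
        nsmul_eq_mul]
    have h3 := hconc S' hcardS'
    rw [← hA] at h3
    have h4 : A.card = (A ∩ Vrem).card + (A \ Vrem).card :=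
      (Finset.card_inter_add_card_sdiff A Vrem).symm
    have h5 := card_nbrs_inter_le hE hcardS' hS'
    rw [← hA] at h5
    have h6 := hδ' S' hcardS'
    rw [← hA] at h6
    have hn0 : (0 : ℝ) < n := by exact_mod_cast (by omega : 0 < n)
    have hm : (n.sqrt : ℝ) ≤ n := by exact_mod_cast Nat.sqrt_le_self n
    have h1' : ((A \ Vrem).card : ℝ) ≤ d + (Finset.univ.filter fun i => s i ∈ A).card := by
      exact_mod_cast h1
    have h4' : (A.card : ℝ) = (A ∩ Vrem).card + (A \ Vrem).card := by exact_mod_cast h4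
    have h5' : ((A ∩ Vrem).card : ℝ) ≤ (E.filter fun e => S' ⊆ e ∧ e ⊆ Vrem).card := by
      exact_mod_cast h5
    have h7 : (1 / 2 + γ) * (n - n.sqrt) ≤ A.card - n.sqrt * (A.card / n) := by
      have h8 : 1 / 2 + γ ≤ A.card / n := by rwa [le_div_iff₀ hn0]
      have h9 : (A.card : ℝ) - n.sqrt * (A.card / n) = A.card / n * (n - n.sqrt) := by
        field_simp
      rw [h9]
      exact mul_le_mul_of_nonneg_right h8 (by linarith)
    have h10 : (1 / 2 + γ - (n : ℝ) ^ (-(2 : ℝ) / 3)) * (n - n.sqrt) =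
        (1 / 2 + γ) * (n - n.sqrt) - (n : ℝ) ^ (-(2 : ℝ) / 3) * (n - n.sqrt) := by ring
    rw [h10]
    linarith

/-- Lemma 5.1 (Iteration Lemma). A `√n`-path with end `S` is encoded as an injective
vertex sequence `p` of length `√n + (k−1)` whose first `k−1` vertices are `S` (in
order) and in which every `k` consecutive vertices form an edge; its other end `T` has
underlying vertex set the last `k−1` vertices of `p`. -/
theorem stmt_8 :
    ∀ k : ℕ, 2 ≤ k → ∀ γ : ℝ, 0 < γ →
    ∃ c : ℝ, 0 < c ∧ ∃ n₀ : ℕ, ∀ n : ℕ, n₀ ≤ n →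
    ∀ E : Finset (Finset (Fin n)),
      (∀ e ∈ E, e.card = k) →
      (∀ S : Finset (Fin n), S.card = k - 1 →
        (1/2 + γ) * (n : ℝ) ≤ ((E.filter (fun e => S ⊆ e)).card : ℝ)) →
    ∀ S : Fin (k-1) → Fin n, Function.Injective S →
      ∃ P : Finset (Fin (n.sqrt + (k-1)) → Fin n),
        -- (i) |𝒫| ≥ (cn)^{√n}
        (c * (n : ℝ)) ^ n.sqrt ≤ (P.card : ℝ) ∧
        ∀ p ∈ P,
          -- p is a tight √n-path ...
          Function.Injective p ∧
          (∀ i : ℕ, ∀ _h : i + k ≤ n.sqrt + (k-1),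
            Finset.image (fun j : Fin k => p ⟨i + (j : ℕ), by have := j.isLt; omega⟩)
              Finset.univ ∈ E) ∧
          -- (ii) ... with S as an end
          (∀ j : Fin (k-1), p ⟨(j : ℕ), by have := j.isLt; omega⟩ = S j) ∧
          -- (iii) deleting V(P) \ T leaves minimum codegree ≥ (1/2+γ−n^{-2/3})(n−√n)
          (let Tset : Finset (Fin n) :=
            (Finset.univ.filter (fun i : Fin (n.sqrt + (k-1)) => n.sqrt ≤ (i : ℕ))).image p;
           let Vrem : Finset (Fin n) :=
            Finset.univ \ ((Finset.image p Finset.univ) \ Tset);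
           ∀ S' : Finset (Fin n), S' ⊆ Vrem → S'.card = k - 1 →
             (1/2 + γ - (n : ℝ) ^ (-(2 : ℝ)/3)) * ((n : ℝ) - (n.sqrt : ℝ)) ≤
               ((E.filter (fun e => S' ⊆ e ∧ e ⊆ Vrem)).card : ℝ)) := by
  intro k hk γ hγ
  obtain ⟨d, rfl⟩ : ∃ d, k = d + 1 := ⟨k - 1, by omega⟩
  exact exists_many_paths d (by omega) γ hγ
end

section
/- For every integer k ≥ 2 and all constants γ, τ ∈ (0,1] there exist λ > 0 and n₀ ∈ ℕ such that for all n ≥ n₀ the following holds. Let G be an (n,k,γ)-graph, let μ be any probability distribution on ordered (k−1)-tuples of distinct vertices of G, and let x: E(G) → ℝ⁺ be a positive (τ/n)-lower-balanced edge weighting. Let Y be the simple x-walk on G with initial distribution μ and let W be the stationary x-walk on G. Then for any η > 0 and any integer q ≥ λ ln(1/η), the total variation distance between Y_q and W_q is less than η. -/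
open scoped Classical

noncomputable section

variable {V : Type*} [Fintype V] [DecidableEq V]

/-- An edge weighting extended by zero to non-edges. -/
def xw (E : Finset (Finset V)) (x : Finset V → ℝ) (e : Finset V) : ℝ :=
  if e ∈ E then x e else 0

/-- Unnormalised transition weight of an `x`-walk on the `k`-graph with edge set `E`:
the history `h` of the walk is stored most-recent-first, and the weight of moving to
`v` is `x` of the edge formed by the last `k−1` visited vertices together with `v`
(zero for non-edges); for the self-avoiding walk (`sa = true`) previously visited
vertices get weight zero. -/
def stepw (k : ℕ) (E : Finset (Finset V)) (x : Finset V → ℝ) (sa : Bool)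
    (h : List V) (v : V) : ℝ :=
  if sa = true ∧ v ∈ h then 0 else xw E x (insert v (h.take (k-1)).toFinset)

/-- Transition probability of the `x`-walk (zero if the walk has terminated). -/
def trp (k : ℕ) (E : Finset (Finset V)) (x : Finset V → ℝ) (sa : Bool)
    (h : List V) (v : V) : ℝ :=
  stepw k E x sa h v / ∑ w : V, stepw k E x sa h w

/-- The distribution of the history (most-recent-first) of the `x`-walk after `j`
steps, given the distribution `ν` of the initial history. -/
def walkDist (k : ℕ) (E : Finset (Finset V)) (x : Finset V → ℝ) (sa : Bool)
    (ν : List V → ℝ) : ℕ → List V → ℝ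
  | 0, l => ν l
  | _+1, [] => 0
  | j+1, v :: t => walkDist k E x sa ν j t * trp k E x sa t v

/-- The probability that the `x`-walk is at the vertex `v` at time `q`. -/
def headProb (k : ℕ) (E : Finset (Finset V)) (x : Finset V → ℝ) (sa : Bool)
    (ν : List V → ℝ) (q : ℕ) (v : V) : ℝ :=
  ∑ f : Fin (k - 1 + q) → V,
    if (List.ofFn f).head? = some v then walkDist k E x sa ν q (List.ofFn f) else 0

/-- The initial history (most-recent-first) determined by a starting
`(k−1)`-tuple `S`. -/
def startList {k : ℕ} (S : Fin (k-1) → V) : List V := (List.ofFn S).reverse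

/-- The initial history distribution concentrated on the starting tuple `S`. -/
def startDist {k : ℕ} (S : Fin (k-1) → V) : List V → ℝ :=
  fun l => if l = startList S then 1 else 0

/-- One-step transition probability of the simple `x`-walk viewed as a Markov chain on
ordered `(k−1)`-tuples: from the tuple `S` the chain moves to the tuple obtained by
shifting `S` one place and appending a new vertex `v`, with probability
`x(S ∪ {v}) / Σ_w x(S ∪ {w})` (where `x` is zero on non-edges). -/
def chainP (k : ℕ) (E : Finset (Finset V)) (x : Finset V → ℝ)
    (S T : Fin (k-1) → V) : ℝ :=
  ∑ v : V,
    (if T = (fun i : Fin (k-1) =>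
        if h : (i : ℕ) + 1 < k - 1 then S ⟨(i : ℕ) + 1, h⟩ else v) then (1 : ℝ) else 0) *
      (xw E x (insert v (Finset.image S Finset.univ)) /
        ∑ w : V, xw E x (insert w (Finset.image S Finset.univ)))

/-- `π` is a stationary distribution of the simple `x`-walk Markov chain on ordered
`(k−1)`-tuples of distinct vertices: it is a probability distribution supported on
injective tuples and satisfies `π P = π`. -/
def IsStationaryDist (k : ℕ) (E : Finset (Finset V)) (x : Finset V → ℝ)
    (π : (Fin (k-1) → V) → ℝ) : Prop :=
  (∀ S, 0 ≤ π S) ∧ (∀ S, ¬ Function.Injective S → π S = 0) ∧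
    (∑ S : Fin (k-1) → V, π S = 1) ∧
    (∀ T : Fin (k-1) → V, ∑ S : Fin (k-1) → V, π S * chainP k E x S T = π T)

/-- The initial history distribution (histories most-recent-first) induced by a
distribution `μ` on ordered starting `(k−1)`-tuples. -/
def tupleInit (k : ℕ) (μ : (Fin (k-1) → V) → ℝ) : List V → ℝ :=
  fun l => ∑ S : Fin (k-1) → V, if l = (List.ofFn S).reverse then μ S else 0

/-- `x` is `a`-lower-balanced: every possible transition probability of an `x`-walk is
at least `a`. -/
def LowerBalanced (k : ℕ) (E : Finset (Finset V)) (x : Finset V → ℝ) (a : ℝ) : Prop :=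
  ∀ S : Finset V, S.card = k - 1 → (∃ u, insert u S ∈ E) →
    ∀ v, insert v S ∈ E →
      a ≤ x (insert v S) / (∑ v' : V, xw E x (insert v' S))

/-- The probability that an `x`-walk whose last `k - 1` vertices form the set `S` moves to `v`. -/
def nextProb (E : Finset (Finset V)) (x : Finset V → ℝ) (S : Finset V) (v : V) : ℝ :=
  xw E x (insert v S) / ∑ w : V, xw E x (insert w S)

/-- The one-step expectation operator of the simple `x`-walk, acting on functions of the history. -/
def stepExp (k : ℕ) (E : Finset (Finset V)) (x : Finset V → ℝ) (g : List V → ℝ)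
    (h : List V) : ℝ :=
  ∑ v : V, nextProb E x (h.take (k - 1)).toFinset v * g (v :: h)

/-- The indicator that the most recent vertex of the history lies in `T`. -/
def headInd (T : Finset V) (h : List V) : ℝ :=
  ∑ v ∈ T, if h.head? = some v then 1 else 0

/-- A history containing at least `k - 1` vertices, the last `k - 1` of which are distinct. -/
def IsProper (k : ℕ) (h : List V) : Prop :=
  k - 1 ≤ h.length ∧ (h.take (k - 1)).Nodup

/-- A positive `(τ / n)`-lower-balanced weighting of an `(n, k, γ)`-graph. -/
structure IsBalancedWeighting (k : ℕ) (E : Finset (Finset V)) (x : Finset V → ℝ)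
    (γ τ : ℝ) : Prop where
  two_le : 2 ≤ k
  le_card : k ≤ Fintype.card V
  uniform : ∀ e ∈ E, e.card = k
  codegree : ∀ S : Finset V, S.card = k - 1 →
    (1/2 + γ) * (Fintype.card V : ℝ) ≤ ((E.filter (fun e => S ⊆ e)).card : ℝ)
  pos : ∀ e ∈ E, 0 < x e
  balanced : LowerBalanced k E x (τ / (Fintype.card V : ℝ))

/-- If two distributions `p`, `p'` have overlap at least `β`, then coupling them optimally bounds
the difference of the expectations of `F` and `F'`. -/
theorem sum_mul_sub_sum_mul_le_of_overlap {ι : Type*} [Fintype ι] {p p' F F' : ι → ℝ} {β M A : ℝ}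
    (hp : ∀ v, 0 ≤ p v) (hp' : ∀ v, 0 ≤ p' v) (hp1 : ∑ v, p v = 1) (hp1' : ∑ v, p' v = 1)
    (hM : ∀ v v', 0 < p v → 0 < p' v' → F v - F' v' ≤ M)
    (hA : ∀ v, 0 < p v → 0 < p' v → F v - F' v ≤ A)
    (hAM : A ≤ M) (hβ : β ≤ ∑ v, min (p v) (p' v)) :
    ∑ v, p v * F v - ∑ v, p' v * F' v ≤ (1 - β) * M + β * A := by
  obtain ⟨u, hu, hmin⟩ := (Finset.univ.filter fun v => 0 < p' v).exists_min_image F' (by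
    by_contra hne
    rw [Finset.not_nonempty_iff_eq_empty, Finset.filter_eq_empty_iff] at hne
    have : ∑ v, p' v ≤ 0 := Finset.sum_nonpos fun v hv => not_lt.1 (hne hv)
    linarith)
  simp only [Finset.mem_filter, Finset.mem_univ, true_and] at hu hmin
  set r : ι → ℝ := fun v => min (p v) (p' v) with hr
  have h1 : ∑ v, r v * (F v - F' v) ≤ ∑ v, r v * A := by
    refine Finset.sum_le_sum fun v _ => ?_
    rcases (le_min (hp v) (hp' v)).eq_or_lt with h | h
    · simp [hr, ← h]
    · exact mul_le_mul_of_nonneg_left (hA v (lt_min_iff.1 h).1 (lt_min_iff.1 h).2) h.le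
  have h2 : ∑ v, (p v - r v) * F v ≤ ∑ v, (p v - r v) * (F' u + M) := by
    refine Finset.sum_le_sum fun v _ => ?_
    rcases (hp v).eq_or_lt with h | h
    · have : r v = 0 := by simp [hr, ← h, hp' v]
      simp [this, ← h]
    · refine mul_le_mul_of_nonneg_left ?_ (sub_nonneg.2 (min_le_left _ _))
      linarith [hM v u h hu]
  have h3 : ∑ v, (p' v - r v) * F' u ≤ ∑ v, (p' v - r v) * F' v := by
    refine Finset.sum_le_sum fun v _ => ?_
    rcases (hp' v).eq_or_lt with h | h
    · have : r v = 0 := by simp [hr, ← h, hp v]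
      simp [this, ← h]
    · exact mul_le_mul_of_nonneg_left (hmin v h) (sub_nonneg.2 (min_le_right _ _))
  simp only [sub_mul, mul_sub, Finset.sum_sub_distrib, ← Finset.sum_mul, hp1, hp1'] at h1 h2 h3
  nlinarith [mul_nonneg (sub_nonneg.2 hβ) (sub_nonneg.2 hAM)]

section Step

variable {k : ℕ} {E : Finset (Finset V)} {x : Finset V → ℝ} {γ τ : ℝ}

theorem trp_false (h : List V) (v : V) :
    trp k E x false h v = nextProb E x (h.take (k - 1)).toFinset v := by
  simp [trp, stepw, nextProb]

theorem stepExp_congr_take {g : List V → ℝ}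
    (hg : ∀ h h' : List V, h.take (k - 1) = h'.take (k - 1) → g h = g h') {h h' : List V}
    (hh : h.take (k - 1) = h'.take (k - 1)) : stepExp k E x g h = stepExp k E x g h' := by
  unfold stepExp
  rw [hh]
  refine Finset.sum_congr rfl fun v _ => ?_
  rw [hg (v :: h) (v :: h')]
  clear hg
  revert hh
  rcases k - 1 with _ | m <;> intro hh
  · simp
  · have := congrArg (List.take m) hh
    simp only [List.take_take] at this
    simpa using this

omit [Fintype V] in
theorem headInd_nil (T : Finset V) : headInd T [] = 0 := by simp [headInd]

omit [Fintype V] in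
theorem headInd_cons (T : Finset V) (v : V) (h : List V) :
    headInd T (v :: h) = if v ∈ T then 1 else 0 := by
  simp [headInd]

omit [Fintype V] in
theorem headInd_nonneg (T : Finset V) (h : List V) : 0 ≤ headInd T h :=
  Finset.sum_nonneg fun _ _ => by split_ifs <;> norm_num

omit [Fintype V] in
theorem headInd_le_one (T : Finset V) (h : List V) : headInd T h ≤ 1 := by
  cases h with
  | nil => simp [headInd_nil]
  | cons v h => rw [headInd_cons]; split_ifs <;> norm_num

omit [Fintype V] in
theorem headInd_congr_take (T : Finset V) {j : ℕ} (hj : 1 ≤ j) {h h' : List V}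
    (hh : h.take j = h'.take j) : headInd T h = headInd T h' := by
  obtain ⟨j, rfl⟩ := Nat.exists_eq_add_of_le' hj
  cases h <;> cases h' <;> simp_all [headInd_cons]

theorem iterate_stepExp_congr_take (hk : 2 ≤ k) (T : Finset V) (i : ℕ) :
    ∀ h h' : List V, h.take (k - 1) = h'.take (k - 1) →
      (stepExp k E x)^[i] (headInd T) h = (stepExp k E x)^[i] (headInd T) h' := by
  induction i with
  | zero => exact fun h h' hh => headInd_congr_take T (by omega) hh
  | succ i ih =>
    intro h h' hh
    rw [Function.iterate_succ_apply']
    exact stepExp_congr_take ih hh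

omit [Fintype V] in
theorem IsProper.card_toFinset {h : List V} (hh : IsProper k h) :
    (h.take (k - 1)).toFinset.card = k - 1 := by
  rw [List.toFinset_card_of_nodup hh.2, List.length_take, min_eq_left hh.1]

omit [Fintype V] in
theorem IsProper.cons {h : List V} (hh : IsProper k h) {v : V}
    (hv : v ∉ (h.take (k - 1)).toFinset) : IsProper k (v :: h) := by
  refine ⟨by simpa using hh.1.trans (Nat.le_succ _), ?_⟩
  have h1 := hh.2
  rw [List.mem_toFinset] at hv
  generalize k - 1 = m at *
  rcases m with _ | m
  · simp
  · have hs : List.Sublist (h.take m) (h.take (m + 1)) :=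
      (List.take_prefix_take_left (Nat.le_succ m)).sublist
    simpa using ⟨fun hmem => hv (hs.subset hmem), h1.sublist hs⟩

namespace IsBalancedWeighting

variable (hG : IsBalancedWeighting k E x γ τ)
include hG

theorem card_pos : (0 : ℝ) < Fintype.card V := by
  have := hG.two_le
  have := hG.le_card
  exact_mod_cast (by omega : 0 < Fintype.card V)

theorem xw_nonneg (e : Finset V) : 0 ≤ xw E x e := by
  unfold xw
  split_ifs with h
  · exact (hG.pos e h).le
  · rfl

theorem sum_xw_nonneg (S : Finset V) : 0 ≤ ∑ w : V, xw E x (insert w S) :=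
  Finset.sum_nonneg fun _ _ => hG.xw_nonneg _

theorem nextProb_nonneg (S : Finset V) (v : V) : 0 ≤ nextProb E x S v :=
  div_nonneg (hG.xw_nonneg _) (hG.sum_xw_nonneg S)

theorem le_card_neighbors {S : Finset V} (hS : S.card = k - 1) :
    (1/2 + γ) * (Fintype.card V : ℝ) ≤ ((Finset.univ.filter fun v => insert v S ∈ E).card : ℝ) := by
  refine (hG.codegree S hS).trans (Nat.cast_le.2 ?_)
  refine (Finset.card_le_card (t := (Finset.univ.filter fun v => insert v S ∈ E).image
    fun v => insert v S) fun e he => ?_).trans Finset.card_image_le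
  rw [Finset.mem_filter] at he
  have hk := hG.two_le
  obtain ⟨v, -, hv⟩ := Finset.exists_eq_insert_iff.2
    ⟨he.2, show S.card + 1 = e.card by rw [hG.uniform e he.1, hS]; omega⟩
  exact Finset.mem_image.2 ⟨v, by simpa [hv] using he.1, hv⟩

theorem sum_xw_pos (hγ : 0 < γ) {S : Finset V} (hS : S.card = k - 1) :
    0 < ∑ w : V, xw E x (insert w S) := by
  have h1 := hG.le_card_neighbors hS
  have h2 : (0 : ℝ) < (Finset.univ.filter fun v => insert v S ∈ E).card :=
    lt_of_lt_of_le (mul_pos (by linarith) hG.card_pos) h1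
  obtain ⟨v, hv⟩ := Finset.card_pos.1 (Nat.cast_pos.1 h2)
  have hv := (Finset.mem_filter.1 hv).2
  refine Finset.sum_pos' (fun _ _ => hG.xw_nonneg _) ⟨v, Finset.mem_univ v, ?_⟩
  rw [xw, if_pos hv]
  exact hG.pos _ hv

theorem sum_nextProb (hγ : 0 < γ) {S : Finset V} (hS : S.card = k - 1) :
    ∑ v, nextProb E x S v = 1 := by
  unfold nextProb
  rw [← Finset.sum_div, div_self (hG.sum_xw_pos hγ hS).ne']

theorem le_nextProb {S : Finset V} (hS : S.card = k - 1) {v : V} (hv : insert v S ∈ E) :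
    τ / (Fintype.card V : ℝ) ≤ nextProb E x S v := by
  rw [nextProb, xw, if_pos hv]
  exact hG.balanced S hS ⟨v, hv⟩ v hv

theorem notMem_of_nextProb_pos {S : Finset V} (hS : S.card = k - 1) {v : V}
    (hv : 0 < nextProb E x S v) : v ∉ S := by
  intro hmem
  have hE : insert v S ∉ E := fun hE => by
    have := hG.uniform _ hE
    have := hG.two_le
    rw [Finset.insert_eq_of_mem hmem] at *
    omega
  simp [nextProb, xw, hE] at hv

theorem overlap_nextProb (hγ : 0 < γ) (hτ : 0 < τ) {S S' : Finset V} (hS : S.card = k - 1)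
    (hS' : S'.card = k - 1) :
    γ * τ ≤ ∑ v, min (nextProb E x S v) (nextProb E x S' v) := by
  set N : Finset V := Finset.univ.filter fun v => insert v S ∈ E
  set N' : Finset V := Finset.univ.filter fun v => insert v S' ∈ E
  have hn := hG.card_pos
  have hcard : 2 * γ * (Fintype.card V : ℝ) ≤ ((N ∩ N').card : ℝ) := by
    have h1 := hG.le_card_neighbors hS
    have h2 := hG.le_card_neighbors hS'
    have h3 : ((N ∪ N').card : ℝ) + (N ∩ N').card = N.card + N'.card := by
      exact_mod_cast Finset.card_union_add_card_inter N N'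
    have h4 : ((N ∪ N').card : ℝ) ≤ Fintype.card V := by
      exact_mod_cast Finset.card_le_univ _
    linarith
  calc γ * τ ≤ 2 * γ * (Fintype.card V : ℝ) * (τ / Fintype.card V) := by
        field_simp
        linarith
    _ ≤ (N ∩ N').card * (τ / Fintype.card V) := by gcongr
    _ = ∑ v ∈ N ∩ N', τ / (Fintype.card V : ℝ) := by simp
    _ ≤ ∑ v ∈ N ∩ N', min (nextProb E x S v) (nextProb E x S' v) := by
        refine Finset.sum_le_sum fun v hv => ?_
        obtain ⟨hv, hv'⟩ := Finset.mem_inter.1 hv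
        exact le_min (hG.le_nextProb hS (Finset.mem_filter.1 hv).2)
          (hG.le_nextProb hS' (Finset.mem_filter.1 hv').2)
    _ ≤ _ := Finset.sum_le_univ_sum_of_nonneg fun v =>
        le_min (hG.nextProb_nonneg _ _) (hG.nextProb_nonneg _ _)

/-- Coupling two walks one step at a time: the longer the common recent history, the smaller
the difference between the expectations. -/
theorem iterate_stepExp_sub_le (hγ : 0 < γ) (hτ : 0 < τ) (hγτ : γ * τ ≤ 1) (T : Finset V)
    (i : ℕ) : ∀ j ≤ k - 1, ∀ h h' : List V, IsProper k h → IsProper k h' →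
      h.take j = h'.take j →
      (1 - (γ * τ / 2) ^ (k - 1)) *
          ((stepExp k E x)^[i] (headInd T) h - (stepExp k E x)^[i] (headInd T) h') ≤
        (1 - (γ * τ / 2) ^ (k - 1 - j)) * (1 - (γ * τ / 2) ^ (k - 1)) ^ i := by
  have hk := hG.two_le
  set δ := γ * τ / 2 with hδ
  set θ := 1 - δ ^ (k - 1) with hθ
  have hδ0 : 0 < δ := by positivity
  have hδ1 : δ ≤ 1 / 2 := by rw [hδ]; linarith
  have hθ0 : 0 < θ := sub_pos.2 (pow_lt_one₀ hδ0.le (by linarith) (by omega))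
  have hθ1 : θ ≤ 1 := by rw [hθ]; linarith [pow_pos hδ0 (k - 1)]
  induction i with
  | zero =>
    intro j hj h h' _ _ hh
    simp only [Function.iterate_zero, id_eq, pow_zero, mul_one]
    rcases Nat.eq_zero_or_pos j with rfl | hj0
    · rw [Nat.sub_zero, ← hθ]
      nlinarith [headInd_nonneg T h', headInd_le_one T h]
    · rw [headInd_congr_take T hj0 hh, sub_self, mul_zero]
      exact sub_nonneg.2 (pow_le_one₀ hδ0.le (by linarith))
  | succ i ih =>
    intro j hj h h' hp hp' hh
    rcases hj.eq_or_lt with rfl | hj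
    · rw [iterate_stepExp_congr_take hk T (i + 1) h h' hh]
      simp
    have hS := hp.card_toFinset
    have hS' := hp'.card_toFinset
    rw [Function.iterate_succ_apply', stepExp, stepExp]
    have hcouple := sum_mul_sub_sum_mul_le_of_overlap (β := 2 * δ) (M := θ ^ i)
      (A := (1 - δ ^ (k - 1 - (j + 1))) * θ ^ i / θ)
      (F := fun v => (stepExp k E x)^[i] (headInd T) (v :: h))
      (F' := fun v => (stepExp k E x)^[i] (headInd T) (v :: h'))
      (hG.nextProb_nonneg (h.take (k - 1)).toFinset)
      (hG.nextProb_nonneg (h'.take (k - 1)).toFinset)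
      (hG.sum_nextProb hγ hS) (hG.sum_nextProb hγ hS')
      (fun v v' hv hv' => by
        have := ih 0 (Nat.zero_le _) (v :: h) (v' :: h')
          (hp.cons (hG.notMem_of_nextProb_pos hS hv))
          (hp'.cons (hG.notMem_of_nextProb_pos hS' hv')) (by simp)
        rw [Nat.sub_zero, ← hθ] at this
        exact le_of_mul_le_mul_left this hθ0)
      (fun v hv hv' => by
        rw [le_div_iff₀' hθ0]
        exact ih (j + 1) hj (v :: h) (v :: h')
          (hp.cons (hG.notMem_of_nextProb_pos hS hv))
          (hp'.cons (hG.notMem_of_nextProb_pos hS' hv')) (by simp [hh]))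
      (by
        rw [div_le_iff₀ hθ0, mul_comm]
        refine mul_le_mul_of_nonneg_left ?_ (pow_pos hθ0 i).le
        exact sub_le_sub_left (pow_le_pow_of_le_one hδ0.le (by linarith) (by omega)) 1)
      (by rw [hδ]; linarith [hG.overlap_nextProb hγ hτ hS hS'])
    refine (mul_le_mul_of_nonneg_left hcouple hθ0.le).trans ?_
    have he : δ ^ (k - 1 - j) = δ * δ ^ (k - 1 - (j + 1)) := by
      rw [← pow_succ']; congr 1; omega
    have hle : δ ^ (k - 1) ≤ δ ^ (k - 1 - j) :=
      pow_le_pow_of_le_one hδ0.le (by linarith) (by omega)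
    have hd0 : 0 < δ ^ (k - 1 - j) := pow_pos hδ0 _
    have hm0 : 0 < δ ^ (k - 1) := pow_pos hδ0 _
    calc θ * ((1 - 2 * δ) * θ ^ i + 2 * δ * ((1 - δ ^ (k - 1 - (j + 1))) * θ ^ i / θ))
        = θ ^ i * ((1 - 2 * δ) * θ + 2 * δ - 2 * δ ^ (k - 1 - j)) := by
          rw [he]; field_simp; ring
      _ ≤ θ ^ i * ((1 - δ ^ (k - 1 - j)) * θ) := by
          refine mul_le_mul_of_nonneg_left ?_ (pow_pos hθ0 i).le
          nlinarith
      _ = (1 - δ ^ (k - 1 - j)) * θ ^ (i + 1) := by ring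

end IsBalancedWeighting

end Step

section Tuples

variable {k : ℕ} {E : Finset (Finset V)} {x : Finset V → ℝ} {γ τ : ℝ}

omit [DecidableEq V] in
theorem sum_ofFn_cons (n : ℕ) (Φ : List V → ℝ) :
    ∑ f : Fin (n + 1) → V, Φ (List.ofFn f) = ∑ f : Fin n → V, ∑ v, Φ (v :: List.ofFn f) := by
  rw [← (Fin.consEquiv fun _ : Fin (n + 1) => V).sum_comp, Fintype.sum_prod_type,
    Finset.sum_comm]
  simp [Fin.consEquiv, List.ofFn_succ]

omit [DecidableEq V] in
theorem sum_ofFn_append (n : ℕ) (Φ : List V → ℝ) :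
    ∑ f : Fin (n + 1) → V, Φ (List.ofFn f) = ∑ f : Fin n → V, ∑ v, Φ (List.ofFn f ++ [v]) := by
  rw [← (Fin.snocEquiv fun _ : Fin (n + 1) => V).sum_comp, Fintype.sum_prod_type,
    Finset.sum_comm]
  simp only [Fin.snocEquiv, Equiv.coe_fn_mk, List.ofFn_succ', List.concat_eq_append,
    Fin.snoc_castSucc, Fin.snoc_last]

omit [Fintype V] [DecidableEq V] in
theorem reverse_ofFn {n : ℕ} (f : Fin n → V) :
    (List.ofFn f).reverse = List.ofFn (f ∘ Fin.rev) := by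
  refine List.ext_getElem (by simp) fun i h _ => ?_
  simp only [List.length_reverse, List.length_ofFn] at h
  simp only [List.getElem_reverse, List.getElem_ofFn, Function.comp_apply, List.length_ofFn]
  congr 1
  ext
  simp [Fin.val_rev]
  omega

omit [DecidableEq V] in
theorem sum_reverse_ofFn (n : ℕ) (Φ : List V → ℝ) :
    ∑ f : Fin n → V, Φ (List.ofFn f).reverse = ∑ f : Fin n → V, Φ (List.ofFn f) := by
  simp only [reverse_ofFn]
  exact (Equiv.arrowCongr Fin.revPerm (Equiv.refl V)).sum_comp fun f => Φ (List.ofFn f)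

/-- The expectation of `g` under a distribution `μ` of ordered tuples, `g` being evaluated at the
history that lists the tuple most recent vertex first. -/
def tupleExp {m : ℕ} (μ : (Fin m → V) → ℝ) (g : List V → ℝ) : ℝ :=
  ∑ S : Fin m → V, μ S * g (List.ofFn S).reverse

theorem sum_tupleInit_mul (μ : (Fin (k - 1) → V) → ℝ) (g : List V → ℝ) :
    ∑ f : Fin (k - 1) → V, tupleInit k μ (List.ofFn f) * g (List.ofFn f) = tupleExp μ g := by
  simp only [tupleInit, Finset.sum_mul, tupleExp]
  rw [Finset.sum_comm]
  refine Finset.sum_congr rfl fun S _ => ?_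
  simp only [reverse_ofFn, List.ofFn_injective.eq_iff, ite_mul, zero_mul]
  rw [Finset.sum_ite_eq' Finset.univ (S ∘ Fin.rev), if_pos (Finset.mem_univ _)]

theorem sum_walkDist_mul (ν : List V → ℝ) (q : ℕ) (g : List V → ℝ) :
    ∑ f : Fin (k - 1 + q) → V, walkDist k E x false ν q (List.ofFn f) * g (List.ofFn f) =
      ∑ f : Fin (k - 1) → V, ν (List.ofFn f) * (stepExp k E x)^[q] g (List.ofFn f) := by
  induction q generalizing g with
  | zero => rfl
  | succ q ih =>
    rw [Function.iterate_succ_apply, ← ih]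
    refine (sum_ofFn_cons (k - 1 + q)
      fun l => walkDist k E x false ν (q + 1) l * g l).trans ?_
    simp only [walkDist, trp_false, stepExp, Finset.mul_sum, mul_assoc]

theorem sum_headProb (μ : (Fin (k - 1) → V) → ℝ) (q : ℕ) (T : Finset V) :
    ∑ v ∈ T, headProb k E x false (tupleInit k μ) q v =
      tupleExp μ ((stepExp k E x)^[q] (headInd T)) := by
  rw [← sum_tupleInit_mul, ← sum_walkDist_mul]
  simp only [headProb, headInd, Finset.mul_sum, mul_ite, mul_one, mul_zero]
  exact Finset.sum_comm

omit [Fintype V] [DecidableEq V] in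
theorem isProper_reverse_ofFn {S : Fin (k - 1) → V} (hS : Function.Injective S) :
    IsProper k (List.ofFn S).reverse := by
  refine ⟨by simp, ?_⟩
  rw [List.take_of_length_le (by simp), List.nodup_reverse]
  exact List.nodup_ofFn.2 hS

omit [DecidableEq V] in
theorem tupleExp_mono {μ : (Fin (k - 1) → V) → ℝ} (hμ : ∀ S, 0 ≤ μ S) {g g' : List V → ℝ}
    (hg : ∀ h, g h ≤ g' h) : tupleExp μ g ≤ tupleExp μ g' :=
  Finset.sum_le_sum fun S _ => mul_le_mul_of_nonneg_left (hg _) (hμ S)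

theorem tupleExp_sub_le {μ ν : (Fin (k - 1) → V) → ℝ} (hμ : ∀ S, 0 ≤ μ S)
    (hμi : ∀ S, ¬ Function.Injective S → μ S = 0) (hμ1 : ∑ S, μ S = 1) (hν : ∀ S, 0 ≤ ν S)
    (hνi : ∀ S, ¬ Function.Injective S → ν S = 0) (hν1 : ∑ S, ν S = 1) {g : List V → ℝ} {c : ℝ}
    (hg : ∀ h h', IsProper k h → IsProper k h' → g h - g h' ≤ c) :
    tupleExp μ g - tupleExp ν g ≤ c := by
  have h1 : tupleExp μ g - tupleExp ν g =
      ∑ S, ∑ S', μ S * ν S' * (g (List.ofFn S).reverse - g (List.ofFn S').reverse) := by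
    simp only [mul_sub, Finset.sum_sub_distrib]
    congr 1
    · refine Finset.sum_congr rfl fun S _ => ?_
      rw [← Finset.sum_mul, ← Finset.mul_sum, hν1, mul_one]
    · rw [Finset.sum_comm]
      refine Finset.sum_congr rfl fun S' _ => ?_
      rw [← Finset.sum_mul, ← Finset.sum_mul, hμ1, one_mul]
  have h2 : c = ∑ S, ∑ S', μ S * ν S' * c := by
    simp only [← Finset.sum_mul, ← Finset.mul_sum, hν1, hμ1, one_mul, mul_one]
  rw [h1, h2]
  refine Finset.sum_le_sum fun S _ => Finset.sum_le_sum fun S' _ => ?_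
  by_cases hS : Function.Injective S
  · by_cases hS' : Function.Injective S'
    · exact mul_le_mul_of_nonneg_left
        (hg _ _ (isProper_reverse_ofFn hS) (isProper_reverse_ofFn hS'))
        (mul_nonneg (hμ S) (hν S'))
    · simp [hνi S' hS']
  · simp [hμi S hS]

omit [Fintype V] in
theorem take_reverse_ofFn_toFinset {m : ℕ} (S : Fin m → V) :
    ((List.ofFn S).reverse.take m).toFinset = Finset.image S Finset.univ := by
  rw [List.take_of_length_le (by simp)]
  ext v
  simp

/-- A distribution invariant under the Markov chain on tuples has invariant expectations. -/
theorem tupleExp_stepExp_of_isStationaryDist (hk : 2 ≤ k) {π : (Fin (k - 1) → V) → ℝ}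
    (hπ : IsStationaryDist k E x π) {g : List V → ℝ}
    (hg : ∀ h h' : List V, h.take (k - 1) = h'.take (k - 1) → g h = g h') :
    tupleExp π (stepExp k E x g) = tupleExp π g := by
  have h1 : tupleExp π g =
      ∑ T : Fin (k - 1) → V, (∑ S, π S * chainP k E x S T) * g (List.ofFn T).reverse :=
    Finset.sum_congr rfl fun T _ => by rw [hπ.2.2.2 T]
  rw [h1]
  simp only [Finset.sum_mul]
  rw [Finset.sum_comm]
  refine Finset.sum_congr rfl fun S _ => ?_
  simp only [mul_assoc]
  rw [← Finset.mul_sum]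
  congr 1
  simp only [stepExp, chainP, Finset.sum_mul]
  rw [Finset.sum_comm]
  refine Finset.sum_congr rfl fun v _ => ?_
  simp only [ite_mul, one_mul, zero_mul]
  rw [Finset.sum_ite_eq' Finset.univ, if_pos (Finset.mem_univ _), take_reverse_ofFn_toFinset]
  refine congrArg _ (hg _ _ ?_)
  refine List.ext_getElem (by simp) fun i h h' => ?_
  simp only [List.length_take, List.length_cons, List.length_reverse, List.length_ofFn] at h h'
  rcases i with _ | i
  · simp [show ¬ (k - 1 - 1 + 1 < k - 1) by omega]
  · simp only [List.getElem_take, List.getElem_cons_succ, List.getElem_reverse, List.getElem_ofFn,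
      List.length_ofFn]
    rw [dif_pos (by omega)]
    congr 2
    omega

/-- The weighted degree of the set of entries of a tuple. -/
def tupleDeg (E : Finset (Finset V)) (x : Finset V → ℝ) {m : ℕ} (S : Fin m → V) : ℝ :=
  ∑ w : V, xw E x (insert w (List.ofFn S).toFinset)

namespace IsBalancedWeighting

variable (hG : IsBalancedWeighting k E x γ τ)
include hG

theorem tupleDeg_mul_nextProb {m : ℕ} (S : Fin m → V) (v : V) :
    tupleDeg E x S * nextProb E x (List.ofFn S).toFinset v =
      xw E x (insert v (List.ofFn S).toFinset) := by
  rw [nextProb]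
  change tupleDeg E x S * (_ / tupleDeg E x S) = _
  by_cases h : tupleDeg E x S = 0
  · rw [h, zero_mul]
    exact ((Finset.sum_eq_zero_iff_of_nonneg fun _ _ => hG.xw_nonneg _).1 h v
      (Finset.mem_univ v)).symm
  · field_simp

/-- The weighted degree is an invariant measure of the walk. -/
theorem tupleExp_stepExp_tupleDeg {g : List V → ℝ}
    (hg : ∀ h h' : List V, h.take (k - 1) = h'.take (k - 1) → g h = g h') :
    tupleExp (m := k - 1) (tupleDeg E x) (stepExp k E x g) =
      tupleExp (m := k - 1) (tupleDeg E x) g := by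
  have hdeg : ∀ G : List V → ℝ, tupleExp (m := k - 1) (tupleDeg E x) G =
      ∑ f : Fin (k - 1) → V, tupleDeg E x f * G (List.ofFn f) := fun G => by
    simp only [tupleExp, tupleDeg]
    rw [← sum_reverse_ofFn (k - 1) fun l => (∑ w : V, xw E x (insert w l.toFinset)) * G l]
    simp only [List.toFinset_reverse]
  rw [hdeg, hdeg]
  have htake : ∀ f : Fin (k - 1) → V, (List.ofFn f).take (k - 1) = List.ofFn f :=
    fun f => List.take_of_length_le (by simp)
  calc ∑ f : Fin (k - 1) → V, tupleDeg E x f * stepExp k E x g (List.ofFn f)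
      = ∑ f : Fin (k - 1) → V, ∑ v,
          xw E x (v :: List.ofFn f).toFinset * g (v :: List.ofFn f) := by
        refine Finset.sum_congr rfl fun f _ => ?_
        rw [stepExp, Finset.mul_sum]
        refine Finset.sum_congr rfl fun v _ => ?_
        rw [htake, ← mul_assoc, hG.tupleDeg_mul_nextProb, List.toFinset_cons]
    _ = ∑ f : Fin (k - 1) → V, ∑ v,
          xw E x (List.ofFn f ++ [v]).toFinset * g (List.ofFn f ++ [v]) := by
        rw [← sum_ofFn_cons (k - 1) fun l => xw E x l.toFinset * g l,
          sum_ofFn_append (k - 1) fun l => xw E x l.toFinset * g l]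
    _ = _ := by
        refine Finset.sum_congr rfl fun f _ => ?_
        rw [tupleDeg, Finset.sum_mul]
        refine Finset.sum_congr rfl fun v _ => ?_
        rw [hg (List.ofFn f ++ [v]) (List.ofFn f) (by simp), List.toFinset_append,
          Finset.union_comm]
        rfl

theorem tupleDeg_nonneg {m : ℕ} (S : Fin m → V) : 0 ≤ tupleDeg E x S :=
  hG.sum_xw_nonneg _

theorem tupleDeg_pos (hγ : 0 < γ) {S : Fin (k - 1) → V} (hS : Function.Injective S) :
    0 < tupleDeg E x S := by
  refine hG.sum_xw_pos hγ ?_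
  rw [List.toFinset_card_of_nodup (List.nodup_ofFn.2 hS), List.length_ofFn]

theorem tupleDeg_eq_zero {S : Fin (k - 1) → V} (hS : ¬ Function.Injective S) :
    tupleDeg E x S = 0 := by
  refine Finset.sum_eq_zero fun w _ => if_neg fun hE => ?_
  have h1 := hG.uniform _ hE
  have h2 := Finset.card_insert_le w (List.ofFn S).toFinset
  have h3 : (List.ofFn S).toFinset.card ≠ k - 1 := fun h => by
    refine hS (List.nodup_ofFn.1 ?_)
    rw [← Multiset.coe_nodup, ← Multiset.toFinset_card_eq_card_iff_nodup]
    simpa using h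
  have h4 := List.toFinset_card_le (List.ofFn S)
  rw [List.length_ofFn] at h4
  omega

theorem exists_injective_headInd_eq_one (v : V) :
    ∃ S : Fin (k - 1) → V, Function.Injective S ∧ headInd {v} (List.ofFn S).reverse = 1 := by
  have hk := hG.two_le
  obtain ⟨e⟩ := Function.Embedding.nonempty_of_card_le (α := Fin (k - 1)) (β := V)
    (by rw [Fintype.card_fin]; exact (Nat.sub_le k 1).trans hG.le_card)
  refine ⟨Equiv.swap (e ⟨k - 2, by omega⟩) v ∘ e, (Equiv.injective _).comp e.injective, ?_⟩
  have hhead : (List.ofFn (Equiv.swap (e ⟨k - 2, by omega⟩) v ∘ e)).reverse.head? = some v := by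
    rw [List.head?_reverse, List.getLast?_eq_getElem?, List.length_ofFn, List.getElem?_ofFn,
      dif_pos (by omega)]
    simp [show k - 1 - 1 = k - 2 by omega]
  simp [headInd, hhead]

theorem tupleExp_iterate_stepExp {μ : (Fin (k - 1) → V) → ℝ}
    (hμ : ∀ g : List V → ℝ, (∀ h h' : List V, h.take (k - 1) = h'.take (k - 1) → g h = g h') →
      tupleExp μ (stepExp k E x g) = tupleExp μ g) (T : Finset V) (i : ℕ) :
    tupleExp μ ((stepExp k E x)^[i] (headInd T)) = tupleExp μ (headInd T) := by
  induction i with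
  | zero => rfl
  | succ i ih =>
    rw [Function.iterate_succ_apply', hμ _ (iterate_stepExp_congr_take hG.two_le T i), ih]

/-- Exponential forgetting of the initial distribution. -/
theorem tupleExp_iterate_stepExp_sub_le (hγ : 0 < γ) (hτ : 0 < τ) (hγτ : γ * τ ≤ 1)
    {μ ν : (Fin (k - 1) → V) → ℝ} (hμ : ∀ S, 0 ≤ μ S)
    (hμi : ∀ S, ¬ Function.Injective S → μ S = 0) (hμ1 : ∑ S, μ S = 1) (hν : ∀ S, 0 ≤ ν S)
    (hνi : ∀ S, ¬ Function.Injective S → ν S = 0) (hν1 : ∑ S, ν S = 1) (T : Finset V) (i : ℕ) :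
    tupleExp μ ((stepExp k E x)^[i] (headInd T)) - tupleExp ν ((stepExp k E x)^[i] (headInd T)) ≤
      (1 - (γ * τ / 2) ^ (k - 1)) ^ i := by
  refine tupleExp_sub_le hμ hμi hμ1 hν hνi hν1 fun h h' hh hh' => ?_
  have hk := hG.two_le
  have hle := hG.iterate_stepExp_sub_le hγ hτ hγτ T i 0 (Nat.zero_le _) h h' hh hh' (by simp)
  refine le_of_mul_le_mul_left hle (sub_pos.2 (pow_lt_one₀ (by positivity) ?_ (by omega)))
  linarith

/-- Every vertex has positive probability under a stationary distribution. -/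
theorem tupleExp_headInd_pos (hγ : 0 < γ) (hτ : 0 < τ) (hγτ : γ * τ ≤ 1)
    {π : (Fin (k - 1) → V) → ℝ} (hπ : IsStationaryDist k E x π) (v : V) :
    0 < tupleExp π (headInd {v}) := by
  have hk := hG.two_le
  obtain ⟨S, hS, hSv⟩ := hG.exists_injective_headInd_eq_one v
  set N : ℝ := ∑ S : Fin (k - 1) → V, tupleDeg E x S with hN
  have hN0 : 0 < N := Finset.sum_pos' (fun S _ => hG.tupleDeg_nonneg S)
    ⟨S, Finset.mem_univ S, hG.tupleDeg_pos hγ hS⟩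
  have hdiv : ∀ g : List V → ℝ, tupleExp (m := k - 1) (fun S => tupleDeg E x S / N) g =
      tupleExp (m := k - 1) (tupleDeg E x) g / N := fun g => by
    simp [tupleExp, div_mul_eq_mul_div, Finset.sum_div]
  have hpos : 0 < tupleExp (m := k - 1) (tupleDeg E x) (headInd {v}) :=
    Finset.sum_pos' (fun S _ => mul_nonneg (hG.tupleDeg_nonneg S) (headInd_nonneg _ _))
      ⟨S, Finset.mem_univ S, by rw [hSv, mul_one]; exact hG.tupleDeg_pos hγ hS⟩
  have hle : ∀ i : ℕ, tupleExp (m := k - 1) (fun S => tupleDeg E x S / N) (headInd {v}) -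
      tupleExp π (headInd {v}) ≤ (1 - (γ * τ / 2) ^ (k - 1)) ^ i := fun i => by
    rw [← hG.tupleExp_iterate_stepExp
        (fun g hg => tupleExp_stepExp_of_isStationaryDist hk hπ hg) {v} i,
      ← hG.tupleExp_iterate_stepExp
        (fun g hg => by rw [hdiv, hdiv, hG.tupleExp_stepExp_tupleDeg hg]) {v} i]
    refine hG.tupleExp_iterate_stepExp_sub_le hγ hτ hγτ
      (fun S => div_nonneg (hG.tupleDeg_nonneg S) hN0.le)
      (fun S hS => by rw [hG.tupleDeg_eq_zero hS, zero_div])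
      (by rw [← Finset.sum_div, ← hN, div_self hN0.ne']) hπ.1 hπ.2.1 hπ.2.2.1 {v} i
  have hδ0 : 0 < (γ * τ / 2) ^ (k - 1) := by positivity
  have hδ1 : (γ * τ / 2) ^ (k - 1) ≤ 1 := pow_le_one₀ (by positivity) (by linarith)
  have hlim := ge_of_tendsto' (tendsto_pow_atTop_nhds_zero_of_lt_one
    (sub_nonneg.2 hδ1) (sub_lt_self 1 hδ0)) hle
  rw [hdiv] at hlim
  linarith [div_pos hpos hN0]

/-- The distribution of the last vertex of a stationary tuple is not singular to any other
distribution. -/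
theorem abs_tupleExp_headInd_sub_lt_one (hγ : 0 < γ) (hτ : 0 < τ) (hγτ : γ * τ ≤ 1)
    {μ π : (Fin (k - 1) → V) → ℝ} (hμ : ∀ S, 0 ≤ μ S) (hμ1 : ∑ S, μ S = 1)
    (hπ : IsStationaryDist k E x π) (T : Finset V) :
    |tupleExp μ (headInd T) - tupleExp π (headInd T)| < 1 := by
  have hk := hG.two_le
  have hconst : ∀ ν : (Fin (k - 1) → V) → ℝ, ∑ S, ν S = 1 → tupleExp ν (fun _ => 1) = 1 :=
    fun ν hν => by simpa [tupleExp] using hν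
  have hzero : ∀ ν : (Fin (k - 1) → V) → ℝ, tupleExp ν (fun _ => 0) = 0 := by simp [tupleExp]
  have hμ_le := tupleExp_mono hμ (headInd_le_one T)
  have hμ_nonneg := tupleExp_mono hμ (headInd_nonneg T)
  have hπ_le := tupleExp_mono hπ.1 (headInd_le_one T)
  have hπ_nonneg := tupleExp_mono hπ.1 (headInd_nonneg T)
  rw [hconst _ hμ1] at hμ_le
  rw [hconst _ hπ.2.2.1] at hπ_le
  rw [hzero] at hμ_nonneg hπ_nonneg
  rw [abs_sub_lt_iff]
  constructor
  · rcases T.eq_empty_or_nonempty with rfl | ⟨v, hv⟩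
    · simp [headInd, tupleExp]
    · have := tupleExp_mono hπ.1 (g := headInd {v}) (g' := headInd T) fun h => by
        unfold headInd
        exact Finset.sum_le_sum_of_subset_of_nonneg (Finset.singleton_subset_iff.2 hv)
          fun _ _ _ => by split_ifs <;> norm_num
      linarith [hG.tupleExp_headInd_pos hγ hτ hγτ hπ v]
  · by_cases hT : ∃ v, v ∉ T
    · obtain ⟨v, hv⟩ := hT
      have hadd : tupleExp π (headInd (insert v T)) =
          tupleExp π (headInd {v}) + tupleExp π (headInd T) := by
        simp only [tupleExp, headInd, Finset.sum_insert hv, Finset.sum_singleton, mul_add,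
          Finset.sum_add_distrib]
      have := tupleExp_mono hπ.1 (headInd_le_one (insert v T))
      rw [hconst _ hπ.2.2.1] at this
      linarith [hG.tupleExp_headInd_pos hγ hτ hγτ hπ v]
    · push Not at hT
      have hone : ∀ ν : (Fin (k - 1) → V) → ℝ, ∑ S, ν S = 1 → tupleExp ν (headInd T) = 1 := by
        intro ν hν
        rw [← hconst ν hν]
        refine Finset.sum_congr rfl fun S _ => ?_
        congr 1
        rcases h : (List.ofFn S).reverse with _ | ⟨v, l⟩
        · have := congrArg List.length h
          simp only [List.length_reverse, List.length_ofFn, List.length_nil] at this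
          omega
        · simp [headInd_cons, hT]
      rw [hone _ hμ1, hone _ hπ.2.2.1]
      norm_num

end IsBalancedWeighting

end Tuples

/-- Lemma 5.5 (Mixing Lemma). For an `(n,k,γ)`-graph `G` (with `n` large), a positive
`(τ/n)`-lower-balanced edge weighting `x`, any initial distribution `μ` on ordered
`(k−1)`-tuples of distinct vertices, and the stationary `x`-walk `W` (the simple
`x`-walk whose initial distribution is a stationary distribution `π`): for any `η > 0`
and any `q ≥ λ ln(1/η)`, the total variation distance between the time-`q` positions
`Y_q` and `W_q` is less than `η`. -/
theorem stmt_12 (k : ℕ) (hk : 2 ≤ k) (γ τ : ℝ)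
    (hγ0 : 0 < γ) (hγ1 : γ ≤ 1) (hτ0 : 0 < τ) (hτ1 : τ ≤ 1) :
    ∃ lam : ℝ, 0 < lam ∧ ∃ n₀ : ℕ, ∀ n : ℕ, n₀ ≤ n →
    ∀ E : Finset (Finset (Fin n)),
      (∀ e ∈ E, e.card = k) →
      (∀ S : Finset (Fin n), S.card = k - 1 →
        (1/2 + γ) * (n : ℝ) ≤ ((E.filter (fun e => S ⊆ e)).card : ℝ)) →
    ∀ x : Finset (Fin n) → ℝ, (∀ e ∈ E, 0 < x e) →
      LowerBalanced k E x (τ / (n : ℝ)) →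
    ∀ μ : (Fin (k-1) → Fin n) → ℝ,
      (∀ S, 0 ≤ μ S) → (∀ S, ¬ Function.Injective S → μ S = 0) →
      (∑ S : Fin (k-1) → Fin n, μ S = 1) →
    ∀ π : (Fin (k-1) → Fin n) → ℝ, IsStationaryDist k E x π →
    ∀ η : ℝ, 0 < η → ∀ q : ℕ, lam * Real.log (1/η) ≤ (q : ℝ) →
    ∀ T : Finset (Fin n),
      |(∑ v ∈ T, headProb k E x false (tupleInit k μ) q v) -
       (∑ v ∈ T, headProb k E x false (tupleInit k π) q v)| < η := by
  have hγτ0 : 0 < γ * τ := mul_pos hγ0 hτ0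
  have hγτ : γ * τ ≤ 1 := mul_le_one₀ hγ1 hτ0.le hτ1
  set θ : ℝ := 1 - (γ * τ / 2) ^ (k - 1) with hθ
  have hθ0 : 0 < θ := sub_pos.2 (pow_lt_one₀ (by positivity) (by linarith) (by omega))
  have hθ1 : θ < 1 := sub_lt_self 1 (by positivity)
  have hlog : Real.log θ < 0 := Real.log_neg hθ0 hθ1
  refine ⟨2 / -Real.log θ, div_pos two_pos (neg_pos.2 hlog), k, ?_⟩
  intro n hn E huni hcodeg x hx hbal μ hμ hμi hμ1 π hπ η hη q hq T
  have hG : IsBalancedWeighting k E x γ τ :=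
    ⟨hk, by simpa using hn, huni, by simpa using hcodeg, hx, by simpa using hbal⟩
  rw [sum_headProb, sum_headProb]
  rw [one_div, Real.log_inv, div_mul_eq_mul_div, div_le_iff₀ (neg_pos.2 hlog)] at hq
  rcases Nat.eq_zero_or_pos q with rfl | hq0
  · have hη1 : 1 ≤ η := by
      rw [Nat.cast_zero, zero_mul] at hq
      exact (Real.log_nonneg_iff hη).1 (by linarith)
    exact (hG.abs_tupleExp_headInd_sub_lt_one hγ0 hτ0 hγτ hμ hμ1 hπ T).trans_le hη1
  · have hlt : θ ^ q < η := by
      rw [← Real.log_lt_log_iff (pow_pos hθ0 q) hη, Real.log_pow]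
      have hq1 : (0 : ℝ) < q := Nat.cast_pos.2 hq0
      nlinarith [mul_pos hq1 (neg_pos.2 hlog)]
    refine lt_of_le_of_lt (abs_sub_le_iff.2 ⟨?_, ?_⟩) hlt
    · exact hG.tupleExp_iterate_stepExp_sub_le hγ0 hτ0 hγτ hμ hμi hμ1 hπ.1 hπ.2.1 hπ.2.2.1 T q
    · exact hG.tupleExp_iterate_stepExp_sub_le hγ0 hτ0 hγτ hπ.1 hπ.2.1 hπ.2.2.1 hμ hμi hμ1 T q
end
end
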